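/- Let ι be a type of cardinality ℵ₁ and let M be a functionally open subset of ι → ℝ (product topology), i.e., M = f⁻¹((0,1]) for some continuous f : (ι → ℝ) → [0,1]. Then the set of all nonempty compact max-plus convex subsets of ι → ℝ that are contained in M, endowed with the Vietoris topology, is homeomorphic to M. -/

import Mathlib

/-- Max-plus convexity. -/
def MaxPlusConvex {ι : Type*} (A : Set (ι → ℝ)) : Prop :=
  ∀ a ∈ A, ∀ b ∈ A, ∀ t : ℝ, t ≤ 0 → (fun i => max (a i) (t + b i)) ∈ A

/-- The Vietoris topology on a family of subsets of a topological space `X`. -/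
def vietoris {X : Type*} [TopologicalSpace X] (P : Set X → Prop) :
    TopologicalSpace {A : Set X // P A} :=
  TopologicalSpace.generateFrom
    {S | ∃ U : Set X, IsOpen U ∧
      (S = {K : {A : Set X // P A} | (K : Set X) ⊆ U} ∨
        S = {K : {A : Set X // P A} | ((K : Set X) ∩ U).Nonempty})}

open Set Filter Topology TopologicalSpace
open scoped ZeroAtInfty

/-! ### Reparametrisation by increasing sequences -/

/-- `x` is strictly increasing and lies strictly above `a`. -/
def StrictAbove (a x : ℕ → ℝ) : Prop :=
  a 0 < x 0 ∧ ∀ k, a (k + 1) < x (k + 1) ∧ x k < x (k + 1)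

lemma StrictAbove.strictMono {a x : ℕ → ℝ} (h : StrictAbove a x) : StrictMono x :=
  strictMono_nat_of_lt_succ fun k => (h.2 k).2

lemma StrictAbove.lt {a x : ℕ → ℝ} (h : StrictAbove a x) (k : ℕ) : a k < x k := by
  cases k with
  | zero => exact h.1
  | succ k => exact (h.2 k).1

lemma strictAbove_iff {a x : ℕ → ℝ} :
    StrictAbove a x ↔ (∀ k, a k < x k) ∧ StrictMono x :=
  ⟨fun h => ⟨h.lt, h.strictMono⟩, fun h => ⟨h.1 0, fun k => ⟨h.1 _, h.2 k.lt_succ_self⟩⟩⟩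

/-- The sequence above `a` with prescribed logarithmic gaps. -/
noncomputable def gapSeq (a z : ℕ → ℝ) : ℕ → ℝ
  | 0 => a 0 + Real.exp (z 0)
  | k + 1 => max (a (k + 1)) (gapSeq a z k) + Real.exp (z (k + 1))

lemma gapSeq_strictAbove (a z : ℕ → ℝ) : StrictAbove a (gapSeq a z) := by
  refine ⟨by simp [gapSeq, Real.exp_pos], fun k => ⟨?_, ?_⟩⟩ <;>
  · have := Real.exp_pos (z (k + 1))
    simp only [gapSeq]
    have h1 := le_max_left (a (k + 1)) (gapSeq a z k)
    have h2 := le_max_right (a (k + 1)) (gapSeq a z k)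
    linarith

lemma continuous_gapSeq (a : ℕ → ℝ) : Continuous (gapSeq a) := by
  refine continuous_pi fun k => ?_
  induction k with
  | zero => simp only [gapSeq]; fun_prop
  | succ k ih => simp only [gapSeq]; fun_prop

/-- Logarithmic gaps of a sequence above `a`. -/
noncomputable def logGaps (a x : ℕ → ℝ) : ℕ → ℝ
  | 0 => Real.log (x 0 - a 0)
  | k + 1 => Real.log (x (k + 1) - max (a (k + 1)) (x k))

lemma continuous_val_apply {P : (ℕ → ℝ) → Prop} (k : ℕ) :
    Continuous fun x : {x // P x} => x.1 k :=
  (continuous_apply k).comp continuous_subtype_val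

/-- The space of strictly increasing sequences above `a` is a countable power of the line. -/
noncomputable def strictAboveHomeo (a : ℕ → ℝ) : {x // StrictAbove a x} ≃ₜ (ℕ → ℝ) where
  toFun x := logGaps a x.1
  invFun z := ⟨gapSeq a z, gapSeq_strictAbove a z⟩
  left_inv := by
    rintro ⟨x, hx⟩
    ext k
    induction k with
    | zero =>
      simp only [gapSeq, logGaps]
      rw [Real.exp_log (sub_pos.2 hx.1)]; ring
    | succ k ih =>
      simp only [gapSeq, logGaps] at ih ⊢
      rw [Real.exp_log (sub_pos.2 (max_lt (hx.2 k).1 (hx.2 k).2)), ih]; ring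
  right_inv z := by
    ext k
    cases k <;> simp [gapSeq, logGaps]
  continuous_toFun := by
    refine continuous_pi fun k => ?_
    cases k with
    | zero =>
      simp only [logGaps]
      exact Continuous.log ((continuous_val_apply 0).sub continuous_const) fun x =>
        (sub_pos.2 x.2.1).ne'
    | succ k =>
      simp only [logGaps]
      exact Continuous.log ((continuous_val_apply _).sub
        (continuous_const.max (continuous_val_apply _))) fun x =>
        (sub_pos.2 (max_lt (x.2.2 k).1 (x.2.2 k).2)).ne'
  continuous_invFun := (continuous_gapSeq a).subtype_mk _

/-- Increments of a sequence started at `0`. -/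
def increment (s : ℕ → ℝ) : ℕ → ℝ
  | 0 => s 0
  | k + 1 => s (k + 1) - s k

/-- The piecewise linear function with value `s k` at `k + 1` and `0` at `0`. -/
noncomputable def interp (s : ℕ → ℝ) (y : ℝ) : ℝ :=
  ∑ k ∈ Finset.range ⌈y⌉₊, increment s k * max 0 (min 1 (y - k))

lemma interp_eq {s : ℕ → ℝ} {y : ℝ} {n : ℕ} (h : y ≤ n) :
    interp s y = ∑ k ∈ Finset.range n, increment s k * max 0 (min 1 (y - k)) := by
  refine Finset.sum_subset (Finset.range_mono (Nat.ceil_le.2 h)) fun k _ hk => ?_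
  have hk : y ≤ k := Nat.ceil_le.1 (by simpa using hk)
  rw [max_eq_left, mul_zero]
  exact (min_le_right _ _).trans (by linarith)

lemma continuous_increment (k : ℕ) : Continuous fun s : ℕ → ℝ => increment s k := by
  cases k <;> simp only [increment] <;> fun_prop

lemma continuous_interp : Continuous fun p : (ℕ → ℝ) × ℝ => interp p.1 p.2 := by
  refine continuous_iff_continuousAt.2 fun p => ?_
  obtain ⟨n, hn⟩ := exists_nat_gt p.2
  have : (fun q : (ℕ → ℝ) × ℝ => interp q.1 q.2) =ᶠ[𝓝 p] fun q =>
      ∑ k ∈ Finset.range n, increment q.1 k * max 0 (min 1 (q.2 - k)) := by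
    filter_upwards [(isOpen_lt continuous_snd continuous_const).mem_nhds hn] with q hq
    exact interp_eq (le_of_lt hq)
  refine ContinuousAt.congr_of_eventuallyEq ?_ this
  refine Continuous.continuousAt (continuous_finsetSum _ fun k _ => ?_)
  exact ((continuous_increment k).comp continuous_fst).mul (by fun_prop)

lemma increment_pos {s : ℕ → ℝ} (hs : StrictAbove 0 s) (k : ℕ) : 0 < increment s k := by
  cases k with
  | zero => exact hs.1
  | succ k => exact sub_pos.2 (hs.2 k).2

lemma interp_lt_interp {s : ℕ → ℝ} (hs : StrictAbove 0 s) {y y' : ℝ} (hy : 0 ≤ y) (h : y < y') :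
    interp s y < interp s y' := by
  obtain ⟨n, hn⟩ := exists_nat_ge y'
  rw [interp_eq (h.le.trans hn), interp_eq hn]
  have hf := Nat.floor_le hy
  have hf' := Nat.lt_floor_add_one y
  refine Finset.sum_lt_sum (fun k _ => ?_) ⟨⌊y⌋₊, ?_, ?_⟩
  · have := increment_pos hs k
    gcongr
  · rw [Finset.mem_range]
    exact_mod_cast (hf.trans_lt h).trans_le hn
  · refine mul_lt_mul_of_pos_left ?_ (increment_pos hs _)
    rw [max_eq_right (le_min zero_le_one (by linarith)), min_eq_right (by linarith)]
    exact lt_max_of_lt_right (lt_min (by linarith) (by linarith))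

lemma interp_zero (s : ℕ → ℝ) : interp s 0 = 0 := by simp [interp]

lemma interp_lt_interp_iff {s : ℕ → ℝ} (hs : StrictAbove 0 s) {y y' : ℝ} (hy : 0 ≤ y)
    (hy' : 0 ≤ y') : interp s y < interp s y' ↔ y < y' := by
  refine ⟨fun h => ?_, interp_lt_interp hs hy⟩
  by_contra! hle
  rcases hle.eq_or_lt with rfl | h'
  · exact lt_irrefl _ h
  · exact lt_asymm h (interp_lt_interp hs hy' h')

lemma interp_succ (s : ℕ → ℝ) (k : ℕ) : interp s (k + 1) = s k := by
  rw [interp_eq (n := k + 1) (by push_cast; rfl)]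
  have : ∀ j ∈ Finset.range (k + 1),
      increment s j * max 0 (min 1 ((k : ℝ) + 1 - j)) = increment s j := by
    intro j hj
    have : (j : ℝ) ≤ k := by exact_mod_cast Finset.mem_range_succ_iff.1 hj
    rw [min_eq_left (by linarith), max_eq_right zero_le_one, mul_one]
  rw [Finset.sum_congr rfl this]
  induction k with
  | zero => simp [increment]
  | succ k ih =>
    rw [Finset.sum_range_succ, ih]
    · simp [increment]
    · intro j hj
      have : (j : ℝ) ≤ k := by exact_mod_cast Finset.mem_range_succ_iff.1 hj
      rw [min_eq_left (by linarith), max_eq_right zero_le_one, mul_one]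

lemma exists_interp_eq {s : ℕ → ℝ} {x : ℝ} {k : ℕ} (hx : 0 < x)
    (hxk : x < s k) : ∃ y, 0 < y ∧ interp s y = x := by
  have hc : ContinuousOn (interp s) (Icc 0 (k + 1)) :=
    (continuous_interp.comp (Continuous.prodMk_right s)).continuousOn
  obtain ⟨y, hy, rfl⟩ := intermediate_value_Ioo (by positivity) hc
    (show x ∈ Ioo _ _ by rw [interp_zero, interp_succ]; exact ⟨hx, hxk⟩)
  exact ⟨y, hy.1, rfl⟩

open Classical in
/-- The positive preimage of `x` under `interp s`. -/
noncomputable def interpInv (s : ℕ → ℝ) (x : ℝ) : ℝ :=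
  if h : ∃ y, 0 < y ∧ interp s y = x then h.choose else 0

lemma interpInv_spec {s : ℕ → ℝ} {x : ℝ} {k : ℕ} (hx : 0 < x)
    (hxk : x < s k) : 0 < interpInv s x ∧ interp s (interpInv s x) = x := by
  have h := exists_interp_eq hx hxk
  rw [interpInv, dif_pos h]
  exact h.choose_spec

lemma continuous_of_interp_eq {T : Type*} [TopologicalSpace T] {s : T → ℕ → ℝ} {x y : T → ℝ}
    (hs : Continuous s) (hx : Continuous x) (hs' : ∀ t, StrictAbove 0 (s t)) (hy : ∀ t, 0 < y t)
    (h : ∀ t, interp (s t) (y t) = x t) : Continuous y := by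
  refine continuous_iff_continuousAt.2 fun t₀ => tendsto_order.2 ⟨fun a ha => ?_, fun b hb => ?_⟩
  · have h0 : interp (s t₀) (max a 0) < x t₀ := by
      rw [← h]; exact interp_lt_interp (hs' _) (le_max_right _ _) (max_lt ha (hy _))
    have hc : Continuous fun t => interp (s t) (max a 0) :=
      continuous_interp.comp (hs.prodMk continuous_const)
    filter_upwards [(isOpen_lt hc hx).mem_nhds h0] with t ht
    have ht : interp (s t) (max a 0) < x t := ht
    rw [← h, interp_lt_interp_iff (hs' _) (le_max_right _ _) (hy _).le] at ht
    exact (le_max_left _ _).trans_lt ht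
  · have h0 : x t₀ < interp (s t₀) b := by
      rw [← h]; exact interp_lt_interp (hs' _) (hy _).le hb
    have hc : Continuous fun t => interp (s t) b :=
      continuous_interp.comp (hs.prodMk continuous_const)
    filter_upwards [(isOpen_lt hx hc).mem_nhds h0] with t ht
    have ht : x t < interp (s t) b := ht
    rwa [← h, interp_lt_interp_iff (hs' _) (hy _).le ((hy t₀).le.trans hb.le)] at ht

/-- Fibrewise straightening of sequences below `g t` by means of `interp (g t)`. -/
noncomputable def straighten {T : Type*} [TopologicalSpace T] (g : T → ℕ → ℝ) (hg : Continuous g)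
    (hg' : ∀ t, StrictAbove 0 (g t)) (P : T → (ℕ → ℝ) → Prop) (Q : (ℕ → ℝ) → Prop)
    (hP : ∀ t x, P t x → ∀ k, 0 < x k ∧ ∃ n, x k < g t n)
    (hQ : ∀ x, Q x → ∀ k, 0 < x k)
    (hPQ : ∀ t x, (∀ k, 0 < x k) → (Q x ↔ P t fun k => interp (g t) (x k))) :
    {p : T × (ℕ → ℝ) // P p.1 p.2} ≃ₜ T × {x // Q x} where
  toFun p := ⟨p.1.1, fun k => interpInv (g p.1.1) (p.1.2 k), by
    have h := fun k => (hP _ _ p.2 k)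
    have h' := fun k => interpInv_spec (h k).1 (h k).2.choose_spec
    rw [hPQ p.1.1 _ fun k => (h' k).1]
    simpa only [fun k => (h' k).2] using p.2⟩
  invFun q := ⟨(q.1, fun k => interp (g q.1) (q.2.1 k)),
    (hPQ q.1 _ (hQ _ q.2.2)).1 q.2.2⟩
  left_inv p := by
    have h := fun k => (hP _ _ p.2 k)
    have h' := fun k => interpInv_spec (h k).1 (h k).2.choose_spec
    ext k
    · rfl
    · exact (h' k).2
  right_inv q := by
    have h := hP _ _ ((hPQ q.1 _ (hQ _ q.2.2)).1 q.2.2)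
    have h' := fun k => interpInv_spec (h k).1 (h k).2.choose_spec
    refine Prod.ext rfl (Subtype.ext (funext fun k => ?_))
    have hq := hQ _ q.2.2 k
    rcases lt_trichotomy (interpInv (g q.1) (interp (g q.1) (q.2.1 k))) (q.2.1 k) with h1 | h1 | h1
    · exact absurd (h' k).2 (interp_lt_interp (hg' _) (h' k).1.le h1).ne
    · exact h1
    · exact absurd (h' k).2 (interp_lt_interp (hg' _) hq.le h1).ne'
  continuous_toFun := by
    have h := fun (p : {p : T × (ℕ → ℝ) // P p.1 p.2}) k => (hP _ _ p.2 k)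
    have h' := fun p k => interpInv_spec (h p k).1 (h p k).2.choose_spec
    refine Continuous.prodMk (by fun_prop) (Continuous.subtype_mk (continuous_pi fun k => ?_) _)
    exact continuous_of_interp_eq (s := fun p : {p : T × (ℕ → ℝ) // P p.1 p.2} => g p.1.1)
      (x := fun p => p.1.2 k) (by fun_prop) (by fun_prop) (fun _ => hg' _)
      (fun p => (h' p k).1) fun p => (h' p k).2
  continuous_invFun := by
    refine Continuous.subtype_mk (Continuous.prodMk (by fun_prop) (continuous_pi fun k => ?_)) _
    exact continuous_interp.comp (Continuous.prodMk (by fun_prop)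
      ((continuous_val_apply k).comp continuous_snd))

lemma strictAbove_zero_interp {s x : ℕ → ℝ} (hs : StrictAbove 0 s) (hx : ∀ k, 0 < x k) :
    StrictAbove 0 x ↔ StrictAbove 0 fun k => interp s (x k) := by
  rw [strictAbove_iff, strictAbove_iff]
  refine ⟨fun h => ⟨fun k => ?_, fun i j hij => interp_lt_interp hs (hx _).le (h.2 hij)⟩,
    fun h => ⟨hx, fun i j hij => ?_⟩⟩
  · rw [Pi.zero_apply, ← interp_zero s]
    exact interp_lt_interp hs le_rfl (hx k)
  · exact (interp_lt_interp_iff hs (hx _).le (hx _).le).1 (h.2 hij)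

lemma interp_lt_iff {s : ℕ → ℝ} (hs : StrictAbove 0 s) {y : ℝ} (hy : 0 < y) (k : ℕ) :
    interp s y < s k ↔ y < k + 1 := by
  rw [← interp_succ s k, interp_lt_interp_iff hs hy.le (by positivity)]

lemma lt_interp_iff {s : ℕ → ℝ} (hs : StrictAbove 0 s) {y : ℝ} (hy : 0 < y) (k : ℕ) :
    s k < interp s y ↔ k + 1 < y := by
  rw [← interp_succ s k, interp_lt_interp_iff hs (by positivity) hy.le]

/-- Increasing unbounded sequences of positive numbers with `s k < k + 1`. -/
def SlowSeq (s : ℕ → ℝ) : Prop :=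
  StrictAbove 0 s ∧ (∀ k : ℕ, s k < k + 1) ∧ ∀ k : ℕ, ∃ n, (k : ℝ) + 1 < s n

/-- Sequences below `g` which are cofinal in `g` become slow after straightening. -/
noncomputable def slowHomeo {T : Type*} [TopologicalSpace T] (g : T → ℕ → ℝ) (hg : Continuous g)
    (hg' : ∀ t, StrictAbove 0 (g t)) :
    {p : T × (ℕ → ℝ) // StrictAbove 0 p.2 ∧ (∀ k, p.2 k < g p.1 k) ∧ ∀ k, ∃ n, g p.1 k < p.2 n} ≃ₜ
      T × {s // SlowSeq s} :=
  straighten g hg hg'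
    (fun t x => StrictAbove 0 x ∧ (∀ k, x k < g t k) ∧ ∀ k, ∃ n, g t k < x n) SlowSeq
    (fun t x h k => ⟨h.1.lt k, k, h.2.1 k⟩) (fun x h => h.1.lt) (fun t x hx => by
      rw [SlowSeq, ← strictAbove_zero_interp (hg' t) hx]
      simp only [fun k j => interp_lt_iff (hg' t) (hx j) k, fun k j => lt_interp_iff (hg' t) (hx j) k])

/-- Strictly increasing sequences of positive numbers. -/
abbrev IncSeq := {x // StrictAbove (0 : ℕ → ℝ) x}

/-- The countable power of the line is its own square. -/
noncomputable def seqProdHomeo : (ℕ → ℝ) ≃ₜ (ℕ → ℝ) × (ℕ → ℝ) :=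
  (Homeomorph.piCongrLeft (Y := fun _ => ℝ) Equiv.natSumNatEquivNat.symm).trans
    (Homeomorph.sumArrowHomeomorphProdArrow)

lemma homeomorph_incSeq_slowSeq :
    Nonempty ((ℕ → ℝ) ≃ₜ (ℕ → ℝ) × {s // SlowSeq s}) := by
  let h1 : {p : IncSeq × (ℕ → ℝ) // StrictAbove 0 p.2 ∧ (∀ k, p.1.1 k < p.2 k) ∧
      ∀ k, ∃ n, p.2 k < p.1.1 n} ≃ₜ IncSeq × {x // StrictAbove (fun k => (k : ℝ) + 1) x} :=
    straighten (fun t : IncSeq => t.1) (by fun_prop) (fun t => t.2)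
      (fun t x => StrictAbove 0 x ∧ (∀ k, t.1 k < x k) ∧ ∀ k, ∃ n, x k < t.1 n) _
      (fun t x h k => ⟨h.1.lt k, h.2.2 k⟩)
      (fun x h k => (by positivity : (0 : ℝ) < k + 1).trans (h.lt k)) (fun t x hx => by
        rw [← strictAbove_zero_interp t.2 hx]
        simp only [fun k j => interp_lt_iff t.2 (hx j) k, fun k j => lt_interp_iff t.2 (hx j) k]
        rw [strictAbove_iff, strictAbove_iff]
        refine ⟨fun h => ⟨⟨hx, h.2⟩, h.1, fun k => ?_⟩, fun h => ⟨h.2.1, h.1.2⟩⟩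
        obtain ⟨n, hn⟩ := exists_nat_gt (x k)
        exact ⟨n, hn.trans (by linarith)⟩)
  let h2 := slowHomeo (fun t : IncSeq => t.1) (by fun_prop) (fun t => t.2)
  let sw : {p : IncSeq × (ℕ → ℝ) // StrictAbove 0 p.2 ∧ (∀ k, p.1.1 k < p.2 k) ∧
      ∀ k, ∃ n, p.2 k < p.1.1 n} ≃ₜ {p : IncSeq × (ℕ → ℝ) // StrictAbove 0 p.2 ∧
      (∀ k, p.2 k < p.1.1 k) ∧ ∀ k, ∃ n, p.1.1 k < p.2 n} :=
    { toFun := fun p => ⟨(⟨p.1.2, p.2.1⟩, p.1.1.1), p.1.1.2, p.2.2⟩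
      invFun := fun p => ⟨(⟨p.1.2, p.2.1⟩, p.1.1.1), p.1.1.2, p.2.2⟩
      left_inv := fun p => rfl
      right_inv := fun p => rfl
      continuous_toFun := by fun_prop
      continuous_invFun := by fun_prop }
  let e : IncSeq ≃ₜ (ℕ → ℝ) := strictAboveHomeo 0
  let e' := strictAboveHomeo fun k => (k : ℝ) + 1
  exact ⟨seqProdHomeo.trans <| (e.symm.prodCongr e'.symm).trans <| h1.symm.trans <| sw.trans <| h2.trans <|
    e.prodCongr (Homeomorph.refl _)⟩

/-! ### Null families -/

lemma continuous_zeroAtInfty {T α V : Type*} [TopologicalSpace T] [TopologicalSpace α]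
    [DiscreteTopology α] [NormedAddCommGroup V] {F : T → C₀(α, V)}
    (h1 : ∀ a, Continuous fun t => F t a)
    (h2 : ∀ t₀, ∀ ε > 0, ∃ s : Set α, s.Finite ∧ ∀ᶠ t in 𝓝 t₀, ∀ a ∉ s, ‖F t a‖ ≤ ε) :
    Continuous F := by
  refine continuous_iff_continuousAt.2 fun t₀ => Metric.tendsto_nhds.2 fun ε hε => ?_
  obtain ⟨s, hs, hev⟩ := h2 t₀ (ε / 3) (by positivity)
  have h3 : ∀ᶠ t in 𝓝 t₀, ∀ a ∈ s, dist (F t a) (F t₀ a) < ε / 2 :=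
    (hs.eventually_all).2 fun a _ =>
      Metric.tendsto_nhds.1 (h1 a).continuousAt (ε / 2) (by positivity)
  filter_upwards [hev, h3] with t ht ht'
  refine lt_of_le_of_lt ?_ (show 2 * ε / 3 < ε by linarith)
  rw [← ZeroAtInftyContinuousMap.dist_toBCF_eq_dist]
  refine (BoundedContinuousFunction.dist_le (by positivity)).2 fun a => ?_
  change dist (F t a) (F t₀ a) ≤ _
  by_cases ha : a ∈ s
  · linarith [ht' a ha]
  · have h4 := ht a ha
    have h5 := hev.self_of_nhds a ha
    rw [dist_eq_norm]
    linarith [norm_sub_le (F t a) (F t₀ a)]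

lemma finite_le_norm_zeroAtInfty {α V : Type*} [TopologicalSpace α] [DiscreteTopology α]
    [NormedAddCommGroup V] (f : C₀(α, V)) {ε : ℝ} (hε : 0 < ε) : {a | ε ≤ ‖f a‖}.Finite := by
  have h := f.zero_at_infty'
  rw [cocompact_eq_cofinite] at h
  have := (tendsto_zero_iff_norm_tendsto_zero.1 h).eventually (gt_mem_nhds hε)
  refine (mem_cofinite.1 this).subset fun a ha => ?_
  exact not_lt.2 (show ε ≤ ‖f a‖ from ha)

lemma norm_apply_le_zeroAtInfty {α V : Type*} [TopologicalSpace α] [NormedAddCommGroup V]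
    (f : C₀(α, V)) (a : α) : ‖f a‖ ≤ ‖f‖ := by
  rw [← ZeroAtInftyContinuousMap.norm_toBCF_eq_norm]
  exact f.toBCF.norm_coe_le_norm a

lemma norm_le_zeroAtInfty {α V : Type*} [TopologicalSpace α] [NormedAddCommGroup V]
    {f : C₀(α, V)} {c : ℝ} (hc : 0 ≤ c) (h : ∀ a, ‖f a‖ ≤ c) : ‖f‖ ≤ c := by
  rw [← ZeroAtInftyContinuousMap.norm_toBCF_eq_norm]
  exact (BoundedContinuousFunction.norm_le hc).2 h

/-- A null family as a continuous function vanishing at infinity. -/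
def nullMk {α V : Type*} [TopologicalSpace α] [DiscreteTopology α] [NormedAddCommGroup V]
    (f : α → V) (hf : ∀ ε > 0, {a | ε ≤ ‖f a‖}.Finite) : C₀(α, V) where
  toFun := f
  continuous_toFun := continuous_of_discreteTopology
  zero_at_infty' := by
    rw [cocompact_eq_cofinite, tendsto_zero_iff_norm_tendsto_zero, Metric.tendsto_nhds]
    intro ε hε
    refine mem_cofinite.2 ((hf ε hε).subset fun a ha => ?_)
    simpa using ha

@[simp] lemma nullMk_apply {α V : Type*} [TopologicalSpace α] [DiscreteTopology α]
    [NormedAddCommGroup V] (f : α → V) (hf : ∀ ε > 0, {a | ε ≤ ‖f a‖}.Finite) (a : α) :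
    nullMk f hf a = f a := rfl

lemma continuous_eval_zeroAtInfty {α V : Type*} [TopologicalSpace α] [NormedAddCommGroup V]
    (a : α) : Continuous fun f : C₀(α, V) => f a := by
  refine LipschitzWith.continuous (K := 1) (LipschitzWith.of_dist_le_mul fun f g => ?_)
  rw [NNReal.coe_one, one_mul, dist_eq_norm, dist_eq_norm]
  exact norm_apply_le_zeroAtInfty (f - g) a

/-! ### Absorption of the space of null sequences -/

/-- The supremum norm of the tail of a null sequence. -/
noncomputable def tailNorm (w : C₀(ℕ, ℝ)) (k : ℕ) : ℝ := ⨆ j, |w (k + j)|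

lemma bddAbove_tail (w : C₀(ℕ, ℝ)) (k : ℕ) : BddAbove (range fun j => |w (k + j)|) :=
  ⟨‖w‖, by rintro _ ⟨j, rfl⟩; exact norm_apply_le_zeroAtInfty w _⟩

lemma abs_le_tailNorm (w : C₀(ℕ, ℝ)) {j k : ℕ} (h : k ≤ j) : |w j| ≤ tailNorm w k := by
  obtain ⟨i, rfl⟩ := Nat.exists_eq_add_of_le h
  exact le_ciSup (bddAbove_tail w k) i

lemma tailNorm_nonneg (w : C₀(ℕ, ℝ)) (k : ℕ) : 0 ≤ tailNorm w k :=
  (abs_nonneg _).trans (abs_le_tailNorm w le_rfl)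

lemma tailNorm_le {w : C₀(ℕ, ℝ)} {k : ℕ} {c : ℝ} (h : ∀ j, k ≤ j → |w j| ≤ c) :
    tailNorm w k ≤ c := ciSup_le fun _ => h _ (Nat.le_add_right _ _)

lemma tailNorm_lt {w : C₀(ℕ, ℝ)} {k : ℕ} {c : ℝ} (h : ∀ j, k ≤ j → |w j| < c) :
    tailNorm w k < c := by
  have hc : 0 < c := (abs_nonneg _).trans_lt (h k le_rfl)
  have hfin := (finite_le_norm_zeroAtInfty w (half_pos hc)).inter_of_left (Ici k)
  rcases (({a | c / 2 ≤ ‖w a‖}) ∩ Ici k).eq_empty_or_nonempty with h0 | h0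
  · refine (tailNorm_le fun j hj => ?_).trans_lt (half_lt_self hc)
    by_contra! hcon
    exact (h0 ▸ (⟨hcon.le, hj⟩ : j ∈ {a | c / 2 ≤ ‖w a‖} ∩ Ici k) : j ∈ (∅ : Set ℕ))
  · obtain ⟨i, hi, hmax⟩ := hfin.exists_maximalFor (fun a => ‖w a‖) _ h0
    refine (tailNorm_le fun j hj => ?_).trans_lt (h i hi.2)
    by_contra! hcon
    have hj' : j ∈ {a | c / 2 ≤ ‖w a‖} ∩ Ici k := ⟨hi.1.trans hcon.le, hj⟩
    exact absurd (hmax hj' hcon.le) (not_le.2 hcon)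

lemma tailNorm_antitone (w : C₀(ℕ, ℝ)) : Antitone (tailNorm w) := fun _ _ h =>
  tailNorm_le fun _ hj => abs_le_tailNorm w (h.trans hj)

lemma continuous_tailNorm (k : ℕ) : Continuous fun w => tailNorm w k := by
  refine LipschitzWith.continuous (K := 1) (LipschitzWith.of_le_add_mul _ fun w w' => ?_)
  refine tailNorm_le fun j hj => ?_
  have h1 := norm_apply_le_zeroAtInfty (w - w') j
  have h2 := abs_le_tailNorm w' hj
  have h3 : |w j| ≤ |w' j| + |w j - w' j| := by
    have := abs_add_le (w' j) (w j - w' j); simpa using this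
  rw [NNReal.coe_one, one_mul, dist_eq_norm]
  exact h3.trans (add_le_add h2 h1)

/-- An increasing unbounded sequence controlling the decay of a null sequence. -/
noncomputable def decayRate (w : C₀(ℕ, ℝ)) (k : ℕ) : ℝ := 1 / (tailNorm w k + 1 / (k + 1))

lemma decayRate_den_pos (w : C₀(ℕ, ℝ)) (k : ℕ) : 0 < tailNorm w k + 1 / ((k : ℝ) + 1) :=
  add_pos_of_nonneg_of_pos (tailNorm_nonneg w k) (by positivity)

lemma decayRate_strictAbove (w : C₀(ℕ, ℝ)) : StrictAbove 0 (decayRate w) := by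
  refine strictAbove_iff.2 ⟨fun k => one_div_pos.2 (decayRate_den_pos w k),
    strictMono_nat_of_lt_succ fun k => ?_⟩
  refine one_div_lt_one_div_of_lt (decayRate_den_pos w _) (add_lt_add_of_le_of_lt
    (tailNorm_antitone w k.le_succ) (one_div_lt_one_div_of_lt (by positivity) ?_))
  push_cast; linarith

lemma continuous_decayRate : Continuous decayRate :=
  continuous_pi fun k => continuous_const.div ((continuous_tailNorm k).add continuous_const)
    fun w => (decayRate_den_pos w k).ne'

lemma lt_decayRate_iff {w : C₀(ℕ, ℝ)} {k : ℕ} {x : ℝ} (hx : 0 < x) :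
    x < decayRate w k ↔ ∀ j, k ≤ j → |w j| < 1 / x - 1 / (k + 1) := by
  rw [decayRate, lt_one_div hx (decayRate_den_pos w k)]
  refine ⟨fun h j hj => (abs_le_tailNorm w hj).trans_lt (by linarith), fun h => ?_⟩
  linarith [tailNorm_lt h]

lemma decayRate_le (w : C₀(ℕ, ℝ)) (k : ℕ) : decayRate w k ≤ k + 1 := by
  rw [decayRate, one_div_le (decayRate_den_pos w k) (by positivity)]
  linarith [tailNorm_nonneg w k]

lemma exists_lt_decayRate (w : C₀(ℕ, ℝ)) (x : ℝ) : ∃ k, x < decayRate w k := by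
  set y := max x 1
  have hy : 0 < y := lt_max_of_lt_right one_pos
  obtain ⟨n, hn⟩ := exists_nat_gt (2 * y)
  obtain ⟨m, hm⟩ := (finite_le_norm_zeroAtInfty w (ε := 1 / (2 * y)) (by positivity)).bddAbove
  refine ⟨max n (m + 1), (le_max_left x 1).trans_lt ((lt_decayRate_iff hy).2 fun j hj => ?_)⟩
  have h1 : |w j| < 1 / (2 * y) := by
    by_contra! hcon
    have := hm (show j ∈ _ from hcon)
    have := (le_max_right n (m + 1)).trans hj
    omega
  have h2 : 1 / ((max n (m + 1) : ℕ) + 1 : ℝ) ≤ 1 / (2 * y) := by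
    refine one_div_le_one_div_of_le (by positivity) ?_
    have : (n : ℝ) ≤ (max n (m + 1) : ℕ) := by exact_mod_cast le_max_left _ _
    linarith
  have h3 : 1 / y = 1 / (2 * y) + 1 / (2 * y) := by field_simp; norm_num
  linarith

/-- The decreasing sequence of bounds attached to a slow sequence. -/
noncomputable def slowBound (s : ℕ → ℝ) : ℕ → ℝ
  | 0 => 1 / s 0 - 1 / ((0 : ℕ) + 1)
  | j + 1 => min (slowBound s j) (1 / s (j + 1) - 1 / ((j + 1 : ℕ) + 1))

lemma lt_slowBound_iff {s : ℕ → ℝ} {c : ℝ} {j : ℕ} :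
    c < slowBound s j ↔ ∀ k ≤ j, c < 1 / s k - 1 / (k + 1) := by
  induction j with
  | zero => simp [slowBound]
  | succ j ih =>
    rw [slowBound, lt_min_iff, ih]
    refine ⟨fun h k hk => ?_, fun h => ⟨fun k hk => h k (by omega), h _ le_rfl⟩⟩
    rcases Nat.of_le_succ hk with hk | rfl
    · exact h.1 k hk
    · exact h.2

lemma slowBound_pos {s : ℕ → ℝ} (hs : SlowSeq s) (j : ℕ) : 0 < slowBound s j :=
  lt_slowBound_iff.2 fun k _ => sub_pos.2 (one_div_lt_one_div_of_lt (hs.1.lt k) (hs.2.1 k))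

lemma slowBound_lt {s : ℕ → ℝ} {j n : ℕ} (h : n ≤ j) : slowBound s j < 1 / s n := by
  by_contra! hcon
  have h1 : ∀ j, slowBound s j ≤ 1 / s j - 1 / (j + 1) := by
    intro j
    cases j with
    | zero => exact le_rfl
    | succ j => exact min_le_right _ _
  have h2 : slowBound s j ≤ slowBound s n :=
    antitone_nat_of_succ_le (f := slowBound s) (fun k => min_le_left _ _) h
  have := h1 n
  have : (0 : ℝ) < 1 / (n + 1) := by positivity
  linarith

lemma continuous_slowBound (j : ℕ) :
    Continuous fun s : {s // SlowSeq s} => slowBound s.1 j := by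
  have h (k : ℕ) : Continuous fun s : {s // SlowSeq s} => 1 / s.1 k - 1 / ((k : ℝ) + 1) :=
    (continuous_const.div (continuous_val_apply k) fun s => (s.2.1.lt k).ne').sub
      continuous_const
  induction j with
  | zero => exact h 0
  | succ j ih => exact ih.min (h (j + 1))

lemma abs_div_one_add_abs_lt (u : ℝ) : |u / (1 + |u|)| < 1 := by
  have : 0 < 1 + |u| := by positivity
  rw [abs_div, abs_of_pos this, div_lt_one this]
  linarith

/-- Over slow sequences, the null sequences of controlled decay form a countable power of the
line. -/
noncomputable def controlledHomeo :
    {p : C₀(ℕ, ℝ) × (ℕ → ℝ) // StrictAbove 0 p.2 ∧ (∀ k, p.2 k < decayRate p.1 k) ∧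
      ∀ k, ∃ n, decayRate p.1 k < p.2 n} ≃ₜ {s // SlowSeq s} × (ℕ → ℝ) :=
  have hslow (p : C₀(ℕ, ℝ) × (ℕ → ℝ)) (hp : StrictAbove 0 p.2 ∧ (∀ k, p.2 k < decayRate p.1 k) ∧
      ∀ k, ∃ n, decayRate p.1 k < p.2 n) : SlowSeq p.2 := by
    refine ⟨hp.1, fun k => (hp.2.1 k).trans_le (decayRate_le _ _), fun k => ?_⟩
    obtain ⟨m, hm⟩ := exists_lt_decayRate p.1 (k + 1)
    obtain ⟨n, hn⟩ := hp.2.2 m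
    exact ⟨n, hm.trans hn⟩
  have hlt (p : C₀(ℕ, ℝ) × (ℕ → ℝ)) (hp : StrictAbove 0 p.2 ∧ (∀ k, p.2 k < decayRate p.1 k) ∧
      ∀ k, ∃ n, decayRate p.1 k < p.2 n) (j : ℕ) : |p.1 j / slowBound p.2 j| < 1 := by
    have h0 := slowBound_pos (hslow p hp) j
    rw [abs_div, abs_of_pos h0, div_lt_one h0]
    exact lt_slowBound_iff.2 fun k hk => (lt_decayRate_iff (hp.1.lt k)).1 (hp.2.1 k) j hk
  have hb (s : {s // SlowSeq s}) (u : ℕ → ℝ) (j : ℕ) :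
      |slowBound s.1 j * (u j / (1 + |u j|))| < slowBound s.1 j := by
    have h0 := slowBound_pos s.2 j
    rw [abs_mul, abs_of_pos h0]
    exact mul_lt_of_lt_one_right h0 (abs_div_one_add_abs_lt _)
  have hfin (s : {s // SlowSeq s}) (ε : ℝ) (hε : 0 < ε) : ∃ n, 1 / ε < s.1 n := by
    obtain ⟨k, hk⟩ := exists_nat_gt (1 / ε)
    obtain ⟨n, hn⟩ := s.2.2.2 k
    exact ⟨n, by linarith⟩
  have hfin' (s : {s // SlowSeq s}) (ε : ℝ) (hε : 0 < ε) (n : ℕ) (hn : 1 / ε < s.1 n)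
      (u : ℕ → ℝ) (j : ℕ) (hj : n ≤ j) : |slowBound s.1 j * (u j / (1 + |u j|))| < ε := by
    refine (hb s u j).trans ((slowBound_lt hj).trans ?_)
    rwa [one_div_lt (s.2.1.lt n) hε]
  have hnull (s : {s // SlowSeq s}) (u : ℕ → ℝ) (ε : ℝ) (hε : 0 < ε) :
      {j | ε ≤ ‖slowBound s.1 j * (u j / (1 + |u j|))‖}.Finite := by
    obtain ⟨n, hn⟩ := hfin s ε hε
    refine (finite_lt_nat n).subset fun j hj => ?_
    by_contra! hcon
    exact absurd (hfin' s ε hε n hn u j (not_lt.1 hcon)) (not_lt.2 hj)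
  { toFun := fun p => (⟨p.1.2, hslow _ p.2⟩, fun j =>
      (p.1.1 j / slowBound p.1.2 j) / (1 - |p.1.1 j / slowBound p.1.2 j|))
    invFun := fun q => ⟨(nullMk (fun j => slowBound q.1.1 j * (q.2 j / (1 + |q.2 j|)))
        (hnull q.1 q.2), q.1.1), q.1.2.1, fun k => by
          refine (lt_decayRate_iff (q.1.2.1.lt k)).2 fun j hj => ?_
          exact lt_slowBound_iff.1 (hb q.1 q.2 j) k hj, fun k => by
          obtain ⟨n, hn⟩ := q.1.2.2.2 k
          exact ⟨n, (decayRate_le _ _).trans_lt hn⟩⟩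
    left_inv := fun p => by
      refine Subtype.ext (Prod.ext ?_ rfl)
      ext j
      have h1 := hlt _ p.2 j
      have h0 := slowBound_pos (hslow _ p.2) j
      simp only [nullMk_apply]
      have hr : slowBound p.1.2 j * (p.1.1 j / slowBound p.1.2 j) = p.1.1 j := by field_simp
      generalize p.1.1 j / slowBound p.1.2 j = r at h1 hr ⊢
      have h2 : 0 < 1 - |r| := by linarith
      rw [← hr, abs_div, abs_of_pos h2]
      field_simp
      ring
    right_inv := fun q => by
      refine Prod.ext rfl (funext fun j => ?_)
      have h0 := slowBound_pos q.1.2 j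
      simp only [nullMk_apply]
      rw [mul_div_cancel_left₀ _ h0.ne']
      have h1 : 0 < 1 + |q.2 j| := by positivity
      rw [abs_div, abs_of_pos h1]
      field_simp
      ring
    continuous_toFun := by
      refine Continuous.prodMk (by fun_prop) (continuous_pi fun j => ?_)
      have hc : Continuous fun p : {p : C₀(ℕ, ℝ) × (ℕ → ℝ) // StrictAbove 0 p.2 ∧
          (∀ k, p.2 k < decayRate p.1 k) ∧ ∀ k, ∃ n, decayRate p.1 k < p.2 n} =>
            p.1.1 j / slowBound p.1.2 j := by
        refine Continuous.div ((continuous_eval_zeroAtInfty j).comp (by fun_prop)) ?_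
          fun p => (slowBound_pos (hslow _ p.2) j).ne'
        exact (continuous_slowBound j).comp (continuous_snd.comp
          continuous_subtype_val |>.subtype_mk fun p => hslow _ p.2)
      exact hc.div (continuous_const.sub hc.abs) fun p => (sub_pos.2 (hlt _ p.2 j)).ne'
    continuous_invFun := by
      refine Continuous.subtype_mk (Continuous.prodMk ?_ (by fun_prop)) _
      refine continuous_zeroAtInfty (fun j => ?_) fun q₀ ε hε => ?_
      · simp only [nullMk_apply]
        have : Continuous fun q : {s // SlowSeq s} × (ℕ → ℝ) => q.2 j := by fun_prop
        exact ((continuous_slowBound j).comp continuous_fst).mul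
          (this.div (continuous_const.add this.abs) fun q => by positivity)
      · obtain ⟨n, hn⟩ := hfin q₀.1 ε hε
        refine ⟨_, finite_lt_nat n, ?_⟩
        have hc : Continuous fun q : {s // SlowSeq s} × (ℕ → ℝ) => q.1.1 n :=
          (continuous_val_apply n).comp continuous_fst
        filter_upwards [(isOpen_lt continuous_const hc).mem_nhds hn] with q hq j hj
        exact (hfin' q.1 ε hε n hq q.2 j (not_lt.1 hj)).le }

theorem null_prod_homeomorph : Nonempty (C₀(ℕ, ℝ) × (ℕ → ℝ) ≃ₜ (ℕ → ℝ)) := by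
  obtain ⟨h⟩ := homeomorph_incSeq_slowSeq
  let h1 : C₀(ℕ, ℝ) × {s // SlowSeq s} ≃ₜ {s // SlowSeq s} × (ℕ → ℝ) :=
    (slowHomeo decayRate continuous_decayRate decayRate_strictAbove).symm.trans controlledHomeo
  let e1 : C₀(ℕ, ℝ) × (ℕ → ℝ) ≃ₜ C₀(ℕ, ℝ) × ({s // SlowSeq s} × (ℕ → ℝ)) :=
    (Homeomorph.refl _).prodCongr (h.trans (Homeomorph.prodComm _ _))
  let e2 := (Homeomorph.prodAssoc C₀(ℕ, ℝ) {s // SlowSeq s} (ℕ → ℝ)).symm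
  let e3 := h1.prodCongr (Homeomorph.refl (ℕ → ℝ))
  let e4 : ({s // SlowSeq s} × (ℕ → ℝ)) × (ℕ → ℝ) ≃ₜ (ℕ → ℝ) × (ℕ → ℝ) :=
    ((Homeomorph.prodComm _ _).trans h.symm).prodCongr (Homeomorph.refl _)
  exact ⟨e1.trans <| e2.trans <| e3.trans <| e4.trans seqProdHomeo.symm⟩

/-! ### A factor theorem for retractive maps -/

section Factor

variable {B E V : Type*} [MetricSpace E] [NormedAddCommGroup V]

lemma finite_nat_of_eventually_lt {f : ℕ → V}
    (h : ∀ ε > 0, ∃ N, ∀ n, N ≤ n → ‖f n‖ ≤ ε) : ∀ ε > 0, {n | ε ≤ ‖f n‖}.Finite := by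
  intro ε hε
  obtain ⟨N, hN⟩ := h (ε / 2) (half_pos hε)
  refine (finite_lt_nat N).subset fun n hn => ?_
  by_contra! hcon
  have := hN n (not_lt.1 hcon)
  have h2 : ε ≤ ‖f n‖ := hn
  linarith

lemma exists_tail_le (z : C₀(ℕ, V)) {ε : ℝ} (hε : 0 < ε) :
    ∃ N, ∀ n, N ≤ n → ‖z n‖ ≤ ε := by
  obtain ⟨m, hm⟩ := (finite_le_norm_zeroAtInfty z hε).bddAbove
  refine ⟨m + 1, fun n hn => ?_⟩
  by_contra! hcon
  have := hm (show n ∈ _ from hcon.le)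
  omega

lemma exists_eventually_tail_le (z₀ : C₀(ℕ, V)) {ε : ℝ} (hε : 0 < ε) :
    ∃ N, ∀ᶠ z in 𝓝 z₀, ∀ n, N ≤ n → ‖z n‖ ≤ ε := by
  obtain ⟨N, hN⟩ := exists_tail_le z₀ (half_pos hε)
  refine ⟨N, ?_⟩
  filter_upwards [Metric.ball_mem_nhds z₀ (half_pos hε)] with z hz n hn
  have h1 := norm_apply_le_zeroAtInfty (z - z₀) n
  rw [← dist_eq_norm] at h1
  have h2 : ‖z n‖ ≤ ‖z₀ n‖ + ‖z n - z₀ n‖ := norm_le_norm_add_norm_sub' _ _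
  have h3 := hN n hn
  have h4 : dist z z₀ < ε / 2 := hz
  have h5 : ‖(z - z₀) n‖ = ‖z n - z₀ n‖ := rfl
  linarith

variable [NormedSpace ℝ V]

/-- The sequence of approximations of `σ e` coded by a null sequence. -/
noncomputable def approxSeq (σ : E → V) (e : E) (z : C₀(ℕ, V)) (n : ℕ) : V :=
  σ e + (1 / 2 : ℝ) ^ n • z n

/-- The corrections needed to pass from one approximation to the next. -/
noncomputable def correction (p : E → B) (σ : E → V) (ρ : B × V → E) (e : E) (z : C₀(ℕ, V)) :
    ℕ → V
  | 0 => approxSeq σ e z 0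
  | n + 1 => (2 : ℝ) ^ (n + 1) • (approxSeq σ e z (n + 1) - σ (ρ (p e, approxSeq σ e z n)))

/-- The approximations recovered from the corrections. -/
noncomputable def recover (σ : E → V) (ρ : B × V → E) (b : B) (u : C₀(ℕ, V)) : ℕ → V
  | 0 => u 0
  | n + 1 => (1 / 2 : ℝ) ^ (n + 1) • u (n + 1) + σ (ρ (b, recover σ ρ b u n))

variable {p : E → B} {σ : E → V} {ρ : B × V → E} {C : ℝ}

lemma norm_correction_le (hC : 0 ≤ C) (hσ : LipschitzWith 1 σ)
    (hρσ : ∀ z e, p e = z.1 → dist (ρ z) e ≤ C * ‖z.2 - σ e‖) (e : E) (z : C₀(ℕ, V)) {m : ℝ}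
    {n : ℕ} (h : ∀ k, n ≤ k → ‖z k‖ ≤ m) : ‖correction p σ ρ e z (n + 1)‖ ≤ (1 + 2 * C) * m := by
  have h1 := hρσ (p e, approxSeq σ e z n) e rfl
  have h2 : ‖approxSeq σ e z n - σ e‖ = (1 / 2 : ℝ) ^ n * ‖z n‖ := by
    simp [approxSeq, norm_smul]
  rw [h2] at h1
  have h3 := hσ.dist_le_mul e (ρ (p e, approxSeq σ e z n))
  rw [NNReal.coe_one, one_mul, dist_comm e, dist_eq_norm] at h3
  have h4 : correction p σ ρ e z (n + 1) = z (n + 1) +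
      (2 : ℝ) ^ (n + 1) • (σ e - σ (ρ (p e, approxSeq σ e z n))) := by
    have : (2 : ℝ) ^ (n + 1) * (1 / 2) ^ (n + 1) = 1 := by rw [← mul_pow]; norm_num
    simp only [correction, approxSeq, add_sub_right_comm, smul_add, smul_smul, this, one_smul]
    abel
  rw [h4]
  refine (norm_add_le _ _).trans ?_
  rw [norm_smul, Real.norm_of_nonneg (by positivity)]
  have h5 := h (n + 1) n.le_succ
  have h6 := h n le_rfl
  have h7 : (2 : ℝ) ^ (n + 1) * ‖σ e - σ (ρ (p e, approxSeq σ e z n))‖ ≤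
      (2 : ℝ) ^ (n + 1) * (C * ((1 / 2 : ℝ) ^ n * ‖z n‖)) := by
    gcongr; exact h3.trans h1
  have h8 : (2 : ℝ) ^ (n + 1) * (C * ((1 / 2 : ℝ) ^ n * ‖z n‖)) = 2 * C * ‖z n‖ := by
    have : (2 : ℝ) ^ n * (1 / 2) ^ n = 1 := by rw [← mul_pow]; norm_num
    calc _ = 2 * C * ‖z n‖ * ((2 : ℝ) ^ n * (1 / 2) ^ n) := by ring
      _ = _ := by rw [this, mul_one]
  have h9 : 2 * C * ‖z n‖ ≤ 2 * C * m := by gcongr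
  linarith

lemma dist_recover_le (hpρ : ∀ z, p (ρ z) = z.1)
    (hρσ : ∀ z e, p e = z.1 → dist (ρ z) e ≤ C * ‖z.2 - σ e‖) (b : B) (u : C₀(ℕ, V)) (n : ℕ) :
    dist (ρ (b, recover σ ρ b u n)) (ρ (b, recover σ ρ b u (n + 1))) ≤
      C * ((1 / 2 : ℝ) ^ (n + 1) * ‖u (n + 1)‖) := by
  have := hρσ (b, recover σ ρ b u (n + 1)) (ρ (b, recover σ ρ b u n)) (hpρ _)
  rw [dist_comm]
  refine this.trans_eq ?_
  simp [recover, norm_smul]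

lemma cauchySeq_recover (hC : 0 ≤ C) (hpρ : ∀ z, p (ρ z) = z.1)
    (hρσ : ∀ z e, p e = z.1 → dist (ρ z) e ≤ C * ‖z.2 - σ e‖) (b : B) (u : C₀(ℕ, V)) :
    CauchySeq fun n => ρ (b, recover σ ρ b u n) := by
  refine cauchySeq_of_le_geometric (1 / 2) (C * ‖u‖ / 2) (by norm_num) fun n => ?_
  refine (dist_recover_le hpρ hρσ b u n).trans ?_
  have := norm_apply_le_zeroAtInfty u (n + 1)
  calc _ ≤ C * ((1 / 2 : ℝ) ^ (n + 1) * ‖u‖) := by gcongr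
    _ = _ := by ring

lemma dist_recover_limit_le (hC : 0 ≤ C) (hpρ : ∀ z, p (ρ z) = z.1)
    (hρσ : ∀ z e, p e = z.1 → dist (ρ z) e ≤ C * ‖z.2 - σ e‖) {b : B} {u : C₀(ℕ, V)} {e : E}
    (he : Tendsto (fun n => ρ (b, recover σ ρ b u n)) atTop (𝓝 e)) {n : ℕ} {m : ℝ}
    (hm : ∀ k, n < k → ‖u k‖ ≤ m) :
    dist (ρ (b, recover σ ρ b u n)) e ≤ C * m * (1 / 2) ^ n := by
  have h := dist_le_of_le_geometric_of_tendsto₀ (1 / 2) (C * m * (1 / 2) ^ (n + 1))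
    (f := fun k => ρ (b, recover σ ρ b u (n + k))) (by norm_num) (fun k => ?_)
    ((tendsto_add_atTop_iff_nat n).2 he |>.congr fun k => by rw [add_comm])
  · simp only [add_zero] at h
    refine h.trans_eq ?_
    ring
  · refine (dist_recover_le hpρ hρσ b u (n + k)).trans ?_
    have := hm (n + k + 1) (by omega)
    calc _ ≤ C * ((1 / 2 : ℝ) ^ (n + k + 1) * m) := by gcongr
      _ = _ := by ring

lemma norm_recover_sub_le (hC : 0 ≤ C) (hσ : LipschitzWith 1 σ) (hpρ : ∀ z, p (ρ z) = z.1)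
    (hρσ : ∀ z e, p e = z.1 → dist (ρ z) e ≤ C * ‖z.2 - σ e‖) {b : B} {u : C₀(ℕ, V)} {e : E}
    (he : Tendsto (fun n => ρ (b, recover σ ρ b u n)) atTop (𝓝 e)) {n : ℕ} {m : ℝ}
    (hm : ∀ k, n < k → ‖u k‖ ≤ m) :
    ‖(2 : ℝ) ^ (n + 1) • (recover σ ρ b u (n + 1) - σ e)‖ ≤ (1 + 2 * C) * m := by
  have h1 := dist_recover_limit_le hC hpρ hρσ he hm
  have h2 := hσ.dist_le_mul (ρ (b, recover σ ρ b u n)) e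
  rw [NNReal.coe_one, one_mul, dist_eq_norm] at h2
  have h3 := hm (n + 1) n.lt_succ_self
  have h4 : (2 : ℝ) ^ (n + 1) * (1 / 2) ^ (n + 1) = 1 := by rw [← mul_pow]; norm_num
  have h5 : (2 : ℝ) ^ (n + 1) • (recover σ ρ b u (n + 1) - σ e) = u (n + 1) +
      (2 : ℝ) ^ (n + 1) • (σ (ρ (b, recover σ ρ b u n)) - σ e) := by
    simp only [recover, add_sub_assoc, smul_add, smul_smul, h4, one_smul]
  rw [h5]
  refine (norm_add_le _ _).trans ?_
  rw [norm_smul, Real.norm_of_nonneg (by positivity)]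
  have h7 : (2 : ℝ) ^ (n + 1) * ‖σ (ρ (b, recover σ ρ b u n)) - σ e‖ ≤
      (2 : ℝ) ^ (n + 1) * (C * m * (1 / 2) ^ n) := by
    gcongr; exact h2.trans h1
  have h8 : (2 : ℝ) ^ (n + 1) * (C * m * (1 / 2) ^ n) = 2 * C * m := by
    have : (2 : ℝ) ^ n * (1 / 2) ^ n = 1 := by rw [← mul_pow]; norm_num
    calc _ = 2 * C * m * ((2 : ℝ) ^ n * (1 / 2) ^ n) := by ring
      _ = _ := by rw [this, mul_one]
  linarith

lemma correction_null (hC : 0 ≤ C) (hσ : LipschitzWith 1 σ)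
    (hρσ : ∀ z e, p e = z.1 → dist (ρ z) e ≤ C * ‖z.2 - σ e‖) (e : E) (z : C₀(ℕ, V)) :
    ∀ ε > 0, {n | ε ≤ ‖correction p σ ρ e z n‖}.Finite := by
  refine finite_nat_of_eventually_lt fun ε hε => ?_
  obtain ⟨N, hN⟩ := exists_tail_le z (ε := ε / (1 + 2 * C)) (by positivity)
  refine ⟨N + 1, fun n hn => ?_⟩
  obtain ⟨k, rfl⟩ := Nat.exists_eq_add_of_le' hn
  refine (norm_correction_le hC hσ hρσ e z (n := k + N)
    (fun j hj => hN j (by omega))).trans_eq ?_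
  field_simp

lemma recover_null (hC : 0 ≤ C) (hσ : LipschitzWith 1 σ) (hpρ : ∀ z, p (ρ z) = z.1)
    (hρσ : ∀ z e, p e = z.1 → dist (ρ z) e ≤ C * ‖z.2 - σ e‖) {b : B} {u : C₀(ℕ, V)} {e : E}
    (he : Tendsto (fun n => ρ (b, recover σ ρ b u n)) atTop (𝓝 e)) :
    ∀ ε > 0, {n | ε ≤ ‖(2 : ℝ) ^ n • (recover σ ρ b u n - σ e)‖}.Finite := by
  refine finite_nat_of_eventually_lt fun ε hε => ?_
  obtain ⟨N, hN⟩ := exists_tail_le u (ε := ε / (1 + 2 * C)) (by positivity)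
  refine ⟨N + 1, fun n hn => ?_⟩
  obtain ⟨k, rfl⟩ := Nat.exists_eq_add_of_le' hn
  refine (norm_recover_sub_le hC hσ hpρ hρσ he (n := k + N)
    (fun j hj => hN j (by omega))).trans_eq ?_
  field_simp

theorem factor_homeomorph [TopologicalSpace B] [T2Space B] [CompleteSpace E] (hp : Continuous p)
    (hσ : LipschitzWith 1 σ) (hρ : Continuous ρ) (hC : 0 ≤ C) (hpρ : ∀ z, p (ρ z) = z.1)
    (hρσ : ∀ z e, p e = z.1 → dist (ρ z) e ≤ C * ‖z.2 - σ e‖) :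
    ∃ h : E × C₀(ℕ, V) ≃ₜ B × C₀(ℕ, V), ∀ x, (h x).1 = p x.1 := by
  choose lim hlim using fun q : B × C₀(ℕ, V) =>
    cauchySeq_tendsto_of_complete (cauchySeq_recover hC hpρ hρσ q.1 q.2)
  have hplim (q : B × C₀(ℕ, V)) : p (lim q) = q.1 := by
    refine tendsto_nhds_unique ((hp.tendsto _).comp (hlim q)) ?_
    simp only [Function.comp_def, hpρ]
    exact tendsto_const_nhds
  have happrox (n : ℕ) : Continuous fun x : E × C₀(ℕ, V) => approxSeq σ x.1 x.2 n :=
    (hσ.continuous.comp continuous_fst).add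
      (((continuous_eval_zeroAtInfty n).comp continuous_snd).const_smul _)
  have hrec (n : ℕ) : Continuous fun q : B × C₀(ℕ, V) => recover σ ρ q.1 q.2 n := by
    induction n with
    | zero => exact (continuous_eval_zeroAtInfty 0).comp continuous_snd
    | succ n ih =>
      exact (((continuous_eval_zeroAtInfty (n + 1)).comp continuous_snd).const_smul _).add
        (hσ.continuous.comp (hρ.comp (continuous_fst.prodMk ih)))
  have hlimc : Continuous lim := by
    refine TendstoLocallyUniformly.continuous (F := fun n q => ρ (q.1, recover σ ρ q.1 q.2 n))
      (p := atTop) ?_ (Frequently.of_forall fun n => hρ.comp (continuous_fst.prodMk (hrec n)))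
    refine Metric.tendstoLocallyUniformly_iff.2 fun ε hε q₀ => ?_
    refine ⟨_, (isOpen_lt continuous_snd.norm continuous_const).mem_nhds
      (show ‖q₀.2‖ < ‖q₀.2‖ + 1 by linarith), ?_⟩
    have : Tendsto (fun n : ℕ => C * (‖q₀.2‖ + 1) * (1 / 2 : ℝ) ^ n) atTop (𝓝 0) := by
      simpa using (tendsto_pow_atTop_nhds_zero_of_lt_one (by norm_num : (0 : ℝ) ≤ 1 / 2)
        (by norm_num)).const_mul (C * (‖q₀.2‖ + 1))
    filter_upwards [this.eventually (gt_mem_nhds hε)] with n hn q hq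
    rw [dist_comm]
    refine (dist_recover_limit_le hC hpρ hρσ (hlim q) fun k _ => ?_).trans_lt hn
    exact (norm_apply_le_zeroAtInfty _ _).trans (le_of_lt hq)
  have hfwd (x : E × C₀(ℕ, V)) (n : ℕ) : recover σ ρ (p x.1)
      (nullMk (correction p σ ρ x.1 x.2) (correction_null hC hσ hρσ x.1 x.2)) n =
        approxSeq σ x.1 x.2 n := by
    induction n with
    | zero => rfl
    | succ n ih =>
      have h4 : (1 / 2 : ℝ) ^ (n + 1) * 2 ^ (n + 1) = 1 := by rw [← mul_pow]; norm_num
      rw [recover, ih, nullMk_apply, correction, smul_smul, h4, one_smul]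
      abel
  have hlim_eq (x : E × C₀(ℕ, V)) : lim (p x.1,
      nullMk (correction p σ ρ x.1 x.2) (correction_null hC hσ hρσ x.1 x.2)) = x.1 := by
    refine tendsto_nhds_unique (hlim _) ?_
    simp only [hfwd]
    refine tendsto_iff_dist_tendsto_zero.2 (squeeze_zero (fun _ => dist_nonneg)
      (fun n => hρσ (p x.1, approxSeq σ x.1 x.2 n) x.1 rfl) (g := fun n =>
        C * ‖approxSeq σ x.1 x.2 n - σ x.1‖) ?_)
    have h0 : Tendsto (fun n : ℕ => C * ((1 / 2 : ℝ) ^ n * ‖x.2‖)) atTop (𝓝 0) := by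
      simpa using ((tendsto_pow_atTop_nhds_zero_of_lt_one (by norm_num : (0 : ℝ) ≤ 1 / 2)
        (by norm_num)).mul_const ‖x.2‖).const_mul C
    refine squeeze_zero (fun n => by positivity) (fun n => ?_) h0
    have := norm_apply_le_zeroAtInfty x.2 n
    simp only [approxSeq, add_sub_cancel_left, norm_smul]
    rw [Real.norm_of_nonneg (by positivity)]
    gcongr
  have hbwd (q : B × C₀(ℕ, V)) (n : ℕ) : approxSeq σ (lim q)
      (nullMk (fun n => (2 : ℝ) ^ n • (recover σ ρ q.1 q.2 n - σ (lim q)))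
        (recover_null hC hσ hpρ hρσ (hlim q))) n = recover σ ρ q.1 q.2 n := by
    have h4 : (1 / 2 : ℝ) ^ n * 2 ^ n = 1 := by rw [← mul_pow]; norm_num
    rw [approxSeq, nullMk_apply, smul_smul, h4, one_smul]
    abel
  refine ⟨{
    toFun := fun x => (p x.1, nullMk (correction p σ ρ x.1 x.2)
      (correction_null hC hσ hρσ x.1 x.2))
    invFun := fun q => (lim q, nullMk (fun n => (2 : ℝ) ^ n • (recover σ ρ q.1 q.2 n - σ (lim q)))
      (recover_null hC hσ hpρ hρσ (hlim q)))
    left_inv := fun x => ?_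
    right_inv := fun q => ?_
    continuous_toFun := ?_
    continuous_invFun := ?_ }, fun _ => rfl⟩
  · refine Prod.ext (hlim_eq x) ?_
    ext n
    have h4 : (2 : ℝ) ^ n * (1 / 2) ^ n = 1 := by rw [← mul_pow]; norm_num
    simp only [nullMk_apply, hlim_eq, hfwd]
    rw [approxSeq, add_sub_cancel_left, smul_smul, h4, one_smul]
  · refine Prod.ext (hplim q) ?_
    ext n
    cases n with
    | zero =>
      simp only [nullMk_apply, correction, hbwd]
      rfl
    | succ n =>
      have h4 : (2 : ℝ) ^ (n + 1) * (1 / 2) ^ (n + 1) = 1 := by rw [← mul_pow]; norm_num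
      simp only [nullMk_apply, correction, hbwd, hplim]
      rw [recover, add_sub_cancel_right, smul_smul, h4, one_smul]
  · refine (hp.comp continuous_fst).prodMk (continuous_zeroAtInfty (fun n => ?_) fun x₀ ε hε => ?_)
    · cases n with
      | zero => exact happrox 0
      | succ n =>
        exact ((happrox (n + 1)).sub (hσ.continuous.comp
          (hρ.comp ((hp.comp continuous_fst).prodMk (happrox n))))).const_smul _
    · obtain ⟨N, hN⟩ := exists_eventually_tail_le x₀.2 (ε := ε / (1 + 2 * C)) (by positivity)
      refine ⟨_, finite_lt_nat (N + 1), ?_⟩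
      filter_upwards [continuous_snd.continuousAt.eventually hN] with x hx n hn
      obtain ⟨k, rfl⟩ := Nat.exists_eq_add_of_le' (not_lt.1 hn)
      refine (norm_correction_le hC hσ hρσ x.1 x.2 (n := k + N)
        (fun j hj => hx j (by omega))).trans_eq ?_
      field_simp
  · refine hlimc.prodMk (continuous_zeroAtInfty (fun n => ?_) fun q₀ ε hε => ?_)
    · exact ((hrec n).sub (hσ.continuous.comp hlimc)).const_smul _
    · obtain ⟨N, hN⟩ := exists_eventually_tail_le q₀.2 (ε := ε / (1 + 2 * C)) (by positivity)
      refine ⟨_, finite_lt_nat (N + 1), ?_⟩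
      filter_upwards [continuous_snd.continuousAt.eventually hN] with q hq n hn
      obtain ⟨k, rfl⟩ := Nat.exists_eq_add_of_le' (not_lt.1 hn)
      refine (norm_recover_sub_le hC hσ hpρ hρσ (hlim q) (n := k + N)
        (fun j hj => hq j (by omega))).trans_eq ?_
      field_simp

end Factor

lemma dist_le_zeroAtInfty {α V : Type*} [TopologicalSpace α] [NormedAddCommGroup V]
    {z z' : C₀(α, V)} {c : ℝ} (hc : 0 ≤ c) (h : ∀ n, dist (z n) (z' n) ≤ c) : dist z z' ≤ c := by
  rw [dist_eq_norm]
  exact norm_le_zeroAtInfty hc fun n => (dist_eq_norm (z n) (z' n)).symm.trans_le (h n)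

lemma dist_apply_le_zeroAtInfty {α V : Type*} [TopologicalSpace α] [NormedAddCommGroup V]
    (z z' : C₀(α, V)) (n : α) : dist (z n) (z' n) ≤ dist z z' := by
  rw [dist_eq_norm, dist_eq_norm]
  exact norm_apply_le_zeroAtInfty (z - z') n

/-- Null sequences of null families form a space of null families. -/
noncomputable def nullCurry {κ : Type*} [TopologicalSpace κ] [DiscreteTopology κ] (e : κ ≃ ℕ) :
    C₀(ℕ, C₀(κ, ℝ)) ≃ₜ C₀(ℕ, ℝ) :=
  let E : ℕ × κ ≃ ℕ := ((Equiv.refl ℕ).prodCongr e).trans Nat.pairEquiv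
  have hfwd (z : C₀(ℕ, C₀(κ, ℝ))) (ε : ℝ) (hε : 0 < ε) :
      {n | ε ≤ ‖z (E.symm n).1 (E.symm n).2‖}.Finite := by
    have h1 := finite_le_norm_zeroAtInfty z hε
    have h2 : (⋃ n ∈ {n | ε ≤ ‖z n‖}, (fun k => E (n, k)) '' {k | ε ≤ ‖z n k‖}).Finite :=
      h1.biUnion fun n _ => (finite_le_norm_zeroAtInfty (z n) hε).image _
    refine h2.subset fun n hn => ?_
    simp only [mem_iUnion]
    exact ⟨(E.symm n).1, le_trans hn (norm_apply_le_zeroAtInfty _ _), (E.symm n).2, hn, by simp⟩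
  have hbwd (w : C₀(ℕ, ℝ)) (n : ℕ) (ε : ℝ) (hε : 0 < ε) : {k | ε ≤ ‖w (E (n, k))‖}.Finite := by
    refine (finite_le_norm_zeroAtInfty w hε).preimage (f := fun k => E (n, k)) fun a _ b _ h => ?_
    simpa using h
  have hbwd' (w : C₀(ℕ, ℝ)) (ε : ℝ) (hε : 0 < ε) :
      {n | ε ≤ ‖nullMk (fun k => w (E (n, k))) (hbwd w n)‖}.Finite := by
    refine ((finite_le_norm_zeroAtInfty w (half_pos hε)).image fun m => (E.symm m).1).subset
      fun n hn => ?_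
    by_contra! hcon
    refine absurd (show ε ≤ _ from hn) (not_le.2 (lt_of_le_of_lt ?_ (half_lt_self hε)))
    refine norm_le_zeroAtInfty (half_pos hε).le fun k => ?_
    by_contra! hlt
    exact hcon ⟨E (n, k), hlt.le, by simp⟩
  let f : C₀(ℕ, C₀(κ, ℝ)) ≃ C₀(ℕ, ℝ) :=
    { toFun := fun z => nullMk (fun n => z (E.symm n).1 (E.symm n).2) (hfwd z)
      invFun := fun w => nullMk (fun n => nullMk (fun k => w (E (n, k))) (hbwd w n)) (hbwd' w)
      left_inv := fun z => by ext n k; simp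
      right_inv := fun w => by ext n; simp }
  have hf : Isometry f := by
    refine Isometry.of_dist_eq fun z z' => le_antisymm ?_ ?_
    · refine dist_le_zeroAtInfty dist_nonneg fun n => ?_
      exact (dist_apply_le_zeroAtInfty (z (E.symm n).1) (z' (E.symm n).1) (E.symm n).2).trans
        (dist_apply_le_zeroAtInfty z z' _)
    · refine dist_le_zeroAtInfty dist_nonneg fun n => dist_le_zeroAtInfty dist_nonneg fun k => ?_
      have h := dist_apply_le_zeroAtInfty (f z) (f z') (E (n, k))
      change dist (z (E.symm (E (n, k))).1 (E.symm (E (n, k))).2)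
        (z' (E.symm (E (n, k))).1 (E.symm (E (n, k))).2) ≤ _ at h
      rwa [E.symm_apply_apply] at h
  (IsometryEquiv.mk f hf).toHomeomorph

theorem factor_homeomorph_seq {B E κ : Type*} [TopologicalSpace B] [T2Space B] [MetricSpace E]
    [CompleteSpace E] [TopologicalSpace κ] [DiscreteTopology κ] (e : κ ≃ ℕ) {p : E → B}
    {σ : E → C₀(κ, ℝ)} {ρ : B × C₀(κ, ℝ) → E} {C : ℝ} (hp : Continuous p)
    (hσ : LipschitzWith 1 σ) (hρ : Continuous ρ) (hC : 0 ≤ C) (hpρ : ∀ z, p (ρ z) = z.1)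
    (hρσ : ∀ z e, p e = z.1 → dist (ρ z) e ≤ C * ‖z.2 - σ e‖) :
    ∃ h : E × (ℕ → ℝ) ≃ₜ B × (ℕ → ℝ), ∀ x, (h x).1 = p x.1 := by
  obtain ⟨h, hh⟩ := factor_homeomorph hp hσ hρ hC hpρ hρσ
  obtain ⟨a⟩ := null_prod_homeomorph
  let c : (ℕ → ℝ) ≃ₜ C₀(ℕ, C₀(κ, ℝ)) × (ℕ → ℝ) :=
    a.symm.trans ((nullCurry e).symm.prodCongr (Homeomorph.refl _))
  refine ⟨((Homeomorph.refl E).prodCongr c).trans <| (Homeomorph.prodAssoc _ _ _).symm.trans <|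
    (h.prodCongr (Homeomorph.refl _)).trans <| (Homeomorph.prodAssoc _ _ _).trans <|
    (Homeomorph.refl B).prodCongr c.symm, fun x => ?_⟩
  exact hh (x.1, (c x.2).1)

/-! ### Lipschitz embeddings of separable spaces into spaces of null families -/

section Aharoni

variable {E : Type*} [MetricSpace E]

/-- The bump of radius `2 ^ n` about `u (k + 1)`, cut off near the earlier points. -/
noncomputable def netBump (u : ℕ → E) (q : ℤ × ℕ) (e : E) : ℝ :=
  max 0 (min (2 * 2 ^ q.1 - dist e (u (q.2 + 1))) (Metric.infDist e (u '' Iic q.2) - 2 ^ q.1))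

lemma netBump_nonneg (u : ℕ → E) (q : ℤ × ℕ) (e : E) : 0 ≤ netBump u q e := le_max_left _ _

lemma abs_netBump_sub_le (u : ℕ → E) (q : ℤ × ℕ) (e e' : E) :
    |netBump u q e - netBump u q e'| ≤ dist e e' := by
  have h1 : |dist e (u (q.2 + 1)) - dist e' (u (q.2 + 1))| ≤ dist e e' := abs_dist_sub_le _ _ _
  have h2 : |Metric.infDist e (u '' Iic q.2) - Metric.infDist e' (u '' Iic q.2)| ≤ dist e e' := by
    simpa [Real.dist_eq] using (Metric.lipschitz_infDist_pt (u '' Iic q.2)).dist_le_mul e e'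
  refine (abs_max_sub_max_le_max _ _ _ _).trans (max_le (by simp) ?_)
  refine (abs_min_sub_min_le_max _ _ _ _).trans (max_le ?_ ?_)
  · rw [show ∀ a b c : ℝ, a - b - (a - c) = -(b - c) by intros; ring, abs_neg]; exact h1
  · rwa [sub_sub_sub_cancel_right]

lemma finite_le_netBump {u : ℕ → E} (hu : DenseRange u) (e : E) {ε : ℝ} (hε : 0 < ε) :
    {q | ε ≤ netBump u q e}.Finite := by
  obtain ⟨l, hl⟩ := hu.exists_dist_lt e (half_pos hε)
  obtain ⟨a, ha⟩ := exists_pow_lt_of_lt_one (half_pos hε) (show (1 / 2 : ℝ) < 1 by norm_num)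
  obtain ⟨b, hb⟩ := pow_unbounded_of_one_lt (dist e (u 0)) (one_lt_two : (1 : ℝ) < 2)
  refine ((finite_Icc (-(a : ℤ)) b).prod (finite_Iio l)).subset ?_
  rintro ⟨n, k⟩ hq
  have hq : ε ≤ netBump u (n, k) e := hq
  have h1 : ε ≤ min (2 * 2 ^ n - dist e (u (k + 1)))
      (Metric.infDist e (u '' Iic k) - 2 ^ n) := by
    rcases le_max_iff.1 hq with h | h
    · linarith
    · exact h
  have h2 := h1.trans (min_le_left _ _)
  have h3 := h1.trans (min_le_right _ _)
  have h4 : ∀ j ≤ k, Metric.infDist e (u '' Iic k) ≤ dist e (u j) := fun j hj =>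
    Metric.infDist_le_dist_of_mem ⟨j, hj, rfl⟩
  have h5 : ε / 2 ≤ (2 : ℝ) ^ n := by linarith [@dist_nonneg _ _ e (u (k + 1))]
  have h6 : (2 : ℝ) ^ n < 2 ^ (b : ℤ) := by
    rw [zpow_natCast]; linarith [h4 0 (Nat.zero_le _)]
  have h7 : (2 : ℝ) ^ (-(a : ℤ)) < 2 ^ n := by
    rw [zpow_neg, zpow_natCast]
    rw [one_div, inv_pow] at ha
    linarith
  refine ⟨⟨?_, ?_⟩, ?_⟩
  · exact ((zpow_lt_zpow_iff_right₀ one_lt_two).1 h7).le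
  · exact ((zpow_lt_zpow_iff_right₀ one_lt_two).1 h6).le
  · by_contra hk
    have := h4 l (not_lt.1 hk)
    linarith

lemma exists_netBump_separates {u : ℕ → E} (hu : DenseRange u) {e e' : E} {n : ℤ}
    (h : 4 * (2 : ℝ) ^ n ≤ dist e e') (h0 : 3 / 2 * (2 : ℝ) ^ n ≤ dist e (u 0)) :
    ∃ k, (2 : ℝ) ^ n / 2 ≤ netBump u (n, k) e - netBump u (n, k) e' := by
  classical
  have hr : (0 : ℝ) < 2 ^ n := by positivity
  have hex : ∃ k, dist e (u k) < 3 / 2 * (2 : ℝ) ^ n := hu.exists_dist_lt e (by positivity)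
  obtain ⟨k, hk⟩ : ∃ k, Nat.find hex = k + 1 :=
    by
    refine Nat.exists_eq_succ_of_ne_zero fun hz => ?_
    have := Nat.find_spec hex
    rw [hz] at this
    linarith
  have h1 : dist e (u (k + 1)) < 3 / 2 * (2 : ℝ) ^ n := hk ▸ Nat.find_spec hex
  have h2 : 3 / 2 * (2 : ℝ) ^ n ≤ Metric.infDist e (u '' Iic k) := by
    refine (Metric.le_infDist ((nonempty_Iic (a := k)).image u)).2 ?_
    rintro _ ⟨j, hj, rfl⟩
    exact not_lt.1 (Nat.find_min hex (hk ▸ Nat.lt_succ_of_le hj))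
  have h3 : (2 : ℝ) ^ n / 2 ≤ netBump u (n, k) e :=
    le_max_of_le_right (le_min (by linarith) (by linarith))
  have h4 : netBump u (n, k) e' = 0 := by
    refine max_eq_left ((min_le_left _ _).trans ?_)
    have := dist_triangle_right e e' (u (k + 1))
    dsimp only
    linarith
  exact ⟨k, by linarith⟩

/-- Every separable metric space embeds in `c₀` with a Lipschitz inverse. -/
theorem exists_lipschitz_embedding_zeroAtInfty [TopologicalSpace.SeparableSpace E] [Nonempty E] :
    ∃ σ : E → C₀(ℤ × ℕ, ℝ), LipschitzWith 1 σ ∧ ∀ e e', dist e e' ≤ 16 * dist (σ e) (σ e') := by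
  have hu := TopologicalSpace.denseRange_denseSeq E
  set u := TopologicalSpace.denseSeq E
  let σ : E → C₀(ℤ × ℕ, ℝ) := fun e => nullMk (fun q => netBump u q e) fun ε hε => by
    simpa [abs_of_nonneg (netBump_nonneg u _ e)] using finite_le_netBump hu e hε
  have hσ (e e' : E) (q : ℤ × ℕ) : |netBump u q e - netBump u q e'| ≤ dist (σ e) (σ e') :=
    dist_apply_le_zeroAtInfty (σ e) (σ e') q
  refine ⟨σ, LipschitzWith.of_dist_le_mul fun e e' => ?_, fun e e' => ?_⟩
  · rw [NNReal.coe_one, one_mul]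
    exact dist_le_zeroAtInfty dist_nonneg fun q => abs_netBump_sub_le u q e e'
  · rcases eq_or_ne e e' with rfl | hne
    · simp
    obtain ⟨m, hm1, hm2⟩ := exists_mem_Ico_zpow (dist_pos.2 hne) (one_lt_two : (1 : ℝ) < 2)
    have e1 : (2 : ℝ) ^ m = 4 * 2 ^ (m - 2) := by
      rw [zpow_sub₀ two_ne_zero]; norm_num; ring
    have e2 : (2 : ℝ) ^ (m + 1) = 8 * 2 ^ (m - 2) := by
      rw [zpow_add_one₀ two_ne_zero, e1]; ring
    rw [e1] at hm1
    rw [e2] at hm2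
    have hr : (0 : ℝ) < 2 ^ (m - 2) := by positivity
    rcases le_or_gt (3 / 2 * (2 : ℝ) ^ (m - 2)) (dist e (u 0)) with h0 | h0
    · obtain ⟨k, hk⟩ := exists_netBump_separates hu hm1 h0
      linarith [le_abs_self (netBump u (m - 2, k) e - netBump u (m - 2, k) e'),
        hσ e e' (m - 2, k)]
    · have h1 : 3 / 2 * (2 : ℝ) ^ (m - 2) ≤ dist e' (u 0) := by
        linarith [dist_triangle_right e e' (u 0)]
      obtain ⟨k, hk⟩ := exists_netBump_separates hu (by rwa [dist_comm] at hm1) h1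
      linarith [neg_abs_le (netBump u (m - 2, k) e - netBump u (m - 2, k) e'),
        hσ e e' (m - 2, k)]

end Aharoni

/-! ### Max-plus spaces -/

/-- The operation `(t, a, b) ↦ a ⊔ (t + b)`. -/
class MaxPlus (X : Type*) where
  mp : ℝ → X → X → X

open MaxPlus (mp)

/-- Max-plus convexity in a space with the operation `mp`. -/
def MPConvex {X : Type*} [MaxPlus X] (A : Set X) : Prop :=
  ∀ a ∈ A, ∀ b ∈ A, ∀ t : ℝ, t ≤ 0 → mp t a b ∈ A

/-- Nonempty compact max-plus convex sets. -/
def Mpcc (X : Type*) [TopologicalSpace X] [MaxPlus X] : Type _ :=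
  {K : NonemptyCompacts X // MPConvex (K : Set X)}

/-- A metric space with a nonexpansive max-plus operation. -/
class MaxPlusMetric (X : Type*) [MetricSpace X] extends MaxPlus X where
  mp_self : ∀ (t : ℝ) (x : X), t ≤ 0 → mp t x x = x
  dist_mp_le : ∀ (t : ℝ) (a b a' b' : X),
    dist (mp t a b) (mp t a' b') ≤ max (dist a a') (dist b b')
  exists_compact : ∀ K : Set X, IsCompact K → ∃ L, K ⊆ L ∧ IsCompact L ∧ MPConvex L

instance {ι : Type*} : MaxPlus (ι → ℝ) := ⟨fun t a b i => max (a i) (t + b i)⟩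

instance : MaxPlus ℝ := ⟨fun t a b => max a (t + b)⟩

instance {X Y : Type*} [MaxPlus X] [MaxPlus Y] : MaxPlus (X × Y) :=
  ⟨fun t a b => (mp t a.1 b.1, mp t a.2 b.2)⟩

namespace Mpcc

section Topological

variable {X : Type*} [TopologicalSpace X] [MaxPlus X]

instance : TopologicalSpace (Mpcc X) := instTopologicalSpaceSubtype

instance : SetLike (Mpcc X) X where
  coe K := (K.1 : Set X)
  coe_injective _ _ h := Subtype.ext (SetLike.coe_injective h)

instance [T2Space X] : T2Space (Mpcc X) := inferInstanceAs (T2Space (Subtype _))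

lemma isCompact (K : Mpcc X) : IsCompact (K : Set X) := K.1.isCompact

lemma nonempty (K : Mpcc X) : (K : Set X).Nonempty := K.1.nonempty

lemma convex (K : Mpcc X) : MPConvex (K : Set X) := K.2

lemma mp_mem (K : Mpcc X) {a b : X} (ha : a ∈ K) (hb : b ∈ K) {t : ℝ} (ht : t ≤ 0) :
    mp t a b ∈ K := K.2 a ha b hb t ht

lemma continuous_val : Continuous (Subtype.val : Mpcc X → NonemptyCompacts X) :=
  continuous_subtype_val

end Topological

/-- The image under a map commuting with the max-plus operations. -/
def map {X Y : Type*} [TopologicalSpace X] [MaxPlus X] [TopologicalSpace Y] [MaxPlus Y] (f : X → Y)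
    (hf : Continuous f) (h : ∀ t a b, f (mp t a b) = mp t (f a) (f b)) (K : Mpcc X) : Mpcc Y :=
  ⟨K.1.map f hf, by
    rintro _ ⟨a, ha, rfl⟩ _ ⟨b, hb, rfl⟩ t ht
    exact ⟨mp t a b, K.2 a ha b hb t ht, h t a b⟩⟩

lemma coe_map {X Y : Type*} [TopologicalSpace X] [MaxPlus X] [TopologicalSpace Y] [MaxPlus Y]
    (f : X → Y) (hf : Continuous f) (h : ∀ t a b, f (mp t a b) = mp t (f a) (f b)) (K : Mpcc X) :
    (map f hf h K : Set Y) = f '' K := rfl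

lemma continuous_map {X Y : Type*} [TopologicalSpace X] [MaxPlus X] [TopologicalSpace Y]
    [MaxPlus Y] (f : X → Y) (hf : Continuous f) (h : ∀ t a b, f (mp t a b) = mp t (f a) (f b)) :
    Continuous (map f hf h) :=
  Continuous.subtype_mk (hf.nonemptyCompacts_map.comp continuous_val) _

end Mpcc

section Metric

variable {X : Type*} [MetricSpace X]

lemma NonemptyCompacts.exists_dist_le (A B : NonemptyCompacts X) {x : X} (hx : x ∈ A) :
    ∃ y ∈ B, dist x y ≤ dist A B := by
  obtain ⟨y, hy, h⟩ := B.isCompact.exists_infDist_eq_dist B.nonempty x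
  refine ⟨y, hy, h ▸ Metric.infDist_le_hausdorffDist_of_mem hx ?_⟩
  exact Metric.hausdorffEDist_ne_top_of_nonempty_of_bounded A.nonempty B.nonempty
    A.isCompact.isBounded B.isCompact.isBounded

lemma NonemptyCompacts.dist_le {A B : NonemptyCompacts X} {r : ℝ} (hr : 0 ≤ r)
    (h1 : ∀ x ∈ A, ∃ y ∈ B, dist x y ≤ r) (h2 : ∀ x ∈ B, ∃ y ∈ A, dist x y ≤ r) :
    dist A B ≤ r :=
  Metric.hausdorffDist_le_of_mem_dist hr h1 h2

variable [MaxPlusMetric X]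

open MaxPlusMetric

lemma dist_mp_le_right {t : ℝ} (ht : t ≤ 0) (a b x : X) :
    dist (mp t a b) x ≤ max (dist a x) (dist b x) := by
  conv_lhs => rw [← mp_self t x ht]
  exact dist_mp_le t a b x x

namespace Mpcc

noncomputable instance : MetricSpace (Mpcc X) :=
  inferInstanceAs (MetricSpace {K : NonemptyCompacts X // MPConvex (K : Set X)})

lemma exists_dist_le (A B : Mpcc X) {x : X} (hx : x ∈ A) : ∃ y ∈ B, dist x y ≤ dist A B :=
  NonemptyCompacts.exists_dist_le A.1 B.1 hx

lemma dist_le {A B : Mpcc X} {r : ℝ} (hr : 0 ≤ r)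
    (h1 : ∀ x ∈ A, ∃ y ∈ B, dist x y ≤ r) (h2 : ∀ x ∈ B, ∃ y ∈ A, dist x y ≤ r) :
    dist A B ≤ r := NonemptyCompacts.dist_le hr h1 h2

lemma isClosed_mpConvex : IsClosed {K : NonemptyCompacts X | MPConvex (K : Set X)} := by
  refine isClosed_of_closure_subset fun K hK a ha b hb t ht => ?_
  rw [K.isCompact.isClosed.mem_iff_infDist_zero K.nonempty]
  refine le_antisymm (le_of_forall_pos_le_add fun ε hε => ?_) Metric.infDist_nonneg
  obtain ⟨L, hL, hd⟩ := Metric.mem_closure_iff.1 hK (ε / 2) (half_pos hε)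
  obtain ⟨a', ha', haa⟩ := NonemptyCompacts.exists_dist_le K L ha
  obtain ⟨b', hb', hbb⟩ := NonemptyCompacts.exists_dist_le K L hb
  obtain ⟨c, hc, hcc⟩ := NonemptyCompacts.exists_dist_le L K (hL a' ha' b' hb' t ht)
  rw [dist_comm] at hcc
  have h1 := dist_mp_le t a b a' b'
  have h2 : max (dist a a') (dist b b') ≤ dist K L := max_le haa hbb
  have h3 := dist_triangle (mp t a b) (mp t a' b') c
  rw [dist_comm L K, dist_comm c] at hcc
  linarith [Metric.infDist_le_dist_of_mem (x := mp t a b) hc]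

instance [CompleteSpace X] : CompleteSpace (Mpcc X) :=
  isClosed_mpConvex.completeSpace_coe

instance [SecondCountableTopology X] : SecondCountableTopology (Mpcc X) :=
  inferInstanceAs (SecondCountableTopology {K : NonemptyCompacts X // MPConvex (K : Set X)})

/-- The points within distance `r` of `K`. -/
lemma isClosed_near (K : Mpcc X) (r : ℝ) : IsClosed {x | ∃ y ∈ K, dist x y ≤ r} := by
  convert isClosed_le (Metric.continuous_infDist_pt (K : Set X)) (continuous_const (y := r)) using 1
  ext x
  refine ⟨fun ⟨y, hy, h⟩ => (Metric.infDist_le_dist_of_mem hy).trans h, fun h => ?_⟩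
  obtain ⟨y, hy, h'⟩ := K.isCompact.exists_infDist_eq_dist K.nonempty x
  exact ⟨y, hy, h' ▸ h⟩

lemma mpConvex_near (K : Mpcc X) (r : ℝ) : MPConvex {x | ∃ y ∈ K, dist x y ≤ r} := by
  rintro a ⟨a', ha', ha⟩ b ⟨b', hb', hb⟩ t ht
  exact ⟨mp t a' b', K.mp_mem ha' hb' ht, (dist_mp_le t a b a' b').trans (max_le ha hb)⟩

/-- The closed max-plus convex hull of a compact set. -/
def hull (A : NonemptyCompacts X) : Mpcc X :=
  ⟨⟨⟨⋂ L ∈ {L : Set X | (A : Set X) ⊆ L ∧ IsClosed L ∧ MPConvex L}, L, by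
      obtain ⟨L, hAL, hL, hL'⟩ := exists_compact (A : Set X) A.isCompact
      exact hL.of_isClosed_subset (isClosed_biInter fun L hL => hL.2.1)
        (biInter_subset_of_mem ⟨hAL, hL.isClosed, hL'⟩)⟩,
      A.nonempty.mono (subset_iInter₂ fun L hL => hL.1)⟩, by
    intro a ha b hb t ht
    simp only [mem_iInter, NonemptyCompacts.coe_mk, Compacts.coe_mk] at ha hb ⊢
    exact fun L hL => hL.2.2 a (ha L hL) b (hb L hL) t ht⟩

lemma subset_hull (A : NonemptyCompacts X) : (A : Set X) ⊆ hull A :=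
  subset_iInter₂ fun _ hL => hL.1

lemma hull_subset {A : NonemptyCompacts X} {L : Set X} (h : (A : Set X) ⊆ L) (hc : IsClosed L)
    (hL : MPConvex L) : (hull A : Set X) ⊆ L :=
  biInter_subset_of_mem (show L ∈ {L : Set X | (A : Set X) ⊆ L ∧ IsClosed L ∧ MPConvex L} from
    ⟨h, hc, hL⟩)

lemma lipschitz_hull : LipschitzWith 1 (hull : NonemptyCompacts X → Mpcc X) := by
  have key (A B : NonemptyCompacts X) :
      (hull A : Set X) ⊆ {x | ∃ y ∈ hull B, dist x y ≤ dist A B} := by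
    refine hull_subset (fun x hx => ?_) (isClosed_near _ _) (mpConvex_near _ _)
    obtain ⟨y, hy, h⟩ := NonemptyCompacts.exists_dist_le A B hx
    exact ⟨y, subset_hull B hy, h⟩
  refine LipschitzWith.of_dist_le_mul fun A B => ?_
  rw [NNReal.coe_one, one_mul]
  exact dist_le dist_nonneg (fun x hx => key A B hx) fun x hx => dist_comm A B ▸ key B A hx

/-- A compact set near a convex set has a hull near that set. -/
lemma dist_hull_le {A : NonemptyCompacts X} {K : Mpcc X} {r : ℝ} (hr : 0 ≤ r)
    (h1 : ∀ x ∈ A, ∃ y ∈ K, dist x y ≤ r) (h2 : ∀ x ∈ K, ∃ y ∈ A, dist x y ≤ r) :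
    dist (hull A) K ≤ r :=
  dist_le hr (fun _ hx => hull_subset h1 (isClosed_near K r) (mpConvex_near K r) hx) fun x hx =>
    let ⟨y, hy, h⟩ := h2 x hx
    ⟨y, subset_hull A hy, h⟩

end Mpcc

end Metric

/-! ### The countable power of the line with a max-plus metric -/

/-- Real sequences, with the metric `sup_j min (1 / (j + 1)) |x j - y j|`. -/
def Sq : Type := ℕ → ℝ

namespace Sq

/-- The weight of a coordinate. -/
noncomputable def weight (j : ℕ) : ℝ := 1 / ((j : ℝ) + 1)

lemma weight_pos (j : ℕ) : 0 < weight j := by unfold weight; positivity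

lemma weight_le_one (j : ℕ) : weight j ≤ 1 := by
  unfold weight
  rw [div_le_one (by positivity)]
  linarith [(Nat.cast_nonneg j : (0 : ℝ) ≤ j)]

/-- The underlying distance function. -/
noncomputable def sqDist (x y : ℕ → ℝ) : ℝ := ⨆ j, min (weight j) |x j - y j|

lemma le_sqDist (x y : ℕ → ℝ) (j : ℕ) : min (weight j) |x j - y j| ≤ sqDist x y :=
  le_ciSup (f := fun j => min (weight j) |x j - y j|)
    ⟨1, by rintro _ ⟨j, rfl⟩; exact (min_le_left _ _).trans (weight_le_one j)⟩ j

lemma sqDist_le {x y : ℕ → ℝ} {c : ℝ} (h : ∀ j, min (weight j) |x j - y j| ≤ c) :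
    sqDist x y ≤ c := ciSup_le h

lemma isOpen_iff_sqDist (s : Set (ℕ → ℝ)) :
    IsOpen s ↔ ∀ x ∈ s, ∃ ε > 0, ∀ y, sqDist x y < ε → y ∈ s := by
  constructor
  · intro hs x hx
    rw [isOpen_pi_iff] at hs
    obtain ⟨I, u, hu, hsub⟩ := hs x hx
    have h1 : ∀ j ∈ I, ∃ ε > 0, ∀ z, |x j - z| < ε → z ∈ u j := fun j hj => by
      obtain ⟨ε, hε, h⟩ := Metric.isOpen_iff.1 (hu j hj).1 (x j) (hu j hj).2
      exact ⟨ε, hε, fun z hz => h (by rwa [Metric.mem_ball, dist_comm])⟩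
    choose! ε hε h using h1
    have h2 : ∃ η > 0, ∀ j ∈ I, η ≤ min (weight j) (ε j) := by
      have := (I.finite_toSet.eventually_all (l := 𝓝[>] (0 : ℝ))
        (p := fun j η => η ≤ min (weight j) (ε j))).2 fun j hj =>
          nhdsWithin_le_nhds (eventually_le_nhds (lt_min (weight_pos j) (hε j hj)))
      obtain ⟨η, hη, hη'⟩ := (this.and self_mem_nhdsWithin).exists
      exact ⟨η, hη', hη⟩
    obtain ⟨η, hη, hle⟩ := h2
    refine ⟨η, hη, fun y hy => hsub fun j hj => h j hj _ ?_⟩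
    have h3 := (le_sqDist x y j).trans_lt hy
    have h4 := hle j hj
    rcases min_lt_iff.1 h3 with h5 | h5
    · exact absurd (h4.trans (min_le_left _ _)) (not_le.2 h5)
    · exact h5.trans_le (h4.trans (min_le_right _ _))
  · intro h
    refine isOpen_iff_mem_nhds.2 fun x hx => ?_
    obtain ⟨ε, hε, hy⟩ := h x hx
    obtain ⟨N, hN⟩ := exists_nat_one_div_lt (half_pos hε)
    have : ∀ᶠ y in 𝓝 x, ∀ j ∈ Finset.range N, |x j - y j| < ε / 2 := by
      refine (Finset.eventually_all _).2 fun j _ => ?_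
      have := (continuous_apply j).continuousAt (x := x) |>.eventually
        (Metric.ball_mem_nhds (x j) (half_pos hε))
      filter_upwards [this] with y hy
      rwa [dist_comm] at hy
    filter_upwards [this] with y hy'
    refine hy y ((sqDist_le fun j => ?_).trans_lt (half_lt_self hε))
    by_cases hj : j < N
    · exact (min_le_right _ _).trans (hy' j (Finset.mem_range.2 hj)).le
    · refine (min_le_left _ _).trans (le_trans ?_ hN.le)
      exact one_div_le_one_div_of_le (by positivity) (by
        have : (N : ℝ) ≤ j := by exact_mod_cast not_lt.1 hj
        linarith)

lemma min_add_le {w a b c : ℝ} (hw : 0 ≤ w) (ha : 0 ≤ a) (hb : 0 ≤ b) (h : c ≤ a + b) :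
    min w c ≤ min w a + min w b := by
  rcases le_total w a with h1 | h1 <;> rcases le_total w b with h2 | h2 <;>
    simp only [min_eq_left, min_eq_right, h1, h2]
  · linarith [min_le_left w c]
  · linarith [min_le_left w c]
  · linarith [min_le_left w c]
  · linarith [min_le_right w c]

noncomputable instance : MetricSpace Sq :=
  letI : TopologicalSpace Sq := inferInstanceAs (TopologicalSpace (ℕ → ℝ))
  MetricSpace.ofDistTopology sqDist
    (fun x => le_antisymm (sqDist_le fun j => by simp [(weight_pos j).le])
      ((le_min (weight_pos 0).le (abs_nonneg _)).trans (le_sqDist x x 0)))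
    (fun x y => by unfold sqDist; simp_rw [abs_sub_comm])
    (fun x y z => sqDist_le fun j =>
      (min_add_le (weight_pos j).le (abs_nonneg (x j - y j)) (abs_nonneg (y j - z j))
        (abs_sub_le _ _ _)).trans (add_le_add (le_sqDist x y j) (le_sqDist y z j)))
    isOpen_iff_sqDist
    (fun x y h => funext fun j => by
      have h1 : min (weight j) |x j - y j| ≤ 0 := h ▸ le_sqDist x y j
      rcases min_le_iff.1 h1 with h2 | h2
      · exact absurd (weight_pos j) (not_lt.2 h2)
      · exact sub_eq_zero.1 (abs_eq_zero.1 (le_antisymm h2 (abs_nonneg _))))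

lemma min_le_dist (x y : Sq) (j : ℕ) : min (weight j) |x j - y j| ≤ dist x y := le_sqDist x y j

lemma dist_le {x y : Sq} {c : ℝ} (h : ∀ j, min (weight j) |x j - y j| ≤ c) : dist x y ≤ c :=
  sqDist_le h

/-- The identity as a homeomorphism onto the product. -/
def homeo : Sq ≃ₜ (ℕ → ℝ) where
  toFun x := x
  invFun x := x
  continuous_toFun := continuous_id (X := ℕ → ℝ)
  continuous_invFun := continuous_id (X := ℕ → ℝ)

lemma continuous_apply (j : ℕ) : Continuous fun x : Sq => x j :=
  _root_.continuous_apply (A := fun _ : ℕ => ℝ) j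

lemma continuous_mk {T : Type*} [TopologicalSpace T] {f : T → Sq}
    (h : ∀ j, Continuous fun t => f t j) : Continuous f :=
  continuous_pi (X := T) (A := fun _ : ℕ => ℝ) h

instance : SecondCountableTopology Sq :=
  inferInstanceAs (SecondCountableTopology (ℕ → ℝ))

instance : Nonempty Sq := ⟨fun _ => 0⟩

instance : CompleteSpace Sq := by
  refine Metric.complete_of_cauchySeq_tendsto fun u hu => ?_
  have h1 : ∀ j, CauchySeq fun n => u n j := fun j => by
    refine Metric.cauchySeq_iff.2 fun ε hε => ?_
    obtain ⟨N, hN⟩ := Metric.cauchySeq_iff.1 hu (min (weight j) ε) (lt_min (weight_pos j) hε)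
    refine ⟨N, fun m hm n hn => ?_⟩
    rcases min_lt_iff.1 ((min_le_dist _ _ j).trans_lt (hN m hm n hn)) with h | h
    · exact absurd (min_le_left _ _) (not_le.2 h)
    · exact h.trans_le (min_le_right _ _)
  choose l hl using fun j => cauchySeq_tendsto_of_complete (h1 j)
  exact ⟨l, tendsto_pi_nhds.2 hl⟩

lemma abs_max_add_sub_le (t a b a' b' : ℝ) :
    |max a (t + b) - max a' (t + b')| ≤ max |a - a'| |b - b'| :=
  (abs_max_sub_max_le_max _ _ _ _).trans_eq (by rw [add_sub_add_left_eq_sub])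

instance : MaxPlus Sq := inferInstanceAs (MaxPlus (ℕ → ℝ))

lemma mp_apply (t : ℝ) (a b : Sq) (j : ℕ) : mp t a b j = max (a j) (t + b j) := rfl

instance : MaxPlusMetric Sq where
  mp_self t x ht := funext fun j => max_eq_left (by linarith)
  dist_mp_le t a b a' b' := dist_le fun j => by
    refine (min_le_min_left _ (abs_max_add_sub_le t (a j) (b j) (a' j) (b' j))).trans ?_
    rw [min_max_distrib_left]
    exact max_le_max (min_le_dist a a' j) (min_le_dist b b' j)
  exists_compact K hK := by
    have h1 (j : ℕ) : ∃ c, ∀ x ∈ K, |x j| ≤ c := by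
      obtain ⟨c, hc⟩ := (hK.image (continuous_apply j)).isBounded.exists_norm_le
      exact ⟨c, fun x hx => hc _ ⟨x, hx, rfl⟩⟩
    choose c hc using h1
    refine ⟨{x : Sq | ∀ j, x j ∈ Icc (-c j) (c j)}, fun x hx j => abs_le.1 (hc j x hx), ?_, ?_⟩
    · have h2 := isCompact_univ_pi fun j : ℕ => isCompact_Icc (a := -c j) (b := c j)
      rw [show (univ.pi fun j => Icc (-c j) (c j)) = {x : ℕ → ℝ | ∀ j, x j ∈ Icc (-c j) (c j)} by
        ext x; exact mem_univ_pi] at h2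
      exact h2
    · intro a ha b hb t ht j
      rw [mp_apply]
      exact ⟨le_max_of_le_left (ha j).1, max_le (ha j).2 (by linarith [(hb j).2])⟩

end Sq

instance : MaxPlusMetric ℝ where
  mp_self t x ht := max_eq_left (by linarith)
  dist_mp_le t a b a' b' := Sq.abs_max_add_sub_le t a b a' b'
  exists_compact K hK := by
    obtain ⟨c, hc⟩ := hK.isBounded.exists_norm_le
    refine ⟨Icc (-c) c, fun x hx => abs_le.1 (hc x hx), isCompact_Icc, ?_⟩
    intro a ha b hb t ht
    exact ⟨le_max_of_le_left ha.1, max_le ha.2 (by linarith [hb.2])⟩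

instance {X Y : Type*} [MetricSpace X] [MetricSpace Y] [MaxPlusMetric X] [MaxPlusMetric Y] :
    MaxPlusMetric (X × Y) where
  mp_self t x ht := Prod.ext (MaxPlusMetric.mp_self t x.1 ht) (MaxPlusMetric.mp_self t x.2 ht)
  dist_mp_le t a b a' b' := by
    refine max_le ((MaxPlusMetric.dist_mp_le t a.1 b.1 a'.1 b'.1).trans ?_)
      ((MaxPlusMetric.dist_mp_le t a.2 b.2 a'.2 b'.2).trans ?_)
    · exact max_le_max (le_max_left _ _) (le_max_left _ _)
    · exact max_le_max (le_max_right _ _) (le_max_right _ _)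
  exists_compact K hK := by
    obtain ⟨L, h1, h2, h3⟩ := MaxPlusMetric.exists_compact _ (hK.image continuous_fst)
    obtain ⟨L', h1', h2', h3'⟩ := MaxPlusMetric.exists_compact _ (hK.image continuous_snd)
    refine ⟨L ×ˢ L', fun x hx => ⟨h1 ⟨x, hx, rfl⟩, h1' ⟨x, hx, rfl⟩⟩, h2.prod h2', ?_⟩
    exact fun a ha b hb t ht => ⟨h3 _ ha.1 _ hb.1 t ht, h3' _ ha.2 _ hb.2 t ht⟩

/-! ### Factor maps from local retractions -/

theorem factor_of_local {B E : Type} [MetricSpace B] [MetricSpace E] [CompleteSpace E]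
    [SeparableSpace E] [Nonempty E] {p : E → B} (hp : Continuous p) {C : ℝ} (hC : 0 ≤ C)
    (H : ∀ (O : Type) [MetricSpace O] (b : O → B) (δ : O → ℝ) (f : BumpCovering E O),
      Continuous b → Continuous δ → (∀ z, 0 < δ z) →
      (∀ z α, f α z ≠ 0 → dist (b z) (p α) ≤ 2 * δ z) →
      (∀ z α β, f α z ≠ 0 → f β z ≠ 0 → dist α β ≤ 64 * δ z) →
      ∃ ρ : O → E, Continuous ρ ∧ (∀ z, p (ρ z) = b z) ∧
        (∀ z e D, δ z ≤ D → b z = p e → (∀ α, f α z ≠ 0 → dist e α ≤ 48 * D) →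
          dist (ρ z) e ≤ C * D) ∧
        ∀ e, ∃ C' η : ℝ, 0 < η ∧ ∀ z D, δ z ≤ D → D < η → dist (b z) (p e) ≤ D →
          (∀ α, f α z ≠ 0 → dist e α ≤ 48 * D) → dist (ρ z) e ≤ C' * D) :
    ∃ h : E × (ℕ → ℝ) ≃ₜ B × (ℕ → ℝ), ∀ x, (h x).1 = p x.1 := by
  obtain ⟨σ, hσ, hσ'⟩ := exists_lipschitz_embedding_zeroAtInfty (E := E)
  let k : E → B × C₀(ℤ × ℕ, ℝ) := fun e => (p e, σ e)
  have hk : Continuous k := hp.prodMk hσ.continuous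
  have hk16 (e e' : E) : dist e e' ≤ 16 * dist (k e) (k e') :=
    (hσ' e e').trans (mul_le_mul_of_nonneg_left (le_max_right _ _) (by norm_num))
  have hkinj : Function.Injective k := fun e e' h => by
    have := hk16 e e'
    rw [h, dist_self, mul_zero] at this
    exact dist_le_zero.1 this
  have hσc : IsClosedEmbedding σ :=
    (AntilipschitzWith.of_le_mul_dist (K := 16) hσ').isClosedEmbedding hσ.uniformContinuous
  have hcl : IsClosed (range k) := by
    refine IsSeqClosed.isClosed fun u y hu hy => ?_
    choose e he using hu
    obtain rfl : (fun n => k (e n)) = u := funext he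
    have h2 : Tendsto (fun n => σ (e n)) atTop (𝓝 y.2) := (continuous_snd.tendsto y).comp hy
    obtain ⟨e', he'⟩ := hσc.isClosed_range.mem_of_tendsto h2
      (Eventually.of_forall fun n => mem_range_self _)
    rw [← he'] at h2
    have h3 := (hp.tendsto e').comp (hσc.isInducing.tendsto_nhds_iff.2 h2)
    exact ⟨e', Prod.ext (tendsto_nhds_unique h3 ((continuous_fst.tendsto y).comp hy)) he'⟩
  have hne : (range k).Nonempty := range_nonempty k
  let O : Type := ↥(range k)ᶜ
  let δ : O → ℝ := fun z => Metric.infDist z.1 (range k)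
  have hδ : Continuous δ := (Metric.continuous_infDist_pt _).comp continuous_subtype_val
  have hδ0 (z : O) : 0 < δ z := (hcl.notMem_iff_infDist_pos hne).1 z.2
  have hδle (z : O) (e : E) : δ z ≤ dist z.1 (k e) :=
    Metric.infDist_le_dist_of_mem (mem_range_self e)
  let U : E → Set O := fun e => {z | dist z.1 (k e) < 2 * δ z}
  have hU (e : E) : IsOpen (U e) :=
    isOpen_lt (continuous_subtype_val.dist continuous_const) (continuous_const.mul hδ)
  have hcov : (univ : Set O) ⊆ ⋃ e, U e := fun z _ => by
    have h2 : Metric.infDist z.1 (range k) < 2 * δ z := by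
      change δ z < 2 * δ z
      linarith [hδ0 z]
    obtain ⟨_, ⟨e, rfl⟩, he⟩ := (Metric.infDist_lt_iff hne).1 h2
    exact mem_iUnion.2 ⟨e, he⟩
  obtain ⟨f, hf⟩ := BumpCovering.exists_isSubordinate isClosed_univ U hU hcov
  have hact (z : O) (α : E) (h : f α z ≠ 0) : dist z.1 (k α) < 2 * δ z :=
    hf α (subset_tsupport _ h)
  obtain ⟨ρ, hρ, hpρ, hest, hest'⟩ := H O (fun z => z.1.1) δ f
    (continuous_fst.comp continuous_subtype_val) hδ hδ0
    (fun z α h => (le_max_left _ _).trans (hact z α h).le)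
    (fun z α β hα hβ => by
      have := dist_triangle_left (k α) (k β) z.1
      linarith [hk16 α β, hact z α hα, hact z β hβ])
  classical
  let r : B × C₀(ℤ × ℕ, ℝ) → E := fun z => if h : z ∈ range k then h.choose else ρ ⟨z, h⟩
  have hr1 (e : E) : r (k e) = e := by
    have h : k e ∈ range k := mem_range_self e
    change (if h : k e ∈ range k then h.choose else ρ ⟨k e, h⟩) = e
    rw [dif_pos h]
    exact hkinj h.choose_spec
  have hr2 (z : O) : r z.1 = ρ z := dif_neg z.2
  have hactive (z : O) (e : E) (α : E) (hα : f α z ≠ 0) : dist e α ≤ 48 * dist z.1 (k e) := by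
    have h1 := dist_triangle_left (k e) (k α) z.1
    linarith [hk16 e α, hact z α hα, hδle z e]
  have hrc : Continuous r := by
    refine continuous_iff_continuousAt.2 fun z => ?_
    by_cases h : z ∈ range k
    · obtain ⟨e, rfl⟩ := h
      rw [ContinuousAt, hr1, tendsto_iff_dist_tendsto_zero]
      obtain ⟨C', η, hη, hest'⟩ := hest' e
      have h0 : Tendsto (fun z => max C' 16 * dist z (k e)) (𝓝 (k e)) (𝓝 0) := by
        have : Continuous fun z => max C' 16 * dist z (k e) := by fun_prop
        simpa using this.tendsto (k e)
      refine squeeze_zero' (Eventually.of_forall fun _ => dist_nonneg) ?_ h0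
      filter_upwards [Metric.ball_mem_nhds (k e) hη] with z hz
      by_cases h : z ∈ range k
      · obtain ⟨e', rfl⟩ := h
        rw [hr1]
        exact (hk16 e' e).trans (mul_le_mul_of_nonneg_right (le_max_right _ _) dist_nonneg)
      · rw [show r z = ρ ⟨z, h⟩ from hr2 ⟨z, h⟩]
        exact (hest' ⟨z, h⟩ _ (hδle _ e) hz (le_max_left _ _) (hactive _ e)).trans
          (mul_le_mul_of_nonneg_right (le_max_left _ _) dist_nonneg)
    · have := (hcl.isOpen_compl.isOpenEmbedding_subtypeVal.continuousAt_iff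
        (g := r) (x := ⟨z, h⟩)).1 ?_
      · exact this
      · have : r ∘ Subtype.val = ρ := funext hr2
        rw [this]
        exact hρ.continuousAt
  refine factor_homeomorph_seq (κ := ℤ × ℕ) (Denumerable.eqv (ℤ × ℕ))
    (p := p) (σ := σ) (ρ := r) (C := max C 16) hp hσ hrc
    (le_max_of_le_left hC) (fun z => ?_) fun z e h => ?_
  · by_cases h : z ∈ range k
    · obtain ⟨e, rfl⟩ := h
      rw [hr1]
    · rw [show r z = ρ ⟨z, h⟩ from hr2 ⟨z, h⟩]
      exact hpρ _
  · suffices dist (r z) e ≤ max C 16 * dist z (k e) by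
      refine this.trans_eq ?_
      rw [Prod.dist_eq, ← h, dist_self, max_eq_right dist_nonneg, dist_eq_norm]
    by_cases hz : z ∈ range k
    · obtain ⟨e', rfl⟩ := hz
      rw [hr1]
      exact (hk16 e' e).trans (mul_le_mul_of_nonneg_right (le_max_right _ _) dist_nonneg)
    · rw [show r z = ρ ⟨z, hz⟩ from hr2 ⟨z, hz⟩]
      exact (hest ⟨z, hz⟩ e _ (hδle _ e) h.symm (hactive _ e)).trans
        (mul_le_mul_of_nonneg_right (le_max_left _ _) dist_nonneg)

/-! ### Forgetting a coordinate of a max-plus convex set -/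

section Tower

variable {X : Type} [MetricSpace X] [MaxPlusMetric X]

/-- The projection of a max-plus convex set in `X × ℝ` to `X`. -/
def Mpcc.fst : Mpcc (X × ℝ) → Mpcc X := Mpcc.map Prod.fst continuous_fst fun _ _ _ => rfl

lemma Mpcc.lipschitz_fst : LipschitzWith 1 (Mpcc.fst : Mpcc (X × ℝ) → Mpcc X) := by
  have key (A B : Mpcc (X × ℝ)) : ∀ x ∈ A.fst, ∃ y ∈ B.fst, dist x y ≤ dist A B := by
    rintro _ ⟨a, ha, rfl⟩
    obtain ⟨y, hy, h⟩ := A.exists_dist_le B ha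
    exact ⟨y.1, ⟨y, hy, rfl⟩, (le_max_left _ _).trans h⟩
  refine LipschitzWith.of_dist_le_mul fun A B => ?_
  rw [NNReal.coe_one, one_mul]
  exact Mpcc.dist_le dist_nonneg (key A B) (dist_comm A B ▸ key B A)

/-- A cutoff equal to one for `d ≤ 66 s` and vanishing for `132 s ≤ d`. -/
noncomputable def cutoff (s d : ℝ) : ℝ := max 0 (min 1 (2 - d / (66 * s)))

lemma cutoff_nonneg (s d : ℝ) : 0 ≤ cutoff s d := le_max_left _ _

lemma cutoff_le_one (s d : ℝ) : cutoff s d ≤ 1 := max_le zero_le_one (min_le_left _ _)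

lemma cutoff_eq_one {s d : ℝ} (hs : 0 < s) (h : d ≤ 66 * s) : cutoff s d = 1 := by
  have : d / (66 * s) ≤ 1 := (div_le_one (by positivity)).2 h
  unfold cutoff
  rw [min_eq_left (by linarith), max_eq_right zero_le_one]

lemma le_of_cutoff_pos {s d : ℝ} (hs : 0 < s) (h : 0 < cutoff s d) : d ≤ 132 * s := by
  unfold cutoff at h
  rcases lt_max_iff.1 h with h | h
  · exact absurd h (lt_irrefl _)
  · have h1 := h.trans_le (min_le_right _ _)
    have h2 : d / (66 * s) ≤ 2 := by linarith
    rw [div_le_iff₀ (by positivity)] at h2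
    linarith

lemma Mpcc.exists_height (e : Mpcc (X × ℝ)) : ∃ c, ∀ q ∈ e, |q.2| ≤ c := by
  obtain ⟨c, hc⟩ := (e.isCompact.image continuous_snd).isBounded.exists_norm_le
  exact ⟨c, fun q hq => hc _ ⟨q, hq, rfl⟩⟩

/-- A bound for the heights of the points of `e`. -/
noncomputable def Mpcc.height (e : Mpcc (X × ℝ)) : ℝ := e.exists_height.choose

lemma Mpcc.abs_le_height (e : Mpcc (X × ℝ)) {q : X × ℝ} (hq : q ∈ e) : |q.2| ≤ e.height :=
  e.exists_height.choose_spec q hq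

/-- A regularized supremum of `ε * r` over the points `(y, r)` of `e` with `y` near `x`. -/
noncomputable def localSup (e : Mpcc (X × ℝ)) (ε s : ℝ) (x : X) : ℝ :=
  sSup ((fun q => cutoff s (dist q.1 x) * (ε * q.2 + e.height) - e.height) '' (e : Set (X × ℝ)))

lemma continuous_localSup {T : Type*} [TopologicalSpace T] (e : Mpcc (X × ℝ)) (ε : ℝ)
    {s : T → ℝ} (hs : Continuous s) (h0 : ∀ t, 0 < s t) {x : T → X} (hx : Continuous x) :
    Continuous fun t => localSup e ε (s t) (x t) := by
  refine e.isCompact.continuous_sSup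
    (f := fun t q => cutoff (s t) (dist q.1 (x t)) * (ε * q.2 + e.height) - e.height) ?_
  have h1 : ∀ q : T × (X × ℝ), 66 * s q.1 ≠ 0 := fun q => (mul_pos (by norm_num) (h0 q.1)).ne'
  have h2 : Continuous fun q : T × (X × ℝ) => dist q.2.1 (x q.1) / (66 * s q.1) :=
    Continuous.div (by fun_prop) (by fun_prop) h1
  unfold cutoff
  change Continuous fun q : T × (X × ℝ) =>
    max 0 (min 1 (2 - dist q.2.1 (x q.1) / (66 * s q.1))) * (ε * q.2.2 + e.height) - e.height
  fun_prop

lemma bddAbove_localSup (e : Mpcc (X × ℝ)) (ε s : ℝ) (x : X) : BddAbove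
    ((fun q => cutoff s (dist q.1 x) * (ε * q.2 + e.height) - e.height) ''
      (e : Set (X × ℝ))) := by
  refine (e.isCompact.image ?_).bddAbove
  unfold cutoff
  fun_prop

lemma height_add_nonneg {e : Mpcc (X × ℝ)} {ε : ℝ} (hε : |ε| = 1) {q : X × ℝ} (hq : q ∈ e) :
    0 ≤ ε * q.2 + e.height := by
  have h1 := neg_abs_le (ε * q.2)
  rw [abs_mul, hε, one_mul] at h1
  linarith [e.abs_le_height hq]

lemma le_localSup (e : Mpcc (X × ℝ)) (ε : ℝ) {s : ℝ} (hs : 0 < s) {x : X} {q : X × ℝ}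
    (hq : q ∈ e) (h : dist q.1 x ≤ 66 * s) : ε * q.2 ≤ localSup e ε s x := by
  refine le_csSup (bddAbove_localSup e ε s x) ⟨q, hq, ?_⟩
  simp [cutoff_eq_one hs h]

lemma exists_localSup_le (e : Mpcc (X × ℝ)) {ε : ℝ} (hε : |ε| = 1) {s : ℝ} (hs : 0 < s) {x : X}
    (h : ∃ q ∈ e, dist q.1 x ≤ 66 * s) :
    ∃ q ∈ e, dist q.1 x ≤ 132 * s ∧ localSup e ε s x ≤ ε * q.2 := by
  obtain ⟨q₀, hq₀, hd⟩ := h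
  obtain ⟨q, hq, hsup⟩ := e.isCompact.exists_sSup_image_eq e.nonempty
    (f := fun q => cutoff s (dist q.1 x) * (ε * q.2 + e.height) - e.height)
    (by unfold cutoff; fun_prop)
  have hsup : localSup e ε s x = _ := hsup
  rcases (cutoff_nonneg s (dist q.1 x)).eq_or_lt with h0 | h0
  · refine ⟨q₀, hq₀, by linarith, ?_⟩
    rw [hsup, ← h0]
    linarith [height_add_nonneg hε hq₀]
  · refine ⟨q, hq, le_of_cutoff_pos hs h0, ?_⟩
    rw [hsup]
    have := mul_le_mul_of_nonneg_right (cutoff_le_one s (dist q.1 x)) (height_add_nonneg hε hq)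
    linarith

lemma PartitionOfUnity.exists_finsum_le {ι O : Type*} [TopologicalSpace O]
    (g : PartitionOfUnity ι O) (z : O) (a : ι → ℝ) :
    ∃ i, g i z ≠ 0 ∧ ∑ᶠ i, g i z • a i ≤ a i := by
  by_contra! h
  exact lt_irrefl (∑ᶠ i, g i z • a i) (g.finsum_smul_mem_convex (g := fun i _ => a i)
    (t := Iio (∑ᶠ i, g i z • a i)) (mem_univ z) (fun i hi => h i hi) (convex_Iio _))

lemma PartitionOfUnity.le_finsum {ι O : Type*} [TopologicalSpace O]
    (g : PartitionOfUnity ι O) (z : O) {a : ι → ℝ} {c : ℝ} (h : ∀ i, g i z ≠ 0 → c ≤ a i) :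
    c ≤ ∑ᶠ i, g i z • a i :=
  g.finsum_smul_mem_convex (g := fun i _ => a i) (t := Ici c) (mem_univ z) h (convex_Ici _)

variable {O : Type} [MetricSpace O]

/-- The averaged heights over a partition of unity. -/
noncomputable def avgSup (g : PartitionOfUnity (Mpcc (X × ℝ)) O) (δ : O → ℝ) (ε : ℝ) (z : O)
    (x : X) : ℝ := ∑ᶠ α, g α z • localSup α ε (δ z) x

lemma continuous_avgSup (g : PartitionOfUnity (Mpcc (X × ℝ)) O) {δ : O → ℝ} (hδ : Continuous δ)
    (hδ0 : ∀ z, 0 < δ z) (ε : ℝ) : Continuous fun q : O × X => avgSup g δ ε q.1 q.2 := by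
  refine continuous_finsum (fun α => ?_) ?_
  · exact ((g α).continuous.comp continuous_fst).smul
      (continuous_localSup α ε (hδ.comp continuous_fst) (fun _ => hδ0 _) continuous_snd)
  · refine (g.locallyFinite.preimage_continuous
      (continuous_fst : Continuous (Prod.fst : O × X → O))).subset fun α q hq => ?_
    exact left_ne_zero_of_mul hq

/-- The compact set of pairs `(x, s)` with `x ∈ b z` and `s` between the averaged heights. -/
noncomputable def avgBand (g : PartitionOfUnity (Mpcc (X × ℝ)) O) (b : O → Mpcc X) {δ : O → ℝ}
    (hδ : Continuous δ) (hδ0 : ∀ z, 0 < δ z) (z : O) : NonemptyCompacts (X × ℝ) :=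
  ((b z).1 ×ˢ (⟨⟨Icc 0 1, isCompact_Icc⟩, nonempty_Icc.2 zero_le_one⟩ : NonemptyCompacts ℝ)).map
    (fun q => (q.1, (1 - q.2) * -avgSup g δ (-1) z q.1 + q.2 * avgSup g δ 1 z q.1)) (by
      have h (ε : ℝ) : Continuous fun q : X × ℝ => avgSup g δ ε z q.1 :=
        (continuous_avgSup g hδ hδ0 ε).comp (continuous_const.prodMk continuous_fst)
      have h1 := h 1
      have h2 := h (-1)
      fun_prop)

lemma continuous_avgBand (g : PartitionOfUnity (Mpcc (X × ℝ)) O) {b : O → Mpcc X}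
    (hb : Continuous b) {δ : O → ℝ} (hδ : Continuous δ) (hδ0 : ∀ z, 0 < δ z) :
    Continuous (avgBand g b hδ hδ0) := by
  refine Continuous.nonemptyCompacts_map' (g := fun (z : O) (q : X × ℝ) =>
    (q.1, (1 - q.2) * -avgSup g δ (-1) z q.1 + q.2 * avgSup g δ 1 z q.1)) ?_ ?_
  · exact NonemptyCompacts.continuous_prod.comp
      ((Mpcc.continuous_val.comp hb).prodMk continuous_const)
  · have h (ε : ℝ) : Continuous fun q : O × (X × ℝ) => avgSup g δ ε q.1 q.2.1 :=
      (continuous_avgSup g hδ hδ0 ε).comp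
        (continuous_fst.prodMk (continuous_fst.comp continuous_snd))
    have h1 := h 1
    have h2 := h (-1)
    simp only [Function.uncurry_def]
    fun_prop

lemma mem_avgBand (g : PartitionOfUnity (Mpcc (X × ℝ)) O) (b : O → Mpcc X) {δ : O → ℝ}
    (hδ : Continuous δ) (hδ0 : ∀ z, 0 < δ z) (z : O) {q : X × ℝ}
    (hle : ∀ x ∈ b z, -avgSup g δ (-1) z x ≤ avgSup g δ 1 z x) :
    q ∈ avgBand g b hδ hδ0 z ↔ q.1 ∈ b z ∧ -avgSup g δ (-1) z q.1 ≤ q.2 ∧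
      q.2 ≤ avgSup g δ 1 z q.1 := by
  constructor
  · rintro ⟨⟨x, θ⟩, ⟨hx, hθ⟩, rfl⟩
    have h := hle x hx
    have hθ : 0 ≤ θ ∧ θ ≤ 1 := hθ
    refine ⟨hx, ?_, ?_⟩ <;> dsimp only <;> nlinarith
  · rintro ⟨hx, h1, h2⟩
    have h : q.2 ∈ segment ℝ (-avgSup g δ (-1) z q.1) (avgSup g δ 1 z q.1) := by
      rw [segment_eq_Icc (h1.trans h2)]
      exact ⟨h1, h2⟩
    rw [segment_eq_image] at h
    obtain ⟨θ, hθ, hθ'⟩ := h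
    exact ⟨(q.1, θ), ⟨hx, hθ⟩, Prod.ext rfl hθ'⟩

/-- Interpolating two points of a convex set to a prescribed height. -/
lemma Mpcc.exists_mem_height (e : Mpcc (X × ℝ)) {a b : X × ℝ} (ha : a ∈ e) (hb : b ∈ e) {x : X}
    {s r c : ℝ} (hc : c ≤ r) (hs : s ≤ a.2 + c) (hs' : b.2 ≤ s + c) (hax : dist a.1 x ≤ r)
    (hbx : dist b.1 x ≤ r) : ∃ q ∈ e, dist (x, s) q ≤ r := by
  rcases le_total s a.2 with h1 | h1
  · rcases le_total b.2 s with h2 | h2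
    · have ht : s - a.2 ≤ 0 := by linarith
      refine ⟨mp (s - a.2) b a, e.mp_mem hb ha ht, ?_⟩
      refine max_le ?_ ?_
      · rw [dist_comm]
        exact (dist_mp_le_right ht b.1 a.1 x).trans (max_le hbx hax)
      · change |s - max b.2 (s - a.2 + a.2)| ≤ r
        rw [sub_add_cancel, max_eq_right h2, sub_self, abs_zero]
        exact dist_nonneg.trans hax
    · refine ⟨b, hb, max_le (by rwa [dist_comm]) ?_⟩
      change |s - b.2| ≤ r
      rw [abs_le]; constructor <;> linarith
  · refine ⟨a, ha, max_le (by rwa [dist_comm]) ?_⟩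
    change |s - a.2| ≤ r
    rw [abs_le]; constructor <;> linarith

theorem mpcc_fst_factor [CompleteSpace X] [SecondCountableTopology X] [Nonempty X] :
    ∃ h : Mpcc (X × ℝ) × (ℕ → ℝ) ≃ₜ Mpcc X × (ℕ → ℝ), ∀ x, (h x).1 = x.1.fst := by
  have : Nonempty (Mpcc (X × ℝ)) :=
    ⟨Mpcc.hull ⟨⟨{(Classical.arbitrary X, 0)}, isCompact_singleton⟩, singleton_nonempty _⟩⟩
  refine factor_of_local Mpcc.lipschitz_fst.continuous (C := 180) (by norm_num) ?_
  intro O _ b δ f hb hδ hδ0 hact hact2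
  let g := f.toPartitionOfUnity
  have hg (z : O) (α : Mpcc (X × ℝ)) (h : g α z ≠ 0) : f α z ≠ 0 := left_ne_zero_of_mul h
  -- active sets have points over every point of the base
  have hpt (z : O) (α : Mpcc (X × ℝ)) (h : f α z ≠ 0) (x : X) (hx : x ∈ b z) :
      ∃ q ∈ α, dist q.1 x ≤ 66 * δ z := by
    obtain ⟨_, ⟨q, hq, rfl⟩, hd⟩ := (b z).exists_dist_le α.fst hx
    refine ⟨q, hq, ?_⟩
    rw [dist_comm]
    linarith [hact z α h, hδ0 z]
  have hle (z : O) (x : X) (hx : x ∈ b z) : -avgSup g δ (-1) z x ≤ avgSup g δ 1 z x := by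
    have h1 : ∀ α, g α z ≠ 0 → ∃ r : ℝ, -localSup α (-1) (δ z) x ≤ r ∧
        r ≤ localSup α 1 (δ z) x := fun α hα => by
      obtain ⟨q, hq, hd⟩ := hpt z α (hg z α hα) x hx
      exact ⟨q.2, by linarith [le_localSup α (-1) (hδ0 z) hq hd],
        by linarith [le_localSup α 1 (hδ0 z) hq hd]⟩
    have h2 : (0 : ℝ) ≤ ∑ᶠ α, g α z • (localSup α 1 (δ z) x + localSup α (-1) (δ z) x) :=
      g.le_finsum z fun α hα => by
        obtain ⟨r, hr, hr'⟩ := h1 α hα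
        linarith
    have hfin : (Function.support fun α => g α z).Finite := g.locallyFinite.point_finite z
    simp only [smul_add] at h2
    rw [finsum_add_distrib (f := fun α => g α z • localSup α 1 (δ z) x)
      (g := fun α => g α z • localSup α (-1) (δ z) x)
      (hfin.subset fun α hα => left_ne_zero_of_mul hα)
      (hfin.subset fun α hα => left_ne_zero_of_mul hα)] at h2
    unfold avgSup
    linarith
  have hest (z : O) (e : Mpcc (X × ℝ)) (D : ℝ) (hD : δ z ≤ D)
      (he : ∀ α, f α z ≠ 0 → dist e α ≤ 48 * D) :
      dist (Mpcc.hull (avgBand g b hδ hδ0 z)) e ≤ 180 * D := by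
    have hδz := hδ0 z
    refine Mpcc.dist_hull_le (by linarith) (fun q hq => ?_) fun q hq => ?_
    · obtain ⟨hx, h1, h2⟩ := (mem_avgBand g b hδ hδ0 z (hle z)).1 hq
      have key (ε : ℝ) (hε : |ε| = 1) (h : ε * q.2 ≤ avgSup g δ ε z q.1) :
          ∃ a ∈ e, dist a.1 q.1 ≤ 180 * D ∧ ε * q.2 ≤ ε * a.2 + 48 * D := by
        obtain ⟨α, hα, hα'⟩ := g.exists_finsum_le z fun α => localSup α ε (δ z) q.1
        obtain ⟨c, hc, hcd, hcs⟩ := exists_localSup_le α hε hδz (hpt z α (hg z α hα) q.1 hx)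
        obtain ⟨a, ha, had⟩ := α.exists_dist_le e hc
        rw [dist_comm α e] at had
        replace had := had.trans (he α (hg z α hα))
        refine ⟨a, ha, ?_, ?_⟩
        · have h3 : dist c.1 a.1 ≤ 48 * D := (le_max_left _ _).trans had
          linarith [dist_triangle_left a.1 q.1 c.1]
        · have h3 : |c.2 - a.2| ≤ 48 * D := (le_max_right _ _).trans had
          have h4 : |ε * (c.2 - a.2)| ≤ 48 * D := by rwa [abs_mul, hε, one_mul]
          have h5 := (le_abs_self _).trans h4
          have h6 : avgSup g δ ε z q.1 ≤ localSup α ε (δ z) q.1 := hα'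
          linarith
      obtain ⟨a, ha, had, has⟩ := key 1 (by norm_num) (by linarith)
      obtain ⟨c, hc, hcd, hcs⟩ := key (-1) (by norm_num) (by linarith)
      exact e.exists_mem_height ha hc (c := 48 * D) (by linarith) (by linarith) (by linarith)
        had hcd
    · obtain ⟨α₀, hα₀, -⟩ := g.exists_finsum_le z fun _ => 0
      have hα₀ := hg z α₀ hα₀
      obtain ⟨q₀, hq₀, hqd⟩ := e.exists_dist_le α₀ hq
      replace hqd := hqd.trans (he α₀ hα₀)
      obtain ⟨x, hx, hxd⟩ := α₀.fst.exists_dist_le (b z) ⟨q₀, hq₀, rfl⟩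
      rw [dist_comm α₀.fst] at hxd
      replace hxd := hxd.trans (hact z α₀ hα₀)
      have key (ε : ℝ) (hε : |ε| = 1) : ε * q₀.2 - 64 * δ z ≤ avgSup g δ ε z x := by
        refine g.le_finsum z fun α hα => ?_
        obtain ⟨c, hc, hcd⟩ := α₀.exists_dist_le α hq₀
        replace hcd := hcd.trans (hact2 z α₀ α hα₀ (hg z α hα))
        have h3 : |q₀.2 - c.2| ≤ 64 * δ z := (le_max_right _ _).trans hcd
        have h4 : |ε * (q₀.2 - c.2)| ≤ 64 * δ z := by rwa [abs_mul, hε, one_mul]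
        have h5 := (le_abs_self _).trans h4
        have h6 : dist q₀.1 c.1 ≤ 64 * δ z := (le_max_left _ _).trans hcd
        have h7 := le_localSup α ε hδz hc (x := x) (by
          linarith [dist_triangle_left c.1 x q₀.1])
        linarith
      have k1 := key 1 (by norm_num)
      have k2 := key (-1) (by norm_num)
      have k3 := hle z x hx
      refine ⟨(x, max (-avgSup g δ (-1) z x) (min q₀.2 (avgSup g δ 1 z x))),
        (mem_avgBand g b hδ hδ0 z (hle z)).2 ⟨hx, le_max_left _ _, max_le k3 (min_le_right _ _)⟩, ?_⟩
      have h8 : |q₀.2 - max (-avgSup g δ (-1) z x) (min q₀.2 (avgSup g δ 1 z x))| ≤ 64 * δ z := by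
        rw [abs_le]
        constructor
        · have : max (-avgSup g δ (-1) z x) (min q₀.2 (avgSup g δ 1 z x)) ≤ q₀.2 + 64 * δ z :=
            max_le (by linarith) ((min_le_left _ _).trans (by linarith))
          linarith
        · have : q₀.2 - 64 * δ z ≤ max (-avgSup g δ (-1) z x) (min q₀.2 (avgSup g δ 1 z x)) :=
            le_max_of_le_right (le_min (by linarith) (by linarith))
          linarith
      have h9 : dist q₀ (x, max (-avgSup g δ (-1) z x) (min q₀.2 (avgSup g δ 1 z x))) ≤
          64 * δ z := max_le (by dsimp only; linarith) h8
      linarith [dist_triangle q q₀ (x, max (-avgSup g δ (-1) z x) (min q₀.2 (avgSup g δ 1 z x)))]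
  refine ⟨fun z => Mpcc.hull (avgBand g b hδ hδ0 z),
    Mpcc.lipschitz_hull.continuous.comp (continuous_avgBand g hb hδ hδ0), fun z => ?_,
    fun z e D hD _ he => hest z e D hD he,
    fun e => ⟨180, 1, one_pos, fun z D hD _ _ he => hest z e D hD he⟩⟩
  · refine SetLike.coe_injective (Subset.antisymm ?_ fun x hx => ?_)
    · rintro _ ⟨q, hq, rfl⟩
      have hsub : (Mpcc.hull (avgBand g b hδ hδ0 z) : Set (X × ℝ)) ⊆ Prod.fst ⁻¹' (b z : Set X) :=
        Mpcc.hull_subset (fun q hq => ((mem_avgBand g b hδ hδ0 z (hle z)).1 hq).1)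
          ((b z).isCompact.isClosed.preimage continuous_fst)
          fun a ha c hc t ht => (b z).mp_mem ha hc ht
      exact hsub hq
    · exact ⟨(x, avgSup g δ 1 z x), Mpcc.subset_hull _ ((mem_avgBand g b hδ hδ0 z (hle z)).2
        ⟨hx, hle z x hx, le_rfl⟩), rfl⟩

end Tower

/-! ### Complete metrics on open subspaces -/

/-- The open set where a 1-Lipschitz function `κ` is positive. -/
def Collar {Y : Type*} [MetricSpace Y] {κ : Y → ℝ} (_ : LipschitzWith 1 κ) : Type _ :=
  {y : Y // 0 < κ y}

namespace Collar

variable {Y : Type*} [MetricSpace Y] {κ : Y → ℝ} {hκ : LipschitzWith 1 κ}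

/-- The relative size `1 + dist y y' / min (κ y) (κ y')`. -/
noncomputable def ratio (y y' : Collar hκ) : ℝ := 1 + dist y.1 y'.1 / min (κ y.1) (κ y'.1)

lemma min_pos (y y' : Collar hκ) : 0 < min (κ y.1) (κ y'.1) := lt_min y.2 y'.2

lemma one_le_ratio (y y' : Collar hκ) : 1 ≤ ratio y y' :=
  le_add_of_nonneg_right (div_nonneg dist_nonneg (min_pos y y').le)

lemma ratio_comm (y y' : Collar hκ) : ratio y y' = ratio y' y := by
  unfold ratio
  rw [dist_comm, min_comm]

lemma le_add_dist (hκ : LipschitzWith 1 κ) (y y' : Y) : κ y ≤ κ y' + dist y y' := by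
  have := hκ.dist_le_mul y y'
  rw [NNReal.coe_one, one_mul] at this
  linarith [(abs_le.1 this).2]

lemma ratio_triangle (x y z : Collar hκ) : ratio x z ≤ ratio x y * ratio y z := by
  wlog h : κ x.1 ≤ κ z.1 generalizing x z
  · rw [ratio_comm x z, ratio_comm x y, ratio_comm y z, mul_comm]
    exact this z x (le_of_not_ge h)
  have hx := x.2
  have hy := y.2
  have h1 : dist x.1 z.1 / κ x.1 ≤ dist x.1 y.1 / κ x.1 + dist y.1 z.1 / κ x.1 := by
    rw [← add_div]
    exact div_le_div_of_nonneg_right (dist_triangle _ _ _) hx.le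
  have hxz : ratio x z = 1 + dist x.1 z.1 / κ x.1 := by unfold ratio; rw [min_eq_left h]
  have n1 : 0 ≤ dist x.1 y.1 := dist_nonneg
  have n2 : 0 ≤ dist y.1 z.1 := dist_nonneg
  rw [hxz]
  rcases le_total (κ x.1) (κ y.1) with h2 | h2
  · have hxy : ratio x y = 1 + dist x.1 y.1 / κ x.1 := by unfold ratio; rw [min_eq_left h2]
    have hm : min (κ y.1) (κ z.1) ≤ κ x.1 + dist x.1 y.1 :=
      (min_le_left _ _).trans (by rw [dist_comm]; exact le_add_dist hκ _ _)
    have hm0 := min_pos y z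
    have h3 : dist y.1 z.1 / κ x.1 ≤
        (1 + dist x.1 y.1 / κ x.1) * (dist y.1 z.1 / min (κ y.1) (κ z.1)) := by
      have : 1 + dist x.1 y.1 / κ x.1 = (κ x.1 + dist x.1 y.1) / κ x.1 := by field_simp
      rw [this, div_mul_div_comm, div_le_div_iff₀ hx (mul_pos hx hm0)]
      have := mul_le_mul_of_nonneg_left hm (mul_nonneg n2 hx.le)
      nlinarith
    rw [hxy]
    unfold ratio
    linarith
  · have hxy : ratio x y = 1 + dist x.1 y.1 / κ y.1 := by unfold ratio; rw [min_eq_right h2]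
    have hyz : ratio y z = 1 + dist y.1 z.1 / κ y.1 := by
      unfold ratio; rw [min_eq_left (h2.trans h)]
    rw [hxy, hyz]
    have h3 := div_le_div_of_nonneg_left n1 hy h2
    have h4 := div_le_div_of_nonneg_left n2 hy h2
    have h5 : 0 ≤ dist x.1 y.1 / κ y.1 * (dist y.1 z.1 / κ y.1) :=
      mul_nonneg (div_nonneg n1 hy.le) (div_nonneg n2 hy.le)
    linarith

/-- The underlying distance function. -/
noncomputable def collarDist (y y' : Collar hκ) : ℝ := min 1 (Real.log (ratio y y'))

lemma collarDist_nonneg (y y' : Collar hκ) : 0 ≤ collarDist y y' :=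
  le_min zero_le_one (Real.log_nonneg (one_le_ratio y y'))

lemma collarDist_le (y y' : Collar hκ) :
    collarDist y y' ≤ dist y.1 y'.1 / min (κ y.1) (κ y'.1) := by
  refine (min_le_right _ _).trans ((Real.log_le_sub_one_of_pos ?_).trans_eq ?_)
  · linarith [one_le_ratio y y']
  · unfold ratio; ring

lemma le_of_collarDist_le {y y' : Collar hκ} (h : collarDist y y' ≤ 1 / 2) :
    dist y.1 y'.1 ≤ 2 * collarDist y y' * min (κ y.1) (κ y'.1) := by
  have h1 : collarDist y y' = Real.log (ratio y y') := by
    refine min_eq_right (le_of_not_ge fun h' => ?_)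
    rw [collarDist, min_eq_left h'] at h
    norm_num at h
  have h0 := collarDist_nonneg y y'
  set t := collarDist y y'
  have h2 : ratio y y' = Real.exp t := by
    rw [h1, Real.exp_log (by linarith [one_le_ratio y y'])]
  have h3 : Real.exp t * (1 - t) ≤ 1 := by
    have := mul_le_mul_of_nonneg_left (Real.one_sub_le_exp_neg t) (Real.exp_pos t).le
    rwa [← Real.exp_add, add_neg_cancel, Real.exp_zero] at this
  have h4 : Real.exp t ≤ 1 + 2 * t := by nlinarith
  have h5 : dist y.1 y'.1 / min (κ y.1) (κ y'.1) ≤ 2 * t := by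
    rw [← h2] at h4
    unfold ratio at h4
    linarith
  rwa [div_le_iff₀ (min_pos y y')] at h5

instance : TopologicalSpace (Collar hκ) := instTopologicalSpaceSubtype

lemma isOpen_iff_collarDist (s : Set (Collar hκ)) :
    IsOpen s ↔ ∀ x ∈ s, ∃ ε > 0, ∀ y, collarDist x y < ε → y ∈ s := by
  constructor
  · intro hs x hx
    obtain ⟨t, ht, rfl⟩ := isOpen_induced_iff.1 hs
    obtain ⟨ε, hε, h⟩ := Metric.isOpen_iff.1 ht x.1 hx
    have hx0 := x.2
    refine ⟨min (1 / 2) (ε / (2 * κ x.1)), lt_min (by norm_num) (by positivity), fun y hy => ?_⟩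
    have h1 := le_of_collarDist_le (hy.le.trans (min_le_left _ _))
    have h2 := hy.trans_le (min_le_right _ _)
    rw [lt_div_iff₀ (by positivity)] at h2
    refine h ?_
    rw [Metric.mem_ball, dist_comm]
    refine h1.trans_lt (lt_of_le_of_lt (mul_le_mul_of_nonneg_left (min_le_left _ _)
      (mul_nonneg zero_le_two (collarDist_nonneg x y))) ?_)
    linarith
  · intro h
    refine isOpen_iff_mem_nhds.2 fun x hx => ?_
    obtain ⟨ε, hε, hs⟩ := h x hx
    have hx0 := x.2
    have h1 : Tendsto (fun y : Collar hκ => dist x.1 y.1 / min (κ x.1) (κ y.1)) (𝓝 x) (𝓝 0) := by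
      have hc : Continuous (Subtype.val : Collar hκ → Y) := continuous_subtype_val
      have : Continuous fun y : Collar hκ => dist x.1 y.1 / min (κ x.1) (κ y.1) :=
        (continuous_const.dist hc).div (continuous_const.min (hκ.continuous.comp hc))
          fun y => (min_pos x y).ne'
      simpa using this.tendsto x
    filter_upwards [h1.eventually (gt_mem_nhds hε)] with y hy
    exact hs y ((collarDist_le x y).trans_lt hy)

noncomputable instance : MetricSpace (Collar hκ) :=
  MetricSpace.ofDistTopology collarDist
    (fun x => by simp [collarDist, ratio])
    (fun x y => by unfold collarDist; rw [ratio_comm])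
    (fun x y z => by
      have h1 := one_le_ratio x y
      have h2 := one_le_ratio y z
      refine Sq.min_add_le zero_le_one (Real.log_nonneg h1) (Real.log_nonneg h2) ?_
      rw [← Real.log_mul (by linarith) (by linarith)]
      exact Real.log_le_log (by linarith [one_le_ratio x z]) (ratio_triangle x y z))
    isOpen_iff_collarDist
    (fun x y h => by
      have h1 := le_of_collarDist_le (h.le.trans (by norm_num))
      rw [h, mul_zero, zero_mul] at h1
      exact Subtype.ext (dist_le_zero.1 h1))

lemma dist_le_one (y y' : Collar hκ) : dist y y' ≤ 1 := min_le_left _ _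

lemma dist_le_div (y y' : Collar hκ) : dist y y' ≤ dist y.1 y'.1 / min (κ y.1) (κ y'.1) :=
  collarDist_le y y'

lemma dist_val_le {y y' : Collar hκ} (h : dist y y' ≤ 1 / 2) :
    dist y.1 y'.1 ≤ 2 * dist y y' * min (κ y.1) (κ y'.1) := le_of_collarDist_le h

lemma continuous_val : Continuous (Subtype.val : Collar hκ → Y) := continuous_subtype_val

instance [SecondCountableTopology Y] : SecondCountableTopology (Collar hκ) :=
  inferInstanceAs (SecondCountableTopology {y : Y // 0 < κ y})

instance [CompleteSpace Y] : CompleteSpace (Collar hκ) := by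
  refine Metric.complete_of_cauchySeq_tendsto fun u hu => ?_
  obtain ⟨N, hN⟩ := Metric.cauchySeq_iff'.1 hu (1 / 8) (by norm_num)
  have h1 : ∀ n ≥ N, κ (u N).1 / 2 ≤ κ (u n).1 ∧ κ (u n).1 ≤ 2 * κ (u N).1 := fun n hn => by
    have h2 := hN n hn
    have h3 := dist_val_le (h2.le.trans (by norm_num))
    have h4 : 2 * dist (u n) (u N) * min (κ (u n).1) (κ (u N).1) ≤ 1 / 2 * κ (u N).1 :=
      mul_le_mul (by linarith) (min_le_right _ _) (min_pos _ _).le (by norm_num)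
    have h5 := le_add_dist hκ (u N).1 (u n).1
    have h6 := le_add_dist hκ (u n).1 (u N).1
    rw [dist_comm] at h5
    have := (u N).2
    constructor <;> linarith
  have hc : CauchySeq fun n => (u n).1 := by
    refine Metric.cauchySeq_iff.2 fun ε hε => ?_
    have h0 := (u N).2
    obtain ⟨K, hK⟩ := Metric.cauchySeq_iff.1 hu (min (1 / 2) (ε / (4 * κ (u N).1)))
      (lt_min (by norm_num) (by positivity))
    refine ⟨max K N, fun m hm n hn => ?_⟩
    have h2 := hK m (le_of_max_le_left hm) n (le_of_max_le_left hn)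
    have h3 := dist_val_le (h2.le.trans (min_le_left _ _))
    have h4 := h2.trans_le (min_le_right _ _)
    rw [lt_div_iff₀ (by positivity)] at h4
    have h5 : 2 * dist (u m) (u n) * min (κ (u m).1) (κ (u n).1) ≤
        2 * dist (u m) (u n) * (2 * κ (u N).1) :=
      mul_le_mul_of_nonneg_left ((min_le_left _ _).trans (h1 m (le_of_max_le_right hm)).2)
        (mul_nonneg zero_le_two dist_nonneg)
    linarith
  obtain ⟨y, hy⟩ := cauchySeq_tendsto_of_complete hc
  have hy0 : κ (u N).1 / 2 ≤ κ y :=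
    ge_of_tendsto ((hκ.continuous.tendsto y).comp hy)
      (eventually_atTop.2 ⟨N, fun n hn => (h1 n hn).1⟩)
  exact ⟨⟨y, (half_pos (u N).2).trans_le hy0⟩, tendsto_subtype_rng.2 hy⟩

end Collar

/-! ### Suprema of coordinates and depth -/

lemma NonemptyCompacts.lipschitz_sSup :
    LipschitzWith 1 fun K : NonemptyCompacts ℝ => sSup (K : Set ℝ) := by
  refine LipschitzWith.of_le_add fun K L => ?_
  refine csSup_le K.nonempty fun x hx => ?_
  obtain ⟨y, hy, h⟩ := NonemptyCompacts.exists_dist_le K L hx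
  have := le_csSup L.isCompact.bddAbove hy
  linarith [(abs_le.1 h).2]

lemma Mpcc.continuous_sSup_image {X : Type*} [TopologicalSpace X] [MaxPlus X] {g : X → ℝ}
    (hg : Continuous g) : Continuous fun A : Mpcc X => sSup (g '' A) :=
  NonemptyCompacts.lipschitz_sSup.continuous.comp
    (hg.nonemptyCompacts_map.comp Mpcc.continuous_val)

namespace Sq

/-- The coordinatewise supremum. -/
noncomputable def top (A : Mpcc Sq) : Sq := fun j => sSup ((fun x : Sq => x j) '' A)

lemma le_top {A : Mpcc Sq} {a : Sq} (ha : a ∈ A) (j : ℕ) : a j ≤ top A j :=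
  le_csSup (A.isCompact.image (continuous_apply j)).bddAbove ⟨a, ha, rfl⟩

lemma top_mem (A : Mpcc Sq) : top A ∈ A := by
  have h1 (j : ℕ) : ∃ a ∈ A, a j = top A j := by
    obtain ⟨a, ha, h⟩ := A.isCompact.exists_sSup_image_eq A.nonempty (f := fun x : Sq => x j)
      (continuous_apply j).continuousOn
    exact ⟨a, ha, h.symm⟩
  have h2 (u : Finset ℕ) : ∃ a ∈ A, ∀ j ∈ u, a j = top A j := by
    induction u using Finset.induction with
    | empty => exact ⟨_, A.nonempty.some_mem, by simp⟩
    | insert i u _ ih =>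
      obtain ⟨a, ha, h⟩ := ih
      obtain ⟨b, hb, h'⟩ := h1 i
      have hc := A.mp_mem ha hb le_rfl
      refine ⟨mp 0 a b, hc, fun j hj => le_antisymm (le_top hc j) ?_⟩
      rw [mp_apply, zero_add]
      rcases Finset.mem_insert.1 hj with rfl | hj
      · exact h' ▸ le_max_right _ _
      · exact h j hj ▸ le_max_left _ _
  obtain ⟨a, ha, h⟩ := A.isCompact.inter_iInter_nonempty (fun j : ℕ => {x : Sq | x j = top A j})
    (fun j => isClosed_eq (continuous_apply j) continuous_const) fun u => by
      obtain ⟨a, ha, h⟩ := h2 u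
      exact ⟨a, ha, mem_iInter₂.2 h⟩
  have : a = top A := funext fun j => mem_iInter.1 h j
  exact this ▸ ha

lemma dist_top_le (A B : Mpcc Sq) : dist (top A) (top B) ≤ dist A B := by
  have key (A B : Mpcc Sq) (j : ℕ) (h : top B j ≤ top A j) :
      min (weight j) |top A j - top B j| ≤ dist A B := by
    obtain ⟨b, hb, hd⟩ := A.exists_dist_le B (top_mem A)
    refine le_trans (min_le_min_left _ ?_) ((min_le_dist _ _ j).trans hd)
    rw [abs_of_nonneg (by linarith)]
    exact le_trans (by linarith [le_top hb j]) (le_abs_self _)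
  refine dist_le fun j => ?_
  rcases le_total (top B j) (top A j) with h | h
  · exact key A B j h
  · rw [abs_sub_comm, dist_comm]
    exact key B A j h

lemma continuous_top : Continuous top :=
  (LipschitzWith.of_dist_le_mul (K := 1) fun A B => by
    rw [NNReal.coe_one, one_mul]
    exact dist_top_le A B).continuous

lemma top_eq {A : Mpcc Sq} {x : Sq} (hx : x ∈ A) (h : ∀ a ∈ A, ∀ j, a j ≤ x j) : top A = x :=
  funext fun j => le_antisymm (h _ (top_mem A) j) (le_top hx j)

/-- Translate `a` by `x - τ`, after raising it to level `log s` below `x`. -/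
noncomputable def gate (τ x : Sq) (s : ℝ) (a : Sq) : Sq :=
  fun j => x j + Real.log (max (Real.exp (a j - τ j)) s)

lemma continuous_gate {T : Type*} [TopologicalSpace T] (τ : Sq) {x : T → Sq} {s : T → ℝ}
    {a : T → Sq} (hx : Continuous x) (hs : Continuous s) (ha : Continuous a) :
    Continuous fun t => gate τ (x t) (s t) (a t) := by
  refine continuous_mk fun j => ?_
  have h1 := (continuous_apply j).comp hx
  have h2 := (continuous_apply j).comp ha
  refine h1.add (Continuous.log ?_ fun t => (lt_max_of_lt_left (Real.exp_pos _)).ne')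
  exact (Real.continuous_exp.comp (h2.sub continuous_const)).max hs

lemma gate_one {τ a : Sq} (h : ∀ j, a j ≤ τ j) (x : Sq) : gate τ x 1 a = x := by
  funext j
  have : Real.exp (a j - τ j) ≤ 1 := Real.exp_le_one_iff.2 (by linarith [h j])
  simp [gate, max_eq_right this]

lemma gate_le {τ a : Sq} (h : ∀ j, a j ≤ τ j) (x : Sq) {s : ℝ} (hs : s ≤ 1) (j : ℕ) :
    gate τ x s a j ≤ x j := by
  have h1 : max (Real.exp (a j - τ j)) s ≤ 1 :=
    max_le (Real.exp_le_one_iff.2 (by linarith [h j])) hs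
  have h2 := Real.log_nonpos (le_max_of_le_left (Real.exp_pos _).le) h1
  unfold gate
  linarith

lemma gate_zero (τ x a : Sq) (j : ℕ) : gate τ x 0 a j = x j + (a j - τ j) := by
  rw [gate, max_eq_left (Real.exp_pos _).le, Real.log_exp]

lemma dist_le_of_sub_eq {a b x y : Sq} (h : ∀ j, a j - b j = x j - y j) : dist a b ≤ dist x y :=
  dist_le fun j => h j ▸ min_le_dist x y j

lemma dist_gate_zero_le (τ x a : Sq) : dist (gate τ x 0 a) a ≤ dist x τ :=
  dist_le_of_sub_eq fun j => by rw [gate_zero]; ring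

lemma exists_dist_gate_le (A : Mpcc Sq) (x : Sq) {s : ℝ} (h0 : 0 ≤ s) (h1 : s ≤ 1) {a : Sq}
    (ha : a ∈ A) : ∃ c ∈ A, dist (gate (top A) x s a) c ≤ dist x (top A) := by
  rcases h0.eq_or_lt with rfl | h0
  · exact ⟨a, ha, dist_gate_zero_le _ _ _⟩
  · refine ⟨mp (Real.log s) a (top A), A.mp_mem ha (top_mem A) (Real.log_nonpos h0.le h1),
      dist_le_of_sub_eq fun j => ?_⟩
    have h2 : Real.log (max (Real.exp (a j - top A j)) s) = max (a j - top A j) (Real.log s) := by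
      rcases le_total (a j - top A j) (Real.log s) with h | h
      · rw [max_eq_right h, max_eq_right ((Real.le_log_iff_exp_le h0).1 h)]
      · rw [max_eq_left h, max_eq_left ((Real.log_le_iff_le_exp h0).1 h), Real.log_exp]
    rw [gate, h2, mp_apply, ← sub_eq_zero]
    have h3 : max (a j) (Real.log s + top A j) = max (a j - top A j) (Real.log s) + top A j := by
      rw [← max_add_add_right, sub_add_cancel]
    rw [h3]
    ring

/-- The infimum of `m` over a set. -/
noncomputable def depth (m : Sq → ℝ) (A : Mpcc Sq) : ℝ := sInf (m '' A)

lemma depth_le {m : Sq → ℝ} (hm : LipschitzWith 1 m) {A : Mpcc Sq} {a : Sq} (ha : a ∈ A) :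
    depth m A ≤ m a :=
  csInf_le (A.isCompact.image hm.continuous).bddBelow ⟨a, ha, rfl⟩

lemma exists_depth_eq {m : Sq → ℝ} (hm : LipschitzWith 1 m) (A : Mpcc Sq) :
    ∃ a ∈ A, depth m A = m a :=
  A.isCompact.exists_sInf_image_eq A.nonempty hm.continuous.continuousOn

lemma lipschitz_depth {m : Sq → ℝ} (hm : LipschitzWith 1 m) : LipschitzWith 1 (depth m) := by
  refine LipschitzWith.of_le_add fun A B => ?_
  obtain ⟨b, hb, h⟩ := exists_depth_eq hm B
  obtain ⟨a, ha, hd⟩ := B.exists_dist_le A hb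
  rw [dist_comm B A] at hd
  have := Collar.le_add_dist hm a b
  rw [dist_comm] at this
  linarith [depth_le hm ha]

lemma depth_pos_iff {m : Sq → ℝ} (hm : LipschitzWith 1 m) (A : Mpcc Sq) :
    0 < depth m A ↔ ∀ a ∈ A, 0 < m a := by
  refine ⟨fun h a ha => h.trans_le (depth_le hm ha), fun h => ?_⟩
  obtain ⟨a, ha, he⟩ := exists_depth_eq hm A
  exact he ▸ h a ha

end Sq

/-! ### The base step -/

section Base

variable {m : Sq → ℝ} {hm : LipschitzWith 1 m}

/-- Truncation to the unit interval. -/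
noncomputable def clamp (t : ℝ) : ℝ := max 0 (min 1 t)

lemma continuous_clamp : Continuous clamp := by unfold clamp; fun_prop

lemma clamp_nonneg (t : ℝ) : 0 ≤ clamp t := le_max_left _ _

lemma clamp_le_one (t : ℝ) : clamp t ≤ 1 := max_le zero_le_one (min_le_left _ _)

lemma clamp_eq_zero {t : ℝ} (h : t ≤ 0) : clamp t = 0 :=
  max_eq_left ((min_le_right _ _).trans h)

lemma lt_one_of_clamp_lt {t : ℝ} (h : clamp t < 1) : t < 1 := by
  by_contra! h'
  rw [clamp, min_eq_left h', max_eq_right zero_le_one] at h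
  exact lt_irrefl _ h

/-- The hyperspace of convex sets inside the positivity set of `m`. -/
abbrev DeepMpcc (hm : LipschitzWith 1 m) : Type := Collar (Sq.lipschitz_depth hm)

variable {O : Type} [MetricSpace O] (b : O → {x : Sq // 0 < m x}) (δ : O → ℝ)
  (f : BumpCovering (DeepMpcc hm) O)

/-- The level at which the set `α` enters over the point `z`. -/
noncomputable def gateLevel (α : DeepMpcc hm) (z : O) : ℝ :=
  max (1 - f α z) (max (clamp (1024 * δ z - 1))
    (clamp (1024 * dist (b z).1 (Sq.top α.1) / Sq.depth m α.1 - 1)))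

lemma gateLevel_nonneg (α : DeepMpcc hm) (z : O) : 0 ≤ gateLevel b δ f α z :=
  le_max_of_le_right (le_max_of_le_left (clamp_nonneg _))

lemma gateLevel_le_one (α : DeepMpcc hm) (z : O) : gateLevel b δ f α z ≤ 1 :=
  max_le (by linarith [f.nonneg α z]) (max_le (clamp_le_one _) (clamp_le_one _))

lemma continuous_gateLevel {b : O → {x : Sq // 0 < m x}} (hb : Continuous b) {δ : O → ℝ}
    (hδ : Continuous δ) (α : DeepMpcc hm) : Continuous (gateLevel b δ f α) := by
  have h1 : Continuous fun z => (b z).1 := continuous_subtype_val.comp hb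
  refine (continuous_const.sub (f α).continuous).max
    ((continuous_clamp.comp (by fun_prop)).max (continuous_clamp.comp ?_))
  exact ((continuous_const.mul (h1.dist continuous_const)).div_const _).sub continuous_const

lemma gateLevel_eq_one {α : DeepMpcc hm} {z : O} (h : f α z = 0) : gateLevel b δ f α z = 1 :=
  le_antisymm (gateLevel_le_one b δ f α z) (le_max_of_le_left (by rw [h, sub_zero]))

/-- The sets `α` moved over the point `b z` and raised to their levels. -/
def gatedUnion (z : O) : NonemptyCompacts Sq :=
  ⟨⟨{(b z).1} ∪ ⋃ α ∈ Function.support fun α => f α z,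
      Sq.gate (Sq.top α.1) (b z).1 (gateLevel b δ f α z) '' (α.1 : Set Sq), by
    refine isCompact_singleton.union ((f.locallyFinite.point_finite z).isCompact_biUnion
      fun α _ => α.1.isCompact.image ?_)
    exact Sq.continuous_gate _ continuous_const continuous_const continuous_id⟩,
    ⟨(b z).1, Or.inl rfl⟩⟩

lemma mem_gatedUnion {z : O} {y : Sq} : y ∈ gatedUnion b δ f z ↔ y = (b z).1 ∨
    ∃ α, f α z ≠ 0 ∧ ∃ a ∈ α.1, Sq.gate (Sq.top α.1) (b z).1 (gateLevel b δ f α z) a = y := by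
  change y ∈ {(b z).1} ∪ (⋃ α ∈ Function.support fun α => f α z,
      Sq.gate (Sq.top α.1) (b z).1 (gateLevel b δ f α z) '' (α.1 : Set Sq)) ↔ _
  simp only [mem_union, mem_singleton_iff, mem_iUnion, mem_image, Function.mem_support,
    exists_prop, SetLike.mem_coe]

lemma continuous_gatedUnion {b : O → {x : Sq // 0 < m x}} (hb : Continuous b) {δ : O → ℝ}
    (hδ : Continuous δ) : Continuous (gatedUnion b δ f) := by
  have hb1 : Continuous fun z => (b z).1 := continuous_subtype_val.comp hb
  have key (I : Finset (DeepMpcc hm)) : ∃ L : O → NonemptyCompacts Sq, Continuous L ∧ ∀ z y,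
      y ∈ L z ↔ y = (b z).1 ∨ ∃ α ∈ I, ∃ a ∈ α.1,
        Sq.gate (Sq.top α.1) (b z).1 (gateLevel b δ f α z) a = y := by
    classical
    induction I using Finset.induction with
    | empty =>
      refine ⟨fun z => {(b z).1}, ?_, fun z y => ?_⟩
      · exact NonemptyCompacts.isEmbedding_singleton.continuous.comp hb1
      · simp
    | insert β I _ ih =>
      obtain ⟨L, hL, h⟩ := ih
      have hg (z : O) : Continuous (Sq.gate (Sq.top β.1) (b z).1 (gateLevel b δ f β z)) :=
        Sq.continuous_gate _ continuous_const continuous_const continuous_id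
      refine ⟨fun z => L z ⊔ β.1.1.map _ (hg z), hL.sup ?_, fun z y => ?_⟩
      · refine Continuous.nonemptyCompacts_map' (g := fun (z : O) (a : Sq) =>
          Sq.gate (Sq.top β.1) (b z).1 (gateLevel b δ f β z) a) continuous_const ?_
        exact Sq.continuous_gate _ (hb1.comp continuous_fst)
          ((continuous_gateLevel f hb hδ β).comp continuous_fst) continuous_snd
      · have : y ∈ L z ⊔ β.1.1.map _ (hg z) ↔ y ∈ L z ∨
            ∃ a ∈ β.1, Sq.gate (Sq.top β.1) (b z).1 (gateLevel b δ f β z) a = y := Iff.rfl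
        rw [this, h]
        rw [Finset.exists_mem_insert, or_assoc]
        exact or_congr_right or_comm
  refine continuous_iff_continuousAt.2 fun z₀ => ?_
  obtain ⟨t, ht, hfin⟩ := f.locallyFinite z₀
  obtain ⟨L, hL, h⟩ := key hfin.toFinset
  refine hL.continuousAt.congr (mem_of_superset ht fun z hz => ?_)
  refine SetLike.ext fun y => ?_
  rw [h, mem_gatedUnion]
  refine or_congr_right' fun hy => ⟨?_, ?_⟩
  · rintro ⟨α, -, a, ha, rfl⟩
    refine ⟨α, fun h0 => hy ?_, a, ha, rfl⟩
    rw [gateLevel_eq_one b δ f h0, Sq.gate_one fun j => Sq.le_top ha j]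
  · rintro ⟨α, h0, a, ha, rfl⟩
    exact ⟨α, hfin.mem_toFinset.2 ⟨z, h0, hz⟩, a, ha, rfl⟩

lemma top_hull_gatedUnion (z : O) : Sq.top (Mpcc.hull (gatedUnion b δ f z)) = (b z).1 := by
  refine Sq.top_eq (Mpcc.subset_hull _ ((mem_gatedUnion b δ f).2 (Or.inl rfl))) fun a ha => ?_
  refine Mpcc.hull_subset (L := {y : Sq | ∀ j, y j ≤ (b z).1 j}) (fun y hy => ?_) ?_ ?_ ha
  · rcases (mem_gatedUnion b δ f).1 hy with rfl | ⟨α, -, a, ha, rfl⟩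
    · exact fun j => le_rfl
    · exact Sq.gate_le (fun j => Sq.le_top ha j) _ (gateLevel_le_one b δ f α z)
  · simp only [ofPred_forall]
    exact isClosed_iInter fun j => isClosed_le (Sq.continuous_apply j) continuous_const
  · intro a ha c hc t ht j
    rw [Sq.mp_apply]
    exact max_le (ha j) (by linarith [hc j])

/-- Points of the union are close to a convex set close to all active sets. -/
lemma gatedUnion_near {z : O} {e : Mpcc Sq} {r r' : ℝ} (h1 : dist (b z).1 (Sq.top e) ≤ r')
    (h2 : ∀ α, f α z ≠ 0 → dist e α.1 ≤ r) (hr : 0 ≤ r) :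
    ∀ y ∈ gatedUnion b δ f z, ∃ a ∈ e, dist y a ≤ r' + 2 * r := by
  intro y hy
  rcases (mem_gatedUnion b δ f).1 hy with rfl | ⟨α, hα, a, ha, rfl⟩
  · exact ⟨_, Sq.top_mem e, by linarith⟩
  · obtain ⟨c, hc, hd⟩ := Sq.exists_dist_gate_le α.1 (b z).1 (gateLevel_nonneg b δ f α z)
      (gateLevel_le_one b δ f α z) ha
    obtain ⟨d, hd', hcd⟩ := α.1.exists_dist_le e hc
    have h3 := h2 α hα
    rw [dist_comm α.1] at hcd
    refine ⟨d, hd', ?_⟩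
    linarith [dist_triangle (Sq.gate (Sq.top α.1) (b z).1 (gateLevel b δ f α z) a) c d,
      dist_triangle (b z).1 (Sq.top e) (Sq.top α.1), Sq.dist_top_le e α.1]

lemma depth_hull_gatedUnion_pos
    (hact : ∀ z α β, f α z ≠ 0 → f β z ≠ 0 → dist α β ≤ 64 * δ z) (z : O) :
    0 < Sq.depth m (Mpcc.hull (gatedUnion b δ f z)) := by
  rw [Sq.depth_pos_iff hm]
  by_cases h : ∃ α, gateLevel b δ f α z < 1
  · obtain ⟨α, hα⟩ := h
    have hfα : f α z ≠ 0 := fun h0 => hα.ne (gateLevel_eq_one b δ f h0)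
    have hκ := α.2
    have h1 := lt_one_of_clamp_lt
      (((le_max_left _ _).trans (le_max_right _ _)).trans_lt hα)
    have h2 := lt_one_of_clamp_lt
      (((le_max_right _ _).trans (le_max_right _ _)).trans_lt hα)
    have h3 : 1024 * dist (b z).1 (Sq.top α.1) / Sq.depth m α.1 < 2 := by linarith
    rw [div_lt_iff₀ hκ] at h3
    have h4 : ∀ β, f β z ≠ 0 → dist α.1 β.1 ≤ Sq.depth m α.1 / 4 := fun β hβ => by
      have h5 := hact z α β hfα hβ
      have h6 := Collar.dist_val_le (y := α) (y' := β) (by linarith)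
      have h7 : 2 * dist α β * min (Sq.depth m α.1) (Sq.depth m β.1) ≤
          1 / 4 * Sq.depth m α.1 :=
        mul_le_mul (by linarith) (min_le_left _ _) (Collar.min_pos α β).le (by norm_num)
      linarith
    intro y hy
    obtain ⟨a, ha, hd⟩ := Mpcc.hull_subset (gatedUnion_near b δ f (e := α.1)
      (r' := Sq.depth m α.1 / 512) (by linarith) h4 (by positivity)) (Mpcc.isClosed_near _ _)
      (Mpcc.mpConvex_near _ _) hy
    have h8 := Collar.le_add_dist hm a y
    rw [dist_comm] at h8
    have hκ : 0 < Sq.depth m α.1 := hκ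
    linarith [Sq.depth_le hm ha]
  · push Not at h
    intro y hy
    have : y ∈ ({(b z).1} : Set Sq) := by
      refine Mpcc.hull_subset (fun y hy => ?_) isClosed_singleton ?_ hy
      · rcases (mem_gatedUnion b δ f).1 hy with rfl | ⟨α, -, a, ha, rfl⟩
        · rfl
        · rw [(gateLevel_le_one b δ f α z).antisymm (h α), Sq.gate_one fun j => Sq.le_top ha j]
          rfl
      · rintro _ rfl _ rfl t ht
        exact MaxPlusMetric.mp_self t _ ht
    rw [mem_singleton_iff.1 this]
    exact (b z).2

lemma dist_hull_gatedUnion_le {z : O} {e : DeepMpcc hm} {r : ℝ} (hr0 : 0 ≤ r) (hr : r ≤ 1 / 4096)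
    (hδ : δ z ≤ 1 / 1024) (h1 : dist (b z).1 (Sq.top e.1) ≤ r * Sq.depth m e.1)
    (h2 : ∀ α, f α z ≠ 0 → dist e.1 α.1 ≤ r * Sq.depth m e.1) :
    dist (Mpcc.hull (gatedUnion b δ f z)) e.1 ≤ 3 * r * Sq.depth m e.1 := by
  have hκ : 0 < Sq.depth m e.1 := e.2
  have hrκ : 0 ≤ r * Sq.depth m e.1 := mul_nonneg hr0 hκ.le
  refine Mpcc.dist_hull_le (by linarith) (fun y hy => ?_) fun a ha => ?_
  · obtain ⟨c, hc, hd⟩ := gatedUnion_near b δ f h1 h2 hrκ y hy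
    exact ⟨c, hc, by linarith⟩
  · have hf1 : f (f.ind z (mem_univ z)) z = 1 := f.ind_apply z (mem_univ z)
    set α := f.ind z (mem_univ z)
    have hα : f α z ≠ 0 := by rw [hf1]; exact one_ne_zero
    have h3 := h2 α hα
    have hx : dist (b z).1 (Sq.top α.1) ≤ 2 * (r * Sq.depth m e.1) := by
      linarith [dist_triangle (b z).1 (Sq.top e.1) (Sq.top α.1), Sq.dist_top_le e.1 α.1]
    have h4 := Collar.le_add_dist (Sq.lipschitz_depth hm) e.1 α.1
    have h5 : r * Sq.depth m e.1 ≤ 1 / 4096 * Sq.depth m e.1 :=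
      mul_le_mul_of_nonneg_right hr hκ.le
    have hκα : 0 < Sq.depth m α.1 := α.2
    have hlev : gateLevel b δ f α z = 0 := by
      rw [gateLevel, hf1, sub_self, clamp_eq_zero (by linarith), clamp_eq_zero, max_self, max_self]
      rw [sub_nonpos, div_le_one hκα]
      linarith
    obtain ⟨c, hc, hd⟩ := e.1.exists_dist_le α.1 ha
    refine ⟨_, (mem_gatedUnion b δ f).2 (Or.inr ⟨α, hα, c, hc, rfl⟩), ?_⟩
    rw [hlev, dist_comm]
    have h6 := Sq.dist_gate_zero_le (Sq.top α.1) (b z).1 c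
    have h7 := dist_triangle_right (Sq.gate (Sq.top α.1) (b z).1 0 c) a c
    linarith

lemma Collar.dist_le_of_dist_val_le {Y : Type*} [MetricSpace Y] {κ : Y → ℝ}
    {hκ : LipschitzWith 1 κ} {y e : Collar hκ} {r : ℝ} (hr : r ≤ 1 / 2)
    (h : dist y.1 e.1 ≤ r * κ e.1) : dist y e ≤ 2 * r := by
  have he : 0 < κ e.1 := e.2
  refine (Collar.dist_le_div y e).trans ?_
  rw [div_le_iff₀ (Collar.min_pos y e)]
  have h1 := Collar.le_add_dist hκ e.1 y.1
  rw [dist_comm] at h1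
  have h0 : 0 ≤ r := nonneg_of_mul_nonneg_left (dist_nonneg.trans h) he
  have h2 : κ e.1 / 2 ≤ min (κ y.1) (κ e.1) := le_min (by nlinarith) (by linarith)
  nlinarith

end Base

/-- The base step: sets inside an open set, against the open set. -/
theorem mpcc_open_factor {m : Sq → ℝ} (hm : LipschitzWith 1 m) (hne : ∃ x, 0 < m x) :
    Nonempty ({A : Mpcc Sq // ∀ a ∈ A, 0 < m a} × (ℕ → ℝ) ≃ₜ {x : Sq // 0 < m x} × (ℕ → ℝ)) := by
  let p : DeepMpcc hm → {x : Sq // 0 < m x} := fun A =>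
    ⟨Sq.top A.1, A.2.trans_le (Sq.depth_le hm (Sq.top_mem A.1))⟩
  have hp : Continuous p := (Sq.continuous_top.comp Collar.continuous_val).subtype_mk _
  have : Nonempty (DeepMpcc hm) := by
    obtain ⟨x, hx⟩ := hne
    refine ⟨⟨⟨{x}, ?_⟩, (Sq.depth_pos_iff hm _).2 ?_⟩⟩
    · rintro _ rfl _ rfl t ht
      exact MaxPlusMetric.mp_self t _ ht
    · intro a ha
      rwa [show a = x from ha]
  have hfac := factor_of_local hp (C := 393216) (by norm_num) (fun O _ b δ f hb hδ hδ0 _ hact => by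
    refine ⟨fun z => ⟨Mpcc.hull (gatedUnion b δ f z), depth_hull_gatedUnion_pos b δ f hact z⟩,
      ?_, fun z => Subtype.ext (top_hull_gatedUnion b δ f z), fun z e D hD hbz he => ?_,
      fun e => ?_⟩
    · exact Continuous.subtype_mk (Mpcc.lipschitz_hull.continuous.comp
        (continuous_gatedUnion f hb hδ)) _
    · have hδz := hδ0 z
      rcases le_total D (1 / 393216) with h | h
      · have h1 := dist_hull_gatedUnion_le b δ f (r := 96 * D) (z := z) (e := e) (by linarith)
          (by linarith) (by linarith) (by
            rw [hbz, dist_self]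
            exact mul_nonneg (by linarith) e.2.le) fun α hα => by
              have h2 := he α hα
              refine (Collar.dist_val_le (by linarith)).trans ?_
              exact mul_le_mul (by linarith) (min_le_left _ _) (Collar.min_pos e α).le
                (by linarith)
        refine (Collar.dist_le_of_dist_val_le (by linarith) h1).trans (by linarith)
      · exact (Collar.dist_le_one _ _).trans (by linarith)
    · have hκ : 0 < Sq.depth m e.1 := e.2
      obtain ⟨R, hR⟩ : ∃ R, R = 96 + 1 / Sq.depth m e.1 := ⟨_, rfl⟩
      have hκ' : 0 < 1 / Sq.depth m e.1 := by positivity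
      have hR0 : 0 < R := by linarith
      refine ⟨6 * R, 1 / (4096 * R), by positivity, fun z D hD hDη hbz he => ?_⟩
      have hδz := hδ0 z
      rw [lt_div_iff₀ (by positivity)] at hDη
      have h0 : 0 ≤ D * (1 / Sq.depth m e.1) := mul_nonneg (by linarith) hκ'.le
      have hDR : D * R = 96 * D + D * (1 / Sq.depth m e.1) := by rw [hR]; ring
      have h1 := dist_hull_gatedUnion_le b δ f (r := D * R) (z := z) (e := e) (by linarith)
          (by linarith) (by linarith) (by
            refine hbz.trans ?_
            have h3 : D * (1 / Sq.depth m e.1) * Sq.depth m e.1 = D := by field_simp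
            rw [hDR, add_mul, h3]
            have := mul_nonneg (by linarith : 0 ≤ 96 * D) hκ.le
            linarith) fun α hα => by
              have h2 := he α hα
              refine (Collar.dist_val_le (by linarith)).trans ?_
              exact mul_le_mul (by linarith) (min_le_left _ _) (Collar.min_pos e α).le
                (by linarith)
      refine (Collar.dist_le_of_dist_val_le (by linarith) h1).trans (by linarith))
  obtain ⟨h, -⟩ := hfac
  refine ⟨Homeomorph.trans (Homeomorph.prodCongr ?_ (Homeomorph.refl _)) h⟩
  exact Homeomorph.subtype (Homeomorph.refl _) fun A => (Sq.depth_pos_iff hm A).symm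

/-! ### Reindexing convex sets -/

namespace Mpcc

/-- The image under a homeomorphism commuting with the max-plus operations. -/
def mapHomeomorph {X Y : Type*} [TopologicalSpace X] [MaxPlus X] [TopologicalSpace Y] [MaxPlus Y]
    (e : X ≃ₜ Y) (h : ∀ t a b, e (mp t a b) = mp t (e a) (e b)) : Mpcc X ≃ₜ Mpcc Y where
  toFun := map e e.continuous h
  invFun := map e.symm e.symm.continuous fun t a b => by
    rw [e.symm_apply_eq, h, e.apply_symm_apply, e.apply_symm_apply]
  left_inv A := SetLike.coe_injective (by simp [coe_map, image_image])
  right_inv A := SetLike.coe_injective (by simp [coe_map, image_image])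
  continuous_toFun := continuous_map _ _ _
  continuous_invFun := continuous_map _ _ _

variable {κ κ' κ'' : Type*}

/-- Reindexing of coordinates. -/
def comp (c : κ' → κ) (A : Mpcc (κ → ℝ)) : Mpcc (κ' → ℝ) :=
  map (fun x i => x (c i)) (by fun_prop) (fun _ _ _ => rfl) A

lemma mem_comp {c : κ' → κ} {A : Mpcc (κ → ℝ)} {y : κ' → ℝ} :
    y ∈ comp c A ↔ ∃ x ∈ A, x ∘ c = y := Iff.rfl

lemma comp_mem_comp (c : κ' → κ) {A : Mpcc (κ → ℝ)} {x : κ → ℝ} (hx : x ∈ A) :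
    x ∘ c ∈ comp c A := ⟨x, hx, rfl⟩

lemma continuous_comp (c : κ' → κ) : Continuous (comp c) :=
  continuous_map (fun (x : κ → ℝ) i => x (c i)) (by fun_prop) fun _ _ _ => rfl

lemma comp_comp (c : κ' → κ) (d : κ'' → κ') (A : Mpcc (κ → ℝ)) :
    comp d (comp c A) = comp (c ∘ d) A :=
  SetLike.coe_injective (image_image _ _ _)

lemma comp_id (A : Mpcc (κ → ℝ)) : comp id A = A := SetLike.coe_injective (image_id _)

/-- A compact subset of an open set of a product is separated by finitely many coordinates. -/
lemma _root_.IsCompact.exists_finset_restrict {K U : Set (κ → ℝ)} (hK : IsCompact K)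
    (hU : IsOpen U) (hKU : K ⊆ U) : ∃ (F : Finset κ) (V : Set (F → ℝ)), IsOpen V ∧
      K ⊆ F.restrict ⁻¹' V ∧ F.restrict ⁻¹' V ⊆ U := by
  classical
  have hcyl (F G : Finset κ) (hFG : F ⊆ G) (V : Set (F → ℝ)) (hV : IsOpen V) :
      ∃ V' : Set (G → ℝ), IsOpen V' ∧ (G.restrict ⁻¹' V' : Set (κ → ℝ)) = F.restrict ⁻¹' V :=
    ⟨(fun (x : G → ℝ) (i : F) => x ⟨i, hFG i.2⟩) ⁻¹' V,
      hV.preimage (continuous_pi fun i => continuous_apply _), rfl⟩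
  refine hK.induction_on (p := fun K => ∃ (F : Finset κ) (V : Set (F → ℝ)), IsOpen V ∧
      K ⊆ F.restrict ⁻¹' V ∧ F.restrict ⁻¹' V ⊆ U) ?_ ?_ ?_ ?_
  · exact ⟨∅, ∅, isOpen_empty, empty_subset _, empty_subset _⟩
  · rintro s t hst ⟨F, V, hV, h1, h2⟩
    exact ⟨F, V, hV, hst.trans h1, h2⟩
  · rintro s t ⟨F, V, hV, h1, h2⟩ ⟨F', V', hV', h1', h2'⟩
    obtain ⟨W, hW, hWe⟩ := hcyl F (F ∪ F') Finset.subset_union_left V hV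
    obtain ⟨W', hW', hWe'⟩ := hcyl F' (F ∪ F') Finset.subset_union_right V' hV'
    refine ⟨F ∪ F', W ∪ W', hW.union hW', ?_, ?_⟩
    · rw [preimage_union, hWe, hWe']
      exact union_subset_union h1 h1'
    · rw [preimage_union, hWe, hWe']
      exact union_subset h2 h2'
  · intro x hx
    obtain ⟨F, u, hu, hsub⟩ := isOpen_pi_iff.1 hU x (hKU hx)
    have hV : IsOpen (univ.pi fun i : F => u i) :=
      isOpen_set_pi finite_univ fun i _ => (hu i i.2).1
    have hxV : F.restrict x ∈ univ.pi fun i : F => u i := fun i _ => (hu i i.2).2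
    refine ⟨F.restrict ⁻¹' univ.pi fun i : F => u i, mem_nhdsWithin_of_mem_nhds
      ((hV.preimage (by fun_prop)).mem_nhds hxV), F, _, hV, Subset.rfl, ?_⟩
    exact fun y hy => hsub fun i hi => hy ⟨i, hi⟩ (mem_univ _)

lemma ext_finset {A A' : Mpcc (κ → ℝ)}
    (h : ∀ F : Finset κ, comp (Subtype.val : F → κ) A = comp Subtype.val A') : A = A' := by
  have key (A A' : Mpcc (κ → ℝ))
      (h : ∀ F : Finset κ, comp (Subtype.val : F → κ) A = comp Subtype.val A') :
      (A : Set (κ → ℝ)) ⊆ A' := by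
    intro x hx
    by_contra hx'
    obtain ⟨F, V, -, h1, h2⟩ := (isCompact_singleton (x := x)).exists_finset_restrict
      A'.isCompact.isClosed.isOpen_compl (singleton_subset_iff.2 hx')
    have h3 := comp_mem_comp (Subtype.val : F → κ) hx
    rw [h F] at h3
    obtain ⟨y, hy, hxy⟩ := mem_comp.1 h3
    refine h2 (?_ : y ∈ _) hy
    change y ∘ (Subtype.val : F → κ) ∈ V
    rw [hxy]
    exact h1 rfl
  exact SetLike.coe_injective ((key A A' h).antisymm (key A' A fun F => (h F).symm))

lemma eq_generateFrom (X : Type*) [TopologicalSpace X] [MaxPlus X] :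
    (inferInstance : TopologicalSpace (Mpcc X)) = generateFrom {S | ∃ U : Set X, IsOpen U ∧
      (S = {K : Mpcc X | (K : Set X) ⊆ U} ∨ S = {K : Mpcc X | ((K : Set X) ∩ U).Nonempty})} := by
  have h : (inferInstance : TopologicalSpace (Mpcc X)) =
      (TopologicalSpace.vietoris X).induced ((↑) : Mpcc X → Set X) := by
    change TopologicalSpace.induced _ _ = _
    let := TopologicalSpace.vietoris X
    rw [NonemptyCompacts.isEmbedding_coe.eq_induced, induced_compose]
    rfl
  rw [h, TopologicalSpace.vietoris, induced_generateFrom_eq]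
  congr 1
  ext S
  constructor
  · rintro ⟨_, ⟨U, hU, rfl⟩ | ⟨U, hU, rfl⟩, rfl⟩
    · exact ⟨U, hU, Or.inl rfl⟩
    · exact ⟨U, hU, Or.inr rfl⟩
  · rintro ⟨U, hU, rfl | rfl⟩
    · exact ⟨_, Or.inl ⟨U, hU, rfl⟩, rfl⟩
    · exact ⟨_, Or.inr ⟨U, hU, rfl⟩, rfl⟩

lemma isOpen_subset {X : Type*} [TopologicalSpace X] [MaxPlus X] {U : Set X} (hU : IsOpen U) :
    IsOpen {K : Mpcc X | (K : Set X) ⊆ U} := by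
  change IsOpen[(inferInstance : TopologicalSpace (Mpcc X))] _
  rw [eq_generateFrom]
  exact isOpen_generateFrom_of_mem ⟨U, hU, Or.inl rfl⟩

lemma isOpen_inter_nonempty {X : Type*} [TopologicalSpace X] [MaxPlus X] {U : Set X}
    (hU : IsOpen U) : IsOpen {K : Mpcc X | ((K : Set X) ∩ U).Nonempty} := by
  change IsOpen[(inferInstance : TopologicalSpace (Mpcc X))] _
  rw [eq_generateFrom]
  exact isOpen_generateFrom_of_mem ⟨U, hU, Or.inr rfl⟩

lemma continuous_of_finset {T : Type*} [TopologicalSpace T] {φ : T → Mpcc (κ → ℝ)}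
    (h : ∀ F : Finset κ, Continuous fun t => comp (Subtype.val : F → κ) (φ t)) :
    Continuous φ := by
  change Continuous[_, (inferInstance : TopologicalSpace (Mpcc (κ → ℝ)))] φ
  rw [eq_generateFrom, continuous_generateFrom_iff]
  rintro _ ⟨U, hU, rfl | rfl⟩
  · refine isOpen_iff_mem_nhds.2 fun t ht => ?_
    obtain ⟨F, V, hV, h1, h2⟩ := (φ t).isCompact.exists_finset_restrict hU ht
    filter_upwards [((isOpen_subset hV).preimage (h F)).mem_nhds
      (show t ∈ _ by rintro _ ⟨x, hx, rfl⟩; exact h1 hx)] with s hs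
    exact fun x hx => h2 (hs ⟨x, hx, rfl⟩)
  · refine isOpen_iff_mem_nhds.2 ?_
    rintro t ⟨x, hx, hxU⟩
    obtain ⟨F, V, hV, h1, h2⟩ := (isCompact_singleton (x := x)).exists_finset_restrict hU
      (singleton_subset_iff.2 hxU)
    filter_upwards [((isOpen_inter_nonempty hV).preimage (h F)).mem_nhds
      (show t ∈ _ from ⟨_, ⟨x, hx, rfl⟩, h1 rfl⟩)] with s hs
    obtain ⟨_, ⟨y, hy, rfl⟩, hyV⟩ := hs
    exact ⟨y, hy, h2 hyV⟩

end Mpcc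

/-! ### Transfinite towers -/

namespace Tower

variable {N : Type*} [LinearOrder N] [∀ k : N, Countable (Iio k)]

/-- An enumeration of the coordinates preceding `k`. -/
noncomputable def pre (k : N) (m : ℕ) : ℕ ⊕ N :=
  Sum.map id Subtype.val
    (Classical.choice (nonempty_equiv_of_countable : Nonempty (ℕ ≃ ℕ ⊕ Iio k)) m)

/-- An enumeration of the coordinates up to `k`. -/
noncomputable def upto (k : N) (o : Option ℕ) : ℕ ⊕ N := o.elim (Sum.inr k) (pre k)

lemma pre_injective (k : N) : Function.Injective (pre k) :=
  (Function.injective_id.sumMap Subtype.val_injective).comp (Equiv.injective _)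

lemma exists_pre_eq_inl (k : N) (n : ℕ) : ∃ m, pre k m = Sum.inl n :=
  ⟨(Classical.choice (nonempty_equiv_of_countable : Nonempty (ℕ ≃ ℕ ⊕ Iio k))).symm (Sum.inl n),
    by simp [pre]⟩

lemma exists_pre_eq_inr {j k : N} (h : j < k) : ∃ m, pre k m = Sum.inr j :=
  ⟨(Classical.choice (nonempty_equiv_of_countable : Nonempty (ℕ ≃ ℕ ⊕ Iio k))).symm
    (Sum.inr ⟨j, h⟩), by simp [pre]⟩

lemma lt_of_pre_eq_inr {j k : N} {m : ℕ} (h : pre k m = Sum.inr j) : j < k := by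
  rw [pre] at h
  rcases hn : Classical.choice (nonempty_equiv_of_countable : Nonempty (ℕ ≃ ℕ ⊕ Iio k)) m with n | i
  · simp [hn] at h
  · rw [hn] at h
    exact Sum.inr_injective h ▸ i.2

lemma upto_injective (k : N) : Function.Injective (upto k) := by
  rintro (_ | m) (_ | n) h
  · rfl
  · exact absurd (lt_of_pre_eq_inr (Eq.symm h)) (lt_irrefl _)
  · exact absurd (lt_of_pre_eq_inr h) (lt_irrefl _)
  · exact congrArg some (pre_injective k h)

lemma exists_upto_eq_inl (k : N) (n : ℕ) : ∃ m, upto k m = Sum.inl n :=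
  let ⟨m, hm⟩ := exists_pre_eq_inl k n
  ⟨some m, hm⟩

lemma exists_upto_eq_inr {j k : N} (h : j ≤ k) : ∃ m, upto k m = Sum.inr j := by
  obtain rfl | h := h.eq_or_lt
  · exact ⟨none, rfl⟩
  · obtain ⟨m, hm⟩ := exists_pre_eq_inr h
    exact ⟨some m, hm⟩

lemma le_of_upto_eq_inr {j k : N} {o : Option ℕ} (h : upto k o = Sum.inr j) : j ≤ k := by
  obtain _ | m := o
  · exact (Sum.inr_injective h).ge
  · exact (lt_of_pre_eq_inr h).le

lemma upto_comp_some (k : N) : upto k ∘ some = pre k := rfl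

lemma exists_factor {F : Type*} [Finite F] (d : F → ℕ ⊕ N) {J : Set N}
    (h : ∀ i j, d i = Sum.inr j → j ∈ J) :
    (∃ d' : F → ℕ, d = Sum.inl ∘ d') ∨ ∃ j ∈ J, ∃ d' : F → Option ℕ, d = upto j ∘ d' := by
  have hfin : {j | ∃ i, d i = Sum.inr j}.Finite := by
    refine ((finite_range d).preimage (f := Sum.inr) Sum.inr_injective.injOn).subset ?_
    rintro j ⟨i, hi⟩
    exact ⟨i, hi⟩
  obtain he | hne := {j | ∃ i, d i = Sum.inr j}.eq_empty_or_nonempty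
  · left
    have (i : F) : ∃ n, d i = Sum.inl n := by
      rcases hd : d i with n | j
      · exact ⟨n, rfl⟩
      · exact absurd (show j ∈ {j | ∃ i, d i = Sum.inr j} from ⟨i, hd⟩) (he ▸ notMem_empty j)
    choose d' hd' using this
    exact ⟨d', funext hd'⟩
  · right
    obtain ⟨j, ⟨i, hi⟩, hmax⟩ := hfin.exists_maximalFor id _ hne
    refine ⟨j, h i j hi, ?_⟩
    have (a : F) : ∃ n, d a = upto j n := by
      rcases hd : d a with n | l
      · obtain ⟨m, hm⟩ := exists_upto_eq_inl j n
        exact ⟨m, hm.symm⟩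
      · have hl : l ≤ j := by
          by_contra hlt
          exact hlt (hmax (show l ∈ {j | ∃ i, d i = Sum.inr j} from ⟨a, hd⟩) (le_of_not_ge hlt))
        obtain ⟨m, hm⟩ := exists_upto_eq_inr hl
        exact ⟨m, hm.symm⟩
    choose d' hd' using this
    exact ⟨d', funext hd'⟩

open Mpcc

variable {κ : Type*} {J : Set N}

lemma comp_congr {A A' : Mpcc (ℕ ⊕ N → ℝ)} (hb : comp Sum.inl A = comp Sum.inl A')
    (hJ : ∀ j ∈ J, comp (upto j) A = comp (upto j) A') (c : κ → ℕ ⊕ N)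
    (hc : ∀ i j, c i = Sum.inr j → j ∈ J) : comp c A = comp c A' := by
  refine ext_finset fun F => ?_
  rw [comp_comp, comp_comp]
  obtain ⟨d, hd⟩ | ⟨j, hj, d, hd⟩ := exists_factor (c ∘ (Subtype.val : F → κ)) (J := J)
    fun i j => hc _ _
  · rw [hd, ← comp_comp, ← comp_comp, hb]
  · rw [hd, ← comp_comp, ← comp_comp, hJ j hj]

lemma continuous_comp_of_levels {T : Type*} [TopologicalSpace T] {φ : T → Mpcc (ℕ ⊕ N → ℝ)}
    (hb : Continuous fun t => comp Sum.inl (φ t))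
    (hJ : ∀ j ∈ J, Continuous fun t => comp (upto j) (φ t)) (c : κ → ℕ ⊕ N)
    (hc : ∀ i j, c i = Sum.inr j → j ∈ J) : Continuous fun t => comp c (φ t) := by
  refine continuous_of_finset fun F => ?_
  simp_rw [comp_comp]
  obtain ⟨d, hd⟩ | ⟨j, hj, d, hd⟩ := exists_factor (c ∘ (Subtype.val : F → κ)) (J := J)
    fun i j => hc _ _
  · simp_rw [hd, ← comp_comp]
    exact (continuous_comp d).comp hb
  · simp_rw [hd, ← comp_comp]
    exact (continuous_comp d).comp (hJ j hj)

/-- Compatible convex sets over the members of a lower set glue. -/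
lemma exists_glue (hJ : ∀ j ∈ J, ∀ k ≤ j, k ∈ J) (B : Mpcc (ℕ → ℝ))
    (K : N → Mpcc (Option ℕ → ℝ))
    (H : ∀ j ∈ J, ∃ A : Mpcc (ℕ ⊕ N → ℝ), comp Sum.inl A = B ∧ ∀ k ≤ j, comp (upto k) A = K k) :
    ∃ A : Mpcc (ℕ ⊕ N → ℝ), comp Sum.inl A = B ∧ ∀ k ∈ J, comp (upto k) A = K k := by
  classical
  obtain rfl | ⟨j₀, hj₀⟩ := J.eq_empty_or_nonempty
  · refine ⟨comp (Sum.elim id fun _ => 0) B, ?_, by simp⟩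
    rw [comp_comp, Sum.elim_comp_inl, comp_id]
  let R : ℕ ⊕ N → Set ℝ := Sum.elim (fun n => (fun x : ℕ → ℝ => x n) '' (B : Set (ℕ → ℝ)))
    fun k => if k ∈ J then (fun x : Option ℕ → ℝ => x none) '' (K k : Set (Option ℕ → ℝ)) else {0}
  have hRc (i : ℕ ⊕ N) : IsCompact (R i) := by
    obtain n | k := i
    · exact B.isCompact.image (continuous_apply n)
    · by_cases hk : k ∈ J
      · simpa [R, hk] using (K k).isCompact.image (continuous_apply none)
      · simp [R, hk]
  have hRne (i : ℕ ⊕ N) : (R i).Nonempty := by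
    obtain n | k := i
    · exact B.nonempty.image _
    · by_cases hk : k ∈ J
      · simpa [R, hk] using (K k).nonempty
      · simp [R, hk]
  choose p hp using hRne
  let D : Set (ℕ ⊕ N → ℝ) := univ.pi R ∩ {x | x ∘ Sum.inl ∈ B}
  have hDc : IsCompact D := (isCompact_univ_pi hRc).inter_right
    (B.isCompact.isClosed.preimage (f := fun x : ℕ ⊕ N → ℝ => x ∘ Sum.inl)
      (continuous_pi fun i => continuous_apply _))
  have hclosed (j : N) : IsClosed {x : ℕ ⊕ N → ℝ | x ∘ upto j ∈ K j} :=
    (K j).isCompact.isClosed.preimage (f := fun x : ℕ ⊕ N → ℝ => x ∘ upto j)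
      (continuous_pi fun i => continuous_apply _)
  have hlift (k₀ : N) (hk₀ : k₀ ∈ J) (y : Option ℕ → ℝ) (hy : y ∈ K k₀) :
      ((D ∩ {x | x ∘ upto k₀ = y}) ∩ ⋂ j : J, {x | x ∘ upto j.1 ∈ K j.1}).Nonempty := by
    refine IsCompact.inter_iInter_nonempty (hDc.inter_right (isClosed_singleton.preimage
      (f := fun x : ℕ ⊕ N → ℝ => x ∘ upto k₀) (continuous_pi fun i => continuous_apply _)))
      _ (fun j => hclosed j.1) fun u => ?_
    obtain ⟨j, hj, hjk, hju⟩ : ∃ j ∈ J, k₀ ≤ j ∧ ∀ i ∈ u, i.1 ≤ j := by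
      obtain ⟨j, hj⟩ := (insert ⟨k₀, hk₀⟩ u : Finset J).exists_maximal ⟨_, Finset.mem_insert_self _ _⟩
      refine ⟨j.1, j.2, ?_, fun i hi => ?_⟩
      · exact not_lt.1 fun h => (hj.not_gt (Finset.mem_insert_self _ _)) h
      · exact not_lt.1 fun h => (hj.not_gt (Finset.mem_insert_of_mem hi)) h
    obtain ⟨A, hA, hAk⟩ := H j hj
    rw [← hAk k₀ hjk] at hy
    obtain ⟨z, hz, rfl⟩ := mem_comp.1 hy
    let x : ℕ ⊕ N → ℝ := Sum.elim (fun n => z (Sum.inl n))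
      fun k => if k ≤ j then z (Sum.inr k) else p (Sum.inr k)
    have hxz (k : N) (hk : k ≤ j) : x ∘ upto k = z ∘ upto k := by
      ext o
      rcases ho : upto k o with n | l
      · simp [x, ho]
      · simp [x, ho, (le_of_upto_eq_inr ho).trans hk]
    have hxK (k : N) (hk : k ≤ j) : x ∘ upto k ∈ K k := by
      rw [hxz k hk, ← hAk k hk]
      exact comp_mem_comp _ hz
    have hxB : x ∘ Sum.inl ∈ B := by
      have := comp_mem_comp Sum.inl hz
      rwa [hA] at this
    refine ⟨x, ⟨⟨fun i _ => ?_, hxB⟩, hxz k₀ hjk⟩, mem_iInter₂.2 fun i hi => hxK _ (hju i hi)⟩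
    obtain n | k := i
    · exact ⟨_, hxB, rfl⟩
    · by_cases hk : k ≤ j
      · have := hxK k hk
        simp only [R, Sum.elim_inr, hJ j hj k hk, if_true]
        exact ⟨_, this, rfl⟩
      · have : x (Sum.inr k) = p (Sum.inr k) := by simp [x, hk]
        rw [this]
        exact hp _
  let S : Set (ℕ ⊕ N → ℝ) := {x | x ∘ Sum.inl ∈ B ∧ (∀ k ∈ J, x ∘ upto k ∈ K k) ∧
    ∀ k ∉ J, x (Sum.inr k) = 0}
  have hS : S = D ∩ ⋂ j : J, {x | x ∘ upto j.1 ∈ K j.1} := by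
    ext x
    constructor
    · rintro ⟨h1, h2, h3⟩
      refine ⟨⟨fun i _ => ?_, h1⟩, mem_iInter.2 fun j => h2 j.1 j.2⟩
      obtain n | k := i
      · exact ⟨_, h1, rfl⟩
      · by_cases hk : k ∈ J
        · have := h2 k hk
          simp only [R, Sum.elim_inr, hk, if_true]
          exact ⟨_, this, rfl⟩
        · simpa [R, hk] using h3 k hk
    · rintro ⟨⟨h1, h2⟩, h3⟩
      refine ⟨h2, fun k hk => mem_iInter.1 h3 ⟨k, hk⟩, fun k hk => ?_⟩
      simpa [R, hk] using h1 (Sum.inr k) (mem_univ _)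
  have hSlift (k₀ : N) (hk₀ : k₀ ∈ J) (y : Option ℕ → ℝ) (hy : y ∈ K k₀) :
      ∃ x ∈ S, x ∘ upto k₀ = y := by
    obtain ⟨x, ⟨h1, h2⟩, h3⟩ := hlift k₀ hk₀ y hy
    exact ⟨x, hS ▸ ⟨h1, h3⟩, h2⟩
  have hSc : IsCompact S := hS ▸ hDc.inter_right (isClosed_iInter fun j => hclosed j.1)
  have hSne : S.Nonempty := by
    obtain ⟨y, hy⟩ := (K j₀).nonempty
    obtain ⟨x, hx, -⟩ := hSlift j₀ hj₀ y hy
    exact ⟨x, hx⟩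
  refine ⟨⟨⟨⟨S, hSc⟩, hSne⟩, ?_⟩, ?_, ?_⟩
  · rintro a ⟨ha1, ha2, ha3⟩ b ⟨hb1, hb2, hb3⟩ t ht
    refine ⟨B.mp_mem ha1 hb1 ht, fun k hk => (K k).mp_mem (ha2 k hk) (hb2 k hk) ht, fun k hk => ?_⟩
    change max _ _ = _
    rw [ha3 k hk, hb3 k hk]
    simpa using ht
  · refine SetLike.coe_injective (Subset.antisymm ?_ fun b hb => ?_)
    · rintro _ ⟨x, hx, rfl⟩
      exact hx.1
    · obtain ⟨A, hA, hAk⟩ := H j₀ hj₀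
      rw [← hA] at hb
      obtain ⟨z, hz, rfl⟩ := mem_comp.1 hb
      obtain ⟨x, hx, hxz⟩ := hSlift j₀ hj₀ (z ∘ upto j₀) (hAk j₀ le_rfl ▸ comp_mem_comp _ hz)
      refine ⟨x, hx, funext fun n => ?_⟩
      obtain ⟨m, hm⟩ := exists_upto_eq_inl j₀ n
      simpa [hm] using congrFun hxz m
  · refine fun k hk => SetLike.coe_injective (Subset.antisymm ?_ fun y hy => ?_)
    · rintro _ ⟨x, hx, rfl⟩
      exact hx.2.1 k hk
    · obtain ⟨x, hx, h⟩ := hSlift k hk y hy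
      exact ⟨x, hx, h⟩

end Tower

namespace Tower

open Mpcc

variable {N : Type*} [LinearOrder N] [∀ k : N, Countable (Iio k)] {W : Type*} [TopologicalSpace W]

section

variable (h : Mpcc (Option ℕ → ℝ) × W ≃ₜ Mpcc (ℕ → ℝ) × W) (u : N → W) {J : Set N}

/-- The projection of `A` to the coordinates up to `k` is the one prescribed by `u k`. -/
def Good (A : Mpcc (ℕ ⊕ N → ℝ)) (k : N) : Prop :=
  comp (upto k) A = (h.symm (comp (pre k) A, u k)).1

variable {h u}

lemma comp_pre_congr {A A' : Mpcc (ℕ ⊕ N → ℝ)} {k : N}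
    (hk : comp (upto k) A = comp (upto k) A') : comp (pre k) A = comp (pre k) A' := by
  rw [← upto_comp_some, ← comp_comp, ← comp_comp, hk]

lemma Good.unique [WellFoundedLT N] (hJ : ∀ j ∈ J, ∀ k ≤ j, k ∈ J) {A A' : Mpcc (ℕ ⊕ N → ℝ)}
    (hb : comp Sum.inl A = comp Sum.inl A') (hA : ∀ k ∈ J, Good h u A k)
    (hA' : ∀ k ∈ J, Good h u A' k) (k : N) (hk : k ∈ J) : comp (upto k) A = comp (upto k) A' := by
  induction k using WellFoundedLT.induction with
  | ind k ih =>
    have : comp (pre k) A = comp (pre k) A' :=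
      comp_congr (J := Iio k) hb (fun j hj => ih j hj (hJ k hk j (le_of_lt hj))) _
        fun _ _ => lt_of_pre_eq_inr
    rw [hA k hk, hA' k hk, this]

lemma Good.exists_of_levels [WellFoundedLT N] (hJ : ∀ j ∈ J, ∀ k ≤ j, k ∈ J) (B : Mpcc (ℕ → ℝ))
    (H : ∀ j ∈ J, ∃ A : Mpcc (ℕ ⊕ N → ℝ), comp Sum.inl A = B ∧ ∀ k ≤ j, Good h u A k) :
    ∃ A : Mpcc (ℕ ⊕ N → ℝ), comp Sum.inl A = B ∧ ∀ k ∈ J, Good h u A k := by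
  classical
  have : Nonempty (Mpcc (ℕ ⊕ N → ℝ)) := ⟨comp (Sum.elim id fun _ => 0) B⟩
  choose! A hAB hA using H
  obtain ⟨A', hAB', hA'⟩ := exists_glue hJ B (fun k => comp (upto k) (A k)) fun j hj =>
    ⟨A j, hAB j hj, fun k hk => Good.unique (J := Iic k) (fun i hi l hl => hl.trans hi)
      ((hAB j hj).trans (hAB k (hJ j hj k hk)).symm) (fun i hi => hA j hj i (le_trans hi hk))
      (fun i hi => hA k (hJ j hj k hk) i hi) k le_rfl⟩
  refine ⟨A', hAB', fun k hk => ?_⟩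
  rw [Good, comp_pre_congr (hA' k hk), hA' k hk]
  exact hA k hk k le_rfl

lemma comp_congr_of_range {κ κ' κ'' : Type*} {c : κ' → κ} {d : κ'' → κ} {A A' : Mpcc (κ → ℝ)}
    (hd : comp d A = comp d A') (hcd : ∀ i, ∃ j, d j = c i) : comp c A = comp c A' := by
  choose e he using hcd
  obtain rfl : d ∘ e = c := funext he
  rw [← comp_comp, ← comp_comp, hd]

lemma Good.exists_level [WellFoundedLT N] (hh : ∀ x, (h x).1 = comp some x.1) (B : Mpcc (ℕ → ℝ))
    (i : N) : ∃ A : Mpcc (ℕ ⊕ N → ℝ), comp Sum.inl A = B ∧ ∀ k ≤ i, Good h u A k := by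
  induction i using WellFoundedLT.induction with
  | ind i ih =>
    obtain ⟨A, hA, hAk⟩ := Good.exists_of_levels (J := Iio i) (h := h) (u := u)
      (fun j hj k hk => lt_of_le_of_lt hk hj) B ih
    set K := (h.symm (comp (pre i) A, u i)).1 with hK
    have hK' : comp some K = comp (pre i) A := by
      rw [hK, ← hh, h.apply_symm_apply]
    have hinv : Function.invFun (upto i) ∘ upto i = id :=
      Function.invFun_comp (upto_injective i)
    have h1 : comp (upto i) (comp (Function.invFun (upto i)) K) = K := by
      rw [comp_comp, hinv, comp_id]
    have h2 : comp (pre i) (comp (Function.invFun (upto i)) K) = comp (pre i) A := by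
      rw [← upto_comp_some, ← comp_comp, h1, hK', upto_comp_some]
    refine ⟨comp (Function.invFun (upto i)) K, ?_, fun k hk => ?_⟩
    · rw [← hA]
      exact comp_congr_of_range h2 (exists_pre_eq_inl i)
    · obtain rfl | hk := hk.eq_or_lt
      · rw [Good, h1, h2]
      · have h3 : comp (upto k) (comp (Function.invFun (upto i)) K) = comp (upto k) A :=
          comp_congr_of_range h2 fun o => by
            rcases ho : upto k o with n | j
            · exact exists_pre_eq_inl i n
            · exact exists_pre_eq_inr ((le_of_upto_eq_inr ho).trans_lt hk)
        rw [Good, comp_pre_congr h3, h3]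
        exact hAk k hk

lemma Good.exists_all [WellFoundedLT N] (hh : ∀ x, (h x).1 = comp some x.1) (B : Mpcc (ℕ → ℝ))
    (u : N → W) : ∃ A : Mpcc (ℕ ⊕ N → ℝ), comp Sum.inl A = B ∧ ∀ k, Good h u A k := by
  obtain ⟨A, hA, hAk⟩ := Good.exists_of_levels (J := univ) (h := h) (u := u)
    (fun _ _ _ _ => mem_univ _) B fun i _ => Good.exists_level hh B i
  exact ⟨A, hA, fun k => hAk k (mem_univ k)⟩

lemma Good.ext [WellFoundedLT N] {A A' : Mpcc (ℕ ⊕ N → ℝ)}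
    (hb : comp Sum.inl A = comp Sum.inl A') (hA : ∀ k, Good h u A k)
    (hA' : ∀ k, Good h u A' k) : A = A' := by
  rw [← comp_id A, ← comp_id A']
  exact comp_congr (J := univ) hb (Good.unique (fun _ _ _ _ => mem_univ _) hb
    (fun k _ => hA k) fun k _ => hA' k) id fun _ _ _ => mem_univ _

end

lemma exists_homeomorph [WellFoundedLT N] (h : Mpcc (Option ℕ → ℝ) × W ≃ₜ Mpcc (ℕ → ℝ) × W)
    (hh : ∀ x, (h x).1 = comp some x.1) :
    ∃ g : Mpcc (ℕ ⊕ N → ℝ) × (N → W) ≃ₜ Mpcc (ℕ → ℝ) × (N → W),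
      ∀ x, (g x).1 = comp Sum.inl x.1 := by
  choose S hSB hS using fun (B : Mpcc (ℕ → ℝ)) (u : N → W) => Good.exists_all (N := N) hh B u
  have hup (x : Mpcc (ℕ ⊕ N → ℝ) × (N → W)) (i : N) : h (comp (upto i) x.1, x.2 i) =
      (comp (pre i) x.1, (h (comp (upto i) x.1, x.2 i)).2) :=
    Prod.ext (by rw [hh, comp_comp, upto_comp_some]) rfl
  have hsymm (B : Mpcc (ℕ → ℝ)) (u : N → W) (i : N) : (comp (upto i) (S B u),
      (h.symm (comp (pre i) (S B u), u i)).2) = h.symm (comp (pre i) (S B u), u i) :=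
    Prod.ext (hS B u i) rfl
  have hleft (x : Mpcc (ℕ ⊕ N → ℝ) × (N → W)) :
      S (comp Sum.inl x.1) (fun i => (h (comp (upto i) x.1, x.2 i)).2) = x.1 := by
    refine Good.ext (h := h) (hSB _ _) (hS _ _) fun k => ?_
    rw [Good, ← hup, h.symm_apply_apply]
  have hcont (k : N) : Continuous fun p : Mpcc (ℕ → ℝ) × (N → W) => comp (upto k) (S p.1 p.2) := by
    induction k using WellFoundedLT.induction with
    | ind k ih =>
      simp_rw [fun B u => show comp (upto k) (S B u) = _ from hS B u k]
      have : Continuous fun p : Mpcc (ℕ → ℝ) × (N → W) => comp (pre k) (S p.1 p.2) :=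
        continuous_comp_of_levels (J := Iio k) (by simpa only [hSB] using continuous_fst) ih _
          fun _ _ => lt_of_pre_eq_inr
      fun_prop
  have hcontS : Continuous fun p : Mpcc (ℕ → ℝ) × (N → W) => S p.1 p.2 := by
    have := continuous_comp_of_levels (J := univ) (φ := fun p : Mpcc (ℕ → ℝ) × (N → W) => S p.1 p.2)
      (by simpa only [hSB] using continuous_fst) (fun k _ => hcont k) id fun _ _ _ => mem_univ _
    simpa only [comp_id] using this
  refine ⟨{ toFun := fun x => (comp Sum.inl x.1, fun i => (h (comp (upto i) x.1, x.2 i)).2)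
            invFun := fun p => (S p.1 p.2, fun i => (h.symm (comp (pre i) (S p.1 p.2), p.2 i)).2)
            left_inv := fun x => ?_
            right_inv := fun p => ?_
            continuous_toFun := ?_
            continuous_invFun := ?_ }, fun _ => rfl⟩
  · refine Prod.ext (hleft x) (funext fun i => ?_)
    simp only [hleft]
    rw [← hup, h.symm_apply_apply]
  · refine Prod.ext (hSB _ _) (funext fun i => ?_)
    simp only [hsymm, h.apply_symm_apply]
  · have (i : N) := continuous_comp (upto i)
    have := continuous_comp (Sum.inl : ℕ → ℕ ⊕ N)
    fun_prop
  · have (i : N) := (continuous_comp (pre i)).comp hcontS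
    simp only [Function.comp_def] at this
    fun_prop

end Tower

/-! ### Cylinders over open sets -/

/-- Restriction of a homeomorphism of products to subsets of the first factors. -/
def Homeomorph.subtypeFst {X X' Y Y' : Type*} [TopologicalSpace X] [TopologicalSpace X']
    [TopologicalSpace Y] [TopologicalSpace Y'] (g : X × Y ≃ₜ X' × Y') {p : X → Prop}
    {q : X' → Prop} (h : ∀ x, p x.1 ↔ q (g x).1) : {x // p x} × Y ≃ₜ {x // q x} × Y' where
  toFun x := (⟨(g (x.1.1, x.2)).1, (h _).1 x.1.2⟩, (g (x.1.1, x.2)).2)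
  invFun x := (⟨(g.symm (x.1.1, x.2)).1, (h _).2 (by rw [g.apply_symm_apply]; exact x.1.2)⟩,
    (g.symm (x.1.1, x.2)).2)
  left_inv x := by simp
  right_inv x := by simp
  continuous_toFun := by fun_prop
  continuous_invFun := by fun_prop

/-- The factorization of `mpcc_fst_factor` for sets of sequences. -/
lemma exists_option_factor : ∃ h : Mpcc (Option ℕ → ℝ) × (ℕ → ℝ) ≃ₜ Mpcc (ℕ → ℝ) × (ℕ → ℝ),
    ∀ x, (h x).1 = Mpcc.comp some x.1 := by
  obtain ⟨h, hh⟩ := mpcc_fst_factor (X := Sq)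
  let e : Sq × ℝ ≃ₜ (Option ℕ → ℝ) :=
    { toFun := fun p o => o.elim p.2 (Sq.homeo p.1)
      invFun := fun y => (Sq.homeo.symm fun n => y (some n), y none)
      left_inv := fun p => by simp
      right_inv := fun y => by
        ext (_ | n) <;> simp
      continuous_toFun := by
        refine continuous_pi ?_
        rintro (_ | n)
        · exact continuous_snd
        · exact (continuous_apply n).comp (Sq.homeo.continuous.comp continuous_fst)
      continuous_invFun := by
        have := Sq.homeo.symm.continuous
        fun_prop }
  let E : Mpcc (Sq × ℝ) ≃ₜ Mpcc (Option ℕ → ℝ) := Mpcc.mapHomeomorph e fun t a b => by ext (_ | n) <;> rfl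
  let E' : Mpcc Sq ≃ₜ Mpcc (ℕ → ℝ) := Mpcc.mapHomeomorph Sq.homeo fun t a b => rfl
  refine ⟨((E.prodCongr (Homeomorph.refl _)).symm.trans h).trans
    (E'.prodCongr (Homeomorph.refl _)), fun x => ?_⟩
  obtain ⟨y, rfl⟩ := (E.prodCongr (Homeomorph.refl _)).surjective x
  simp only [Homeomorph.trans_apply, Homeomorph.symm_apply_apply]
  change E' (h y).1 = Mpcc.comp some (E y.1)
  rw [hh]
  refine SetLike.coe_injective ?_
  change Sq.homeo '' (Prod.fst '' (y.1 : Set (Sq × ℝ))) = (fun z n => z (some n)) '' (e '' y.1)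
  rw [image_image, image_image]
  rfl

lemma Mpcc.continuous_map_param {X Y S : Type*} [TopologicalSpace X] [MaxPlus X]
    [TopologicalSpace Y] [MaxPlus Y] [TopologicalSpace S] (f : S → X → Y)
    (hf : Continuous fun p : X × S => f p.2 p.1)
    (h : ∀ s t a b, f s (mp t a b) = mp t (f s a) (f s b)) :
    Continuous fun p : Mpcc X × S =>
      map (f p.2) (hf.comp (Continuous.prodMk_left p.2)) (h p.2) p.1 := by
  change Continuous[_, (inferInstance : TopologicalSpace (Mpcc Y))] _
  rw [eq_generateFrom, continuous_generateFrom_iff]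
  rintro _ ⟨U, hU, rfl | rfl⟩
  · refine isOpen_iff_mem_nhds.2 ?_
    rintro ⟨A, s⟩ hA
    obtain ⟨V, V', hV, hV', hAV, hsV, hVV⟩ := generalized_tube_lemma A.isCompact
      (isCompact_singleton (x := s)) (hU.preimage hf) (by
        rintro ⟨x, s'⟩ ⟨hx, rfl⟩
        exact hA ⟨x, hx, rfl⟩)
    filter_upwards [prod_mem_nhds ((isOpen_subset hV).mem_nhds hAV)
      (hV'.mem_nhds (singleton_subset_iff.1 hsV))]
    rintro ⟨A', s'⟩ ⟨hA', hs'⟩ _ ⟨x, hx, rfl⟩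
    exact hVV (show (x, s') ∈ V ×ˢ V' from ⟨hA' hx, hs'⟩)
  · refine isOpen_iff_mem_nhds.2 ?_
    rintro ⟨A, s⟩ ⟨_, ⟨x, hx, rfl⟩, hxU⟩
    obtain ⟨V, V', hV, hV', hxV, hsV, hVV⟩ := generalized_tube_lemma
      (isCompact_singleton (x := x)) (isCompact_singleton (x := s)) (hU.preimage hf) (by
        rintro ⟨x', s'⟩ ⟨rfl, rfl⟩
        exact hxU)
    filter_upwards [prod_mem_nhds
      ((isOpen_inter_nonempty hV).mem_nhds ⟨x, hx, singleton_subset_iff.1 hxV⟩)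
      (hV'.mem_nhds (singleton_subset_iff.1 hsV))]
    rintro ⟨A', s'⟩ ⟨⟨y, hy, hyV⟩, hs'⟩
    exact ⟨_, ⟨y, hy, rfl⟩, hVV (show (y, s') ∈ V ×ˢ V' from ⟨hyV, hs'⟩)⟩

namespace Cylinder

variable {N : Type*}

/-- Translation of the coordinates in `N`. -/
def shift (s : N → ℝ) (x : ℕ ⊕ N → ℝ) : ℕ ⊕ N → ℝ :=
  Sum.elim (fun n => x (Sum.inl n)) fun k => s k + x (Sum.inr k)

lemma shift_mp (s : N → ℝ) (t : ℝ) (a b : ℕ ⊕ N → ℝ) :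
    shift s (mp t a b) = mp t (shift s a) (shift s b) := by
  ext (n | k)
  · rfl
  · change s k + max _ _ = max (s k + _) (t + (s k + _))
    rw [← max_add_add_left, add_left_comm]

lemma continuous_shift : Continuous fun p : (ℕ ⊕ N → ℝ) × (N → ℝ) => shift p.2 p.1 := by
  refine continuous_pi ?_
  rintro (n | k)
  · change Continuous fun p : (ℕ ⊕ N → ℝ) × (N → ℝ) => p.1 (Sum.inl n)
    fun_prop
  · change Continuous fun p : (ℕ ⊕ N → ℝ) × (N → ℝ) => p.2 k + p.1 (Sum.inr k)
    fun_prop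

/-- Translation of convex sets. -/
def shiftSet (s : N → ℝ) (A : Mpcc (ℕ ⊕ N → ℝ)) : Mpcc (ℕ ⊕ N → ℝ) :=
  A.map (shift s) (continuous_shift.comp (Continuous.prodMk_left s)) (shift_mp s)

lemma coe_shiftSet (s : N → ℝ) (A : Mpcc (ℕ ⊕ N → ℝ)) :
    (shiftSet s A : Set (ℕ ⊕ N → ℝ)) = shift s '' A := rfl

lemma continuous_shiftSet :
    Continuous fun p : Mpcc (ℕ ⊕ N → ℝ) × (N → ℝ) => shiftSet p.2 p.1 :=
  Mpcc.continuous_map_param shift continuous_shift shift_mp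

lemma shift_shift (s s' : N → ℝ) (x : ℕ ⊕ N → ℝ) : shift s (shift s' x) = shift (s + s') x := by
  ext (n | k)
  · rfl
  · exact (add_assoc _ _ _).symm

lemma shiftSet_shiftSet (s s' : N → ℝ) (A : Mpcc (ℕ ⊕ N → ℝ)) :
    shiftSet s (shiftSet s' A) = shiftSet (s + s') A :=
  SetLike.coe_injective (by simp only [coe_shiftSet, image_image, shift_shift])

lemma shiftSet_zero (A : Mpcc (ℕ ⊕ N → ℝ)) : shiftSet 0 A = A := by
  have : shift (0 : N → ℝ) = id := by
    ext x (n | k) <;> simp [shift]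
  exact SetLike.coe_injective (by simp [coe_shiftSet, this])

/-- The suprema of the coordinates in `N`. -/
noncomputable def tops (A : Mpcc (ℕ ⊕ N → ℝ)) (k : N) : ℝ :=
  sSup ((fun x : ℕ ⊕ N → ℝ => x (Sum.inr k)) '' A)

lemma continuous_tops : Continuous (tops : Mpcc (ℕ ⊕ N → ℝ) → N → ℝ) :=
  continuous_pi fun _ => Mpcc.continuous_sSup_image (continuous_apply _)

lemma tops_shiftSet (s : N → ℝ) (A : Mpcc (ℕ ⊕ N → ℝ)) : tops (shiftSet s A) = s + tops A := by
  ext k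
  have h := (OrderIso.addLeft (s k)).map_csSup' (A.nonempty.image fun x => x (Sum.inr k))
    (A.isCompact.image (continuous_apply (Sum.inr k))).bddAbove
  rw [image_image] at h
  rw [tops, coe_shiftSet, image_image]
  exact h.symm

/-- The convex sets over `M₀`. -/
abbrev Over (N : Type*) (M₀ : Set (ℕ → ℝ)) : Type _ :=
  {A : Mpcc (ℕ ⊕ N → ℝ) // ∀ a ∈ A, a ∘ Sum.inl ∈ M₀}

variable {M₀ : Set (ℕ → ℝ)}

lemma over_shiftSet (s : N → ℝ) {A : Mpcc (ℕ ⊕ N → ℝ)} (hA : ∀ a ∈ A, a ∘ Sum.inl ∈ M₀) :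
    ∀ a ∈ shiftSet s A, a ∘ Sum.inl ∈ M₀ := by
  rintro _ ⟨a, ha, rfl⟩
  exact hA a ha

/-- A convex set is determined by its suprema and its normalized translate. -/
noncomputable def normalize :
    Over N M₀ ≃ₜ {A : Over N M₀ // tops A.1 = 0} × (N → ℝ) where
  toFun A := (⟨⟨shiftSet (-tops A.1) A.1, over_shiftSet _ A.2⟩, by
    rw [tops_shiftSet, neg_add_cancel]⟩, tops A.1)
  invFun p := ⟨shiftSet p.2 p.1.1.1, over_shiftSet _ p.1.1.2⟩
  left_inv A := Subtype.ext (by simp [shiftSet_shiftSet, shiftSet_zero])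
  right_inv p := by
    have h : tops (shiftSet p.2 p.1.1.1) = p.2 := by rw [tops_shiftSet, p.1.2, add_zero]
    refine Prod.ext (Subtype.ext (Subtype.ext ?_)) h
    simp [h, shiftSet_shiftSet, shiftSet_zero]
  continuous_toFun := by
    have h := continuous_tops (N := N)
    have h' : Continuous fun A : Over N M₀ => shiftSet (-tops A.1) A.1 :=
      continuous_shiftSet.comp
        (continuous_subtype_val.prodMk (h.comp continuous_subtype_val).neg)
    fun_prop
  continuous_invFun := by
    have h' : Continuous fun p : {A : Over N M₀ // tops A.1 = 0} × (N → ℝ) =>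
        shiftSet p.2 p.1.1.1 := continuous_shiftSet.comp
      ((continuous_subtype_val.comp (continuous_subtype_val.comp continuous_fst)).prodMk
        continuous_snd)
    fun_prop

end Cylinder

lemma exists_lipschitz_pos_iff {M : Set Sq} (hM : IsOpen M) :
    ∃ m : Sq → ℝ, LipschitzWith 1 m ∧ ∀ x, 0 < m x ↔ x ∈ M := by
  obtain h | h := Mᶜ.eq_empty_or_nonempty
  · exact ⟨fun _ => 1, LipschitzWith.const' 1, fun x => by simp [compl_empty_iff.1 h]⟩
  · refine ⟨fun x => Metric.infDist x Mᶜ, Metric.lipschitz_infDist_pt _, fun x => ?_⟩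
    rw [← hM.isClosed_compl.notMem_iff_infDist_pos h, notMem_compl_iff]

lemma mpcc_sequence_factor {M₀ : Set (ℕ → ℝ)} (hM₀ : IsOpen M₀) (hne : M₀.Nonempty) :
    Nonempty ({B : Mpcc (ℕ → ℝ) // ∀ b ∈ B, b ∈ M₀} × (ℕ → ℝ) ≃ₜ M₀ × (ℕ → ℝ)) := by
  obtain ⟨m, hm, hmM⟩ := exists_lipschitz_pos_iff (hM₀.preimage Sq.homeo.continuous)
  obtain ⟨z, hz⟩ := hne
  obtain ⟨H⟩ := mpcc_open_factor hm
    ⟨Sq.homeo.symm z, (hmM _).2 (by rwa [mem_preimage, Homeomorph.apply_symm_apply])⟩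
  let E : Mpcc Sq ≃ₜ Mpcc (ℕ → ℝ) := Mpcc.mapHomeomorph Sq.homeo fun t a b => rfl
  let E₁ : {A : Mpcc Sq // ∀ a ∈ A, 0 < m a} ≃ₜ {B : Mpcc (ℕ → ℝ) // ∀ b ∈ B, b ∈ M₀} :=
    E.subtype fun A => by
      constructor
      · rintro h _ ⟨a, ha, rfl⟩
        exact (hmM a).1 (h a ha)
      · exact fun h a ha => (hmM a).2 (h _ ⟨a, ha, rfl⟩)
  let E₂ : {x : Sq // 0 < m x} ≃ₜ M₀ := Sq.homeo.subtype hmM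
  exact ⟨((E₁.prodCongr (.refl _)).symm.trans H).trans (E₂.prodCongr (.refl _))⟩

namespace Cylinder

variable {N : Type*} {M₀ : Set (ℕ → ℝ)}

lemma exists_over_factor [LinearOrder N] [WellFoundedLT N] [∀ k : N, Countable (Iio k)] :
    Nonempty (Over N M₀ × (N → ℕ → ℝ) ≃ₜ
      {B : Mpcc (ℕ → ℝ) // ∀ b ∈ B, b ∈ M₀} × (N → ℕ → ℝ)) := by
  obtain ⟨h, hh⟩ := exists_option_factor
  obtain ⟨g, hg⟩ := Tower.exists_homeomorph (N := N) h hh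
  refine ⟨g.subtypeFst (p := fun A : Mpcc (ℕ ⊕ N → ℝ) => ∀ a ∈ A, a ∘ Sum.inl ∈ M₀) fun x => ?_⟩
  rw [hg]
  constructor
  · rintro h _ ⟨a, ha, rfl⟩
    exact h a ha
  · exact fun h a ha => h _ ⟨a, ha, rfl⟩

/-- The points over `M₀`. -/
def points : {x : ℕ ⊕ N → ℝ // x ∘ Sum.inl ∈ M₀} ≃ₜ M₀ × (N → ℝ) where
  toFun x := (⟨x.1 ∘ Sum.inl, x.2⟩, x.1 ∘ Sum.inr)
  invFun p := ⟨Sum.elim p.1.1 p.2, by simp⟩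
  left_inv x := Subtype.ext (by simp)
  right_inv p := by simp
  continuous_toFun := by
    refine Continuous.prodMk (Continuous.subtype_mk (continuous_pi fun n => ?_) _)
      (continuous_pi fun n => ?_)
    · exact (continuous_apply _).comp continuous_subtype_val
    · exact (continuous_apply _).comp continuous_subtype_val
  continuous_invFun := by
    refine Continuous.subtype_mk (continuous_pi ?_) _
    rintro (n | k)
    · exact (continuous_apply n).comp (continuous_subtype_val.comp continuous_fst)
    · exact (continuous_apply k).comp continuous_snd

lemma nonempty_homeomorph [Infinite N] [LinearOrder N] [WellFoundedLT N]
    [∀ k : N, Countable (Iio k)] (hM₀ : IsOpen M₀) (hne : M₀.Nonempty) :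
    Nonempty (Over N M₀ ≃ₜ {x : ℕ ⊕ N → ℝ // x ∘ Sum.inl ∈ M₀}) := by
  have hN : Cardinal.aleph0 ≤ Cardinal.mk N := Cardinal.aleph0_le_mk N
  obtain ⟨e₁⟩ : Nonempty (N × ℕ ≃ N) := by
    rw [← Cardinal.lift_mk_eq']
    simp
  obtain ⟨e₂⟩ : Nonempty (ℕ ⊕ N ≃ N) := by
    rw [← Cardinal.lift_mk_eq']
    simp [Cardinal.add_eq_right hN hN]
  obtain ⟨e₃⟩ : Nonempty (N ⊕ N ≃ N) := by
    rw [← Cardinal.eq]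
    simp [Cardinal.add_eq_right hN le_rfl]
  let R₁ : (N → ℕ → ℝ) ≃ₜ (N → ℝ) :=
    Homeomorph.piCurry.symm.trans (Homeomorph.piCongrLeft (Y := fun _ => ℝ) e₁)
  let R₂ : (ℕ → ℝ) × (N → ℝ) ≃ₜ (N → ℝ) :=
    Homeomorph.sumArrowHomeomorphProdArrow.symm.trans
      (Homeomorph.piCongrLeft (Y := fun _ => ℝ) e₂)
  let R₃ : (N → ℝ) × (N → ℝ) ≃ₜ (N → ℝ) :=
    Homeomorph.sumArrowHomeomorphProdArrow.symm.trans
      (Homeomorph.piCongrLeft (Y := fun _ => ℝ) e₃)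
  obtain ⟨G⟩ := exists_over_factor (N := N) (M₀ := M₀)
  obtain ⟨H⟩ := mpcc_sequence_factor hM₀ hne
  let absorb {Z : Type _} [TopologicalSpace Z] : (Z × (ℕ → ℝ)) × (N → ℝ) ≃ₜ Z × (N → ℝ) :=
    (Homeomorph.prodAssoc Z (ℕ → ℝ) (N → ℝ)).trans ((Homeomorph.refl Z).prodCongr R₂)
  let S₁ : Over N M₀ ≃ₜ Over N M₀ × (N → ℝ) :=
    normalize.trans (((Homeomorph.refl _).prodCongr R₃.symm).trans
      ((Homeomorph.prodAssoc _ _ _).symm.trans (normalize.symm.prodCongr (Homeomorph.refl _))))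
  let S₂ : Over N M₀ × (N → ℝ) ≃ₜ {B : Mpcc (ℕ → ℝ) // ∀ b ∈ B, b ∈ M₀} × (N → ℝ) :=
    ((Homeomorph.refl _).prodCongr R₁.symm).trans (G.trans ((Homeomorph.refl _).prodCongr R₁))
  let S₃ : {B : Mpcc (ℕ → ℝ) // ∀ b ∈ B, b ∈ M₀} × (N → ℝ) ≃ₜ M₀ × (N → ℝ) :=
    absorb.symm.trans ((H.prodCongr (Homeomorph.refl _)).trans absorb)
  exact ⟨S₁.trans (S₂.trans (S₃.trans points.symm))⟩

end Cylinder

/-! ### Functions on uncountable products -/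

section

variable {ι : Type*} {f : (ι → ℝ) → ℝ}

/-- A continuous function on a product of lines depends on countably many coordinates. -/
lemma Continuous.exists_countable_dependsOn (hf : Continuous f) :
    ∃ C : Set ι, C.Countable ∧ DependsOn f C := by
  classical
  have hbox (n : ℕ) : IsCompact (univ.pi fun _ : ι => Icc (-n : ℝ) n) :=
    isCompact_univ_pi fun _ => isCompact_Icc
  have key (n : ℕ) (a b : ℚ) (hab : a < b) : ∃ (F : Finset ι) (V : Set (F → ℝ)), IsOpen V ∧
      (univ.pi fun _ : ι => Icc (-n : ℝ) n) ∩ {x | (b : ℝ) ≤ f x} ⊆ F.restrict ⁻¹' V ∧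
      F.restrict ⁻¹' V ⊆ {x | (a : ℝ) < f x} :=
    ((hbox n).inter_right (isClosed_le continuous_const hf)).exists_finset_restrict
      (isOpen_lt continuous_const hf) fun x hx =>
        (Rat.cast_lt.2 hab : (a : ℝ) < b).trans_le hx.2
  choose! F V hV h1 h2 using key
  let C : Set ι := ⋃ (n : ℕ) (a : ℚ) (b : ℚ), (F n a b : Set ι)
  have hC : C.Countable := countable_iUnion fun n => countable_iUnion fun a =>
    countable_iUnion fun b => (F n a b).countable_toSet
  have hle (x y : ι → ℝ) (n : ℕ) (hx : ∀ i, |x i| ≤ n) (hxy : ∀ i ∈ C, x i = y i) :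
      f x ≤ f y := by
    by_contra! hlt
    obtain ⟨a, ha, ha'⟩ := exists_rat_btwn hlt
    obtain ⟨b, hb, hb'⟩ := exists_rat_btwn ha'
    have hab : a < b := by exact_mod_cast hb
    have hxV := h1 n a b hab ⟨fun i _ => abs_le.1 (hx i), hb'.le⟩
    have hres : (F n a b).restrict x = (F n a b).restrict y := funext fun i => hxy i
      (mem_iUnion.2 ⟨n, mem_iUnion.2 ⟨a, mem_iUnion.2 ⟨b, i.2⟩⟩⟩)
    rw [mem_preimage, hres] at hxV
    exact lt_asymm ha (h2 n a b hab hxV)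
  let cut (x : ι → ℝ) (G : Finset ι) : ι → ℝ := fun i => if i ∈ G then x i else 0
  have hcut (x : ι → ℝ) : Tendsto (fun G => f (cut x G)) atTop (𝓝 (f x)) := by
    refine (hf.tendsto x).comp (tendsto_pi_nhds.2 fun i => tendsto_const_nhds.congr' ?_)
    filter_upwards [eventually_ge_atTop {i}] with G hG
    simp [cut, Finset.singleton_subset_iff.1 hG]
  have hbdd (x : ι → ℝ) (G : Finset ι) : ∃ n : ℕ, ∀ i, |cut x G i| ≤ n := by
    obtain ⟨n, hn⟩ := exists_nat_ge (∑ i ∈ G, |x i|)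
    refine ⟨n, fun i => ?_⟩
    by_cases hi : i ∈ G
    · simpa [cut, hi] using
        (Finset.single_le_sum (f := fun i => |x i|) (fun _ _ => abs_nonneg _) hi).trans hn
    · simp [cut, hi]
  have hcutle (x y : ι → ℝ) (hxy : ∀ i ∈ C, x i = y i) : f x ≤ f y :=
    le_of_tendsto_of_tendsto' (hcut x) (hcut y) fun G =>
      let ⟨n, hn⟩ := hbdd x G
      hle _ _ n hn fun i hi => by simp [cut, hxy i hi]
  exact ⟨C, hC, fun x y hxy => (hcutle x y hxy).antisymm (hcutle y x fun i hi => (hxy i hi).symm)⟩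

end

lemma exists_equiv_nat_sum {ι : Type*} (hι : Cardinal.mk ι = Cardinal.aleph 1) {C : Set ι}
    (hC : C.Countable) : ∃ D : Set ι, Cardinal.mk D = Cardinal.aleph 1 ∧
      ∃ e : ι ≃ ℕ ⊕ D, ∀ i ∈ C, ∃ n, e i = Sum.inl n := by
  classical
  have hinf : Infinite ι := Cardinal.infinite_iff.2 (hι ▸ Cardinal.aleph0_lt_aleph_one.le)
  let a := Infinite.natEmbedding ι
  have hC' : (C ∪ range a).Countable := hC.union (countable_range a)
  have : Countable ↥(C ∪ range a) := hC'.to_subtype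
  have : Infinite ↥(C ∪ range a) :=
    ((infinite_range_of_injective a.injective).mono subset_union_right).to_subtype
  obtain ⟨b⟩ : Nonempty (↥(C ∪ range a) ≃ ℕ) := nonempty_equiv_of_countable
  refine ⟨(C ∪ range a)ᶜ, ?_, (Equiv.Set.sumCompl (C ∪ range a)).symm.trans
    (b.sumCongr (Equiv.refl _)), fun i hi => ?_⟩
  · rw [← hι]
    refine Cardinal.mk_compl_of_infinite _ ?_
    rw [hι]
    exact (Cardinal.le_aleph0_iff_set_countable.2 hC').trans_lt Cardinal.aleph0_lt_aleph_one
  · rw [Equiv.trans_apply, Equiv.Set.sumCompl_symm_apply_of_mem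
      (show i ∈ C ∪ range a from Or.inl hi)]
    exact ⟨_, rfl⟩

/-- The hyperspace as a space of bundled convex sets. -/
def vietorisHomeomorph {κ : Type*} (M : Set (κ → ℝ)) :
    @Homeomorph {A : Set (κ → ℝ) // A.Nonempty ∧ IsCompact A ∧ MaxPlusConvex A ∧ A ⊆ M}
      {A : Mpcc (κ → ℝ) // ∀ a ∈ A, a ∈ M} (_root_.vietoris _) _ :=
  let := _root_.vietoris
    fun A : Set (κ → ℝ) => A.Nonempty ∧ IsCompact A ∧ MaxPlusConvex A ∧ A ⊆ M
  let E : {A : Set (κ → ℝ) // A.Nonempty ∧ IsCompact A ∧ MaxPlusConvex A ∧ A ⊆ M} ≃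
      {A : Mpcc (κ → ℝ) // ∀ a ∈ A, a ∈ M} :=
    { toFun := fun A => ⟨⟨⟨⟨A.1, A.2.2.1⟩, A.2.1⟩, A.2.2.2.1⟩, A.2.2.2.2⟩
      invFun := fun A => ⟨A.1, A.1.nonempty, A.1.isCompact, A.1.convex, A.2⟩
      left_inv := fun _ => rfl
      right_inv := fun _ => rfl }
  E.toHomeomorphOfIsInducing ⟨by
    change _ = TopologicalSpace.induced E (TopologicalSpace.induced Subtype.val
      (inferInstance : TopologicalSpace (Mpcc (κ → ℝ))))
    rw [Mpcc.eq_generateFrom, induced_compose, induced_generateFrom_eq]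
    change generateFrom _ = _
    congr 1
    ext S
    constructor
    · rintro ⟨U, hU, rfl | rfl⟩
      · exact ⟨_, ⟨U, hU, Or.inl rfl⟩, rfl⟩
      · exact ⟨_, ⟨U, hU, Or.inr rfl⟩, rfl⟩
    · rintro ⟨_, ⟨U, hU, rfl | rfl⟩, rfl⟩
      · exact ⟨U, hU, Or.inl rfl⟩
      · exact ⟨U, hU, Or.inr rfl⟩⟩

/-- Let `ι` have cardinality `ℵ₁` and let `M` be a functionally open subset of `ι → ℝ`,
i.e. `M = f⁻¹((0,1])` for a continuous `f : (ι → ℝ) → [0,1]`. Then the hyperspace of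
nonempty compact max-plus convex subsets of `ι → ℝ` contained in `M`, with the
Vietoris topology, is homeomorphic to `M`. -/
theorem mpcc_functionally_open_homeomorph (ι : Type*)
    (hι : Cardinal.mk ι = Cardinal.aleph 1)
    (M : Set (ι → ℝ)) (f : (ι → ℝ) → ℝ) (hf : Continuous f)
    (hf01 : ∀ x, f x ∈ Set.Icc (0 : ℝ) 1) (hM : M = f ⁻¹' Set.Ioc 0 1) :
    letI : TopologicalSpace
        {A : Set (ι → ℝ) // A.Nonempty ∧ IsCompact A ∧ MaxPlusConvex A ∧ A ⊆ M} :=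
      vietoris _
    Nonempty
      ({A : Set (ι → ℝ) // A.Nonempty ∧ IsCompact A ∧ MaxPlusConvex A ∧ A ⊆ M} ≃ₜ ↥M) := by
  let := vietoris
    fun A : Set (ι → ℝ) => A.Nonempty ∧ IsCompact A ∧ MaxPlusConvex A ∧ A ⊆ M
  have hMf (x : ι → ℝ) : x ∈ M ↔ 0 < f x := by
    rw [hM]
    exact ⟨fun h => h.1, fun h => ⟨h, (hf01 x).2⟩⟩
  obtain rfl | ⟨x₀, hx₀⟩ := M.eq_empty_or_nonempty
  · have : IsEmpty {A : Set (ι → ℝ) //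
        A.Nonempty ∧ IsCompact A ∧ MaxPlusConvex A ∧ A ⊆ (∅ : Set (ι → ℝ))} :=
      ⟨fun A => A.2.1.ne_empty (subset_empty_iff.1 A.2.2.2.2)⟩
    exact ⟨Homeomorph.empty⟩
  obtain ⟨C, hC, hfC⟩ := hf.exists_countable_dependsOn
  obtain ⟨N, hN, e, he⟩ := exists_equiv_nat_sum hι hC
  obtain ⟨_, _, hord⟩ := Cardinal.exists_ord_eq_type_lt N
  have : Infinite N := Cardinal.infinite_iff.2 (hN ▸ Cardinal.aleph0_lt_aleph_one.le)
  have (k : N) : Countable (Iio k) := by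
    rw [← Cardinal.mk_le_aleph0_iff, ← Cardinal.lt_aleph_one_iff, ← hN]
    exact Cardinal.mk_Iio_lt k hord
  let R : (ι → ℝ) ≃ₜ (ℕ ⊕ N → ℝ) := Homeomorph.piCongrLeft (Y := fun _ => ℝ) e
  have hR (x : ι → ℝ) (i : ι) : R x (e i) = x i :=
    Equiv.piCongrLeft_apply_apply (fun _ => ℝ) e x i
  let M₀ : Set (ℕ → ℝ) := {z | 0 < f fun i => Sum.elim z (fun _ => 0) (e i)}
  have hM₀ : IsOpen M₀ := by
    refine isOpen_lt continuous_const (hf.comp (continuous_pi fun i => ?_))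
    rcases e i with n | k
    · exact continuous_apply n
    · exact continuous_const
  have hRM (x : ι → ℝ) : x ∈ M ↔ R x ∘ Sum.inl ∈ M₀ := by
    rw [hMf]
    change _ ↔ 0 < f _
    rw [hfC fun i hi => ?_]
    obtain ⟨n, hn⟩ := he i hi
    rw [hn, Sum.elim_inl, Function.comp_apply, ← hn, hR]
  obtain ⟨G⟩ := Cylinder.nonempty_homeomorph (N := N) hM₀ ⟨_, (hRM x₀).1 hx₀⟩
  let E : Mpcc (ι → ℝ) ≃ₜ Mpcc (ℕ ⊕ N → ℝ) := Mpcc.mapHomeomorph R fun t a b => by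
    ext i
    obtain ⟨j, rfl⟩ := e.surjective i
    change R _ (e j) = max (R a (e j)) (t + R b (e j))
    rw [hR, hR, hR]
    rfl
  let E' : {A : Mpcc (ι → ℝ) // ∀ a ∈ A, a ∈ M} ≃ₜ Cylinder.Over N M₀ := E.subtype fun A => by
    constructor
    · rintro h _ ⟨a, ha, rfl⟩
      exact (hRM a).1 (h a ha)
    · exact fun h a ha => (hRM a).2 (h _ ⟨a, ha, rfl⟩)
  exact ⟨(vietorisHomeomorph M).trans (E'.trans (G.trans (R.subtype hRM).symm))⟩
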